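/- Let T > 0 and let ξ₁(t) < ξ₂(t) be continuous functions on [0,T]. Let u be a classical solution of the linear parabolic equation u_t = a(x,t) u_xx + b(x,t) u_x + c(x,t) u on Ω = {(x,t) : ξ₁(t) < x < ξ₂(t), t ∈ (0,T]} with coefficients satisfying the regularity assumption (1.2), and suppose u(·,t) ≢ 0 on I(t) for every t ∈ [0,T]. Assume (H1) holds for both i = 1,2, (H2) holds at every NZ*-moment of wᵢ(t) := u(ξᵢ(t),t), and (H3) holds at every Z-moment of wᵢ (i = 1,2). Then the number Z(t) of zeros of u(·,t) in I(t) = [ξ₁(t), ξ₂(t)] is finite for every t ∈ (0,T). -/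

import Mathlib

open Set

/-- spatial partial derivative `u_x` -/
noncomputable def pdx (u : ℝ → ℝ → ℝ) (x t : ℝ) : ℝ := deriv (fun y => u y t) x

/-- second spatial partial derivative `u_xx` -/
noncomputable def pdxx (u : ℝ → ℝ → ℝ) (x t : ℝ) : ℝ := deriv (fun y => pdx u y t) x

/-- time partial derivative `u_t` -/
noncomputable def pdt (u : ℝ → ℝ → ℝ) (x t : ℝ) : ℝ := deriv (fun s => u x s) t

/-- the closure of the space-time domain `Ω` -/
def domCl (xi1 xi2 : ℝ → ℝ) (T : ℝ) : Set (ℝ × ℝ) :=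
  {p : ℝ × ℝ | p.2 ∈ Icc (0:ℝ) T ∧ p.1 ∈ Icc (xi1 p.2) (xi2 p.2)}

/-- the domain together with its lateral boundaries -/
def domLat (xi1 xi2 : ℝ → ℝ) (T : ℝ) : Set (ℝ × ℝ) :=
  {p : ℝ × ℝ | p.2 ∈ Ioc (0:ℝ) T ∧ p.1 ∈ Icc (xi1 p.2) (xi2 p.2)}

/-- `u` is a classical solution of `u_t = a u_xx + b u_x + c u` on
`Ω = {(x,t) : ξ₁(t) < x < ξ₂(t), 0 < t ≤ T}`: it is continuous on the closure, its
partial derivatives `u_t, u_x, u_xx` exist and are continuous up to the lateral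
boundaries, and the equation holds. -/
structure IsClassicalSolution (a b c : ℝ → ℝ → ℝ) (xi1 xi2 : ℝ → ℝ) (T : ℝ)
    (u : ℝ → ℝ → ℝ) : Prop where
  cont : ContinuousOn (fun p : ℝ × ℝ => u p.1 p.2) (domCl xi1 xi2 T)
  diff_x : ∀ p ∈ domLat xi1 xi2 T, DifferentiableAt ℝ (fun y => u y p.2) p.1
  diff_xx : ∀ p ∈ domLat xi1 xi2 T, DifferentiableAt ℝ (fun y => pdx u y p.2) p.1
  diff_t : ∀ p ∈ domLat xi1 xi2 T, DifferentiableAt ℝ (fun s => u p.1 s) p.2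
  cont_x : ContinuousOn (fun p : ℝ × ℝ => pdx u p.1 p.2) (domLat xi1 xi2 T)
  cont_xx : ContinuousOn (fun p : ℝ × ℝ => pdxx u p.1 p.2) (domLat xi1 xi2 T)
  cont_t : ContinuousOn (fun p : ℝ × ℝ => pdt u p.1 p.2) (domLat xi1 xi2 T)
  eqn : ∀ p ∈ domLat xi1 xi2 T,
    pdt u p.1 p.2 =
      a p.1 p.2 * pdxx u p.1 p.2 + b p.1 p.2 * pdx u p.1 p.2 + c p.1 p.2 * u p.1 p.2

/-- the regularity assumption (1.2): `a, a⁻¹, a_t, a_x, a_xx, b, b_t, b_x, c ∈ L^∞`,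
with `a > 0` -/
def Reg12 (a b c : ℝ → ℝ → ℝ) (xi1 xi2 : ℝ → ℝ) (T : ℝ) : Prop :=
  ∃ M : ℝ, ∀ p ∈ domLat xi1 xi2 T,
    0 < a p.1 p.2 ∧
    DifferentiableAt ℝ (fun y => a y p.2) p.1 ∧
    DifferentiableAt ℝ (fun y => pdx a y p.2) p.1 ∧
    DifferentiableAt ℝ (fun s => a p.1 s) p.2 ∧
    DifferentiableAt ℝ (fun y => b y p.2) p.1 ∧
    DifferentiableAt ℝ (fun s => b p.1 s) p.2 ∧
    |a p.1 p.2| ≤ M ∧ |(a p.1 p.2)⁻¹| ≤ M ∧ |pdt a p.1 p.2| ≤ M ∧ |pdx a p.1 p.2| ≤ M ∧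
    |pdxx a p.1 p.2| ≤ M ∧ |b p.1 p.2| ≤ M ∧ |pdt b p.1 p.2| ≤ M ∧ |pdx b p.1 p.2| ≤ M ∧
    |c p.1 p.2| ≤ M

/-- the set of zeroes of `u(·,t)` in `I(t) = [ξ₁(t), ξ₂(t)]` -/
def zeroSet (u : ℝ → ℝ → ℝ) (xi1 xi2 : ℝ → ℝ) (t : ℝ) : Set ℝ :=
  {x ∈ Icc (xi1 t) (xi2 t) | u x t = 0}

/-- `Z(t)`: the (extended-natural) number of zeroes of `u(·,t)` in `I(t)` -/
noncomputable def Znum (u : ℝ → ℝ → ℝ) (xi1 xi2 : ℝ → ℝ) (t : ℝ) : ℕ∞ :=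
  (zeroSet u xi1 xi2 t).encard

/-- `u(·,s)` has a multiple (degenerate) zero in `I(s)` -/
def HasMultipleZero (u : ℝ → ℝ → ℝ) (xi1 xi2 : ℝ → ℝ) (s : ℝ) : Prop :=
  ∃ x₀ ∈ Icc (xi1 s) (xi2 s), u x₀ s = 0 ∧ pdx u x₀ s = 0

/-- the boundary trace `wᵢ(t) := u(ξᵢ(t), t)` -/
def bdryTrace (u : ℝ → ℝ → ℝ) (xi : ℝ → ℝ) : ℝ → ℝ := fun t => u (xi t) t

/-- some left neighborhood of `s` consists entirely of N-moments -/
def leftN (w : ℝ → ℝ) (s : ℝ) : Prop := ∃ ε > 0, ∀ t ∈ Ioo (s - ε) s, w t ≠ 0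

/-- some left neighborhood of `s` consists entirely of Z-moments -/
def leftZ (w : ℝ → ℝ) (s : ℝ) : Prop := ∃ ε > 0, ∀ t ∈ Ioo (s - ε) s, w t = 0

/-- some right neighborhood of `s` consists entirely of N-moments -/
def rightN (w : ℝ → ℝ) (s : ℝ) : Prop := ∃ ε > 0, ∀ t ∈ Ioo s (s + ε), w t ≠ 0

/-- some right neighborhood of `s` consists entirely of Z-moments -/
def rightZ (w : ℝ → ℝ) (s : ℝ) : Prop := ∃ ε > 0, ∀ t ∈ Ioo s (s + ε), w t = 0

/-- `s` is an NZN-moment of `w` -/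
def IsNZN (w : ℝ → ℝ) (s : ℝ) : Prop := w s = 0 ∧ leftN w s ∧ rightN w s

/-- `s` is a ZZZ-moment of `w` -/
def IsZZZ (w : ℝ → ℝ) (s : ℝ) : Prop := w s = 0 ∧ leftZ w s ∧ rightZ w s

/-- `s` is an NZZ-moment of `w` -/
def IsNZZ (w : ℝ → ℝ) (s : ℝ) : Prop := w s = 0 ∧ leftN w s ∧ rightZ w s

/-- `s` is a ZZN-moment of `w` -/
def IsZZN (w : ℝ → ℝ) (s : ℝ) : Prop := w s = 0 ∧ leftZ w s ∧ rightN w s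

/-- `s` is an NZ*-moment of `w` -/
def IsNZstar (w : ℝ → ℝ) (s : ℝ) : Prop := w s = 0 ∧ leftN w s

/-- (H1): on every nondegenerate closed interval of Z-moments of the boundary trace `w`,
the boundary curve `ξ` is `C¹` -/
def H1cond (w xi : ℝ → ℝ) (T : ℝ) : Prop :=
  ∀ p q : ℝ, 0 ≤ p → p < q → q ≤ T → (∀ t ∈ Icc p q, w t = 0) → ContDiffOn ℝ 1 xi (Icc p q)

/-- (H2) at an NZ*-moment `s` of `u(ξ(·),·)`, with sign `σ = (-1)^i`:
`ξ'(s-0)` exists, and `σ · u_x(ξ(s),s) ≥ 0` (resp. `≤ 0`) if `u(ξ(t),t) > 0`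
(resp. `< 0`) shortly before `s`. -/
def H2at (u : ℝ → ℝ → ℝ) (xi : ℝ → ℝ) (σ s : ℝ) : Prop :=
  (∃ L : ℝ, HasDerivWithinAt xi L (Iio s) s) ∧
  ((∃ ε > 0, ∀ t ∈ Ioo (s - ε) s, 0 < u (xi t) t) → 0 ≤ σ * pdx u (xi s) s) ∧
  ((∃ ε > 0, ∀ t ∈ Ioo (s - ε) s, u (xi t) t < 0) → σ * pdx u (xi s) s ≤ 0)

/-- (H3) at a Z-moment `s` of `u(ξ(·),·)`, with sign `σ = (-1)^i`:
`σ · u(ξ(t),t) · u(x,s) ≤ 0` for `t` slightly after `s` and `x ∈ I(s)` near (but not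
equal to) `ξ(s)`. -/
def H3at (u : ℝ → ℝ → ℝ) (xi1 xi2 xi : ℝ → ℝ) (σ s : ℝ) : Prop :=
  ∃ ε > 0, ∃ δ > 0, ∀ t ∈ Ioo s (s + ε), ∀ x ∈ Icc (xi1 s) (xi2 s),
    x ≠ xi s → |x - xi s| < δ → σ * (u (xi t) t * u x s) ≤ 0

/-- (H3) at a Z-moment `s` for the left boundary (`i = 1`, one-boundary setting):
`-u(ξ₁(t),t) · u(x,s) ≤ 0` for `t` slightly after `s` and `x` slightly to the right
of `ξ₁(s)`. -/
def H3one (u : ℝ → ℝ → ℝ) (xi : ℝ → ℝ) (s : ℝ) : Prop :=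
  ∃ ε > 0, ∃ δ > 0, ∀ t ∈ Ioo s (s + ε), ∀ x : ℝ,
    xi s < x → x - xi s < δ → -(u (xi t) t) * u x s ≤ 0

set_option linter.all false
set_option maxHeartbeats 1000000
open Filter Topology MeasureTheory
local notation "LIN" => (by linarith)
local notation "POS" => (by positivity)
local notation "FUN" => (by fun_prop)
local notation "OME" => (by omega)
local notation "SIM" => (by simp)
local notation "RIN" => (by ring)
local notation "GCO" => (by gcongr)
local notation "RRR" => Real → Real → Real
local notation "RtR" => Real → Real
local notation:max "JJ" a:max => Icc (-a) a
local notation:max "UC" f:max => fun p : Real × Real => f (Prod.fst p) (Prod.snd p)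

set_option autoImplicit false
structure Ctx (T M : Real) (l r : RtR) (a b c u : RRR) : Prop where
  cl : Continuous l
  cr : Continuous r
  Ta :0 < T
  lt : ∀ t ∈ Icc (0:Real) T, l t < r t
  sol : IsClassicalSolution a b c l r T u
  Mb :1 ≤ M
  ab : ∀ x t,0 < t → t ≤ T → l t ≤ x → x ≤ r t → M⁻¹ ≤ a x t ∧ a x t ≤ M
  bb : ∀ x t,0 < t → t ≤ T → l t ≤ x → x ≤ r t → |b x t| ≤ M
  cb : ∀ x t,0 < t → t ≤ T → l t ≤ x → x ≤ r t → |c x t| ≤ M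
theorem snd_test {f fa : RtR} {x fd : Real} (hm : IsLocalMax f x)
    (ho : ∀ᶠ y in 𝓝 x, HasDerivAt f (fa y) y) (aa : HasDerivAt fa fd x) : fa x =0 ∧ fd ≤0 := by
  have ec : deriv f =ᶠ[𝓝 x] fa := ho.mono fun y hy => hy.deriv
  have af : fa x =0 := hm.hasDerivAt_eq_zero ho.self_of_nhds
  refine ⟨af, ?_⟩
  by_contra hc
  push Not at hc
  have hd : deriv (deriv f) x = fd := by rw [ec.deriv_eq]; exact aa.deriv
  have hmin : IsLocalMin f x := isLocalMin_of_deriv_deriv_pos (by rw [hd]; exact hc)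
    (by rw [ec.self_of_nhds]; exact af) ho.self_of_nhds.continuousAt
  have hcst : f =ᶠ[𝓝 x] fun _ => f x := by
    filter_upwards [hm, hmin] with y ho aa using le_antisymm ho aa
  have : deriv (deriv f) x =0 := by
    have ae : deriv f =ᶠ[𝓝 x] fun _ =>0 := by
      have := hcst.deriv
      simpa using this
    rw [ae.deriv_eq]; simp
  linarith
theorem bar_alg {A B ci e U Ux Uxx E d k ka M : Real} (dm :1 ≤ E) (de :0 < d) (bh :0 < k)
    (Mb :1 ≤ M) (hk : k * |ka| - k ^2 / M + M * k +2 * M <0) (qa : M⁻¹ ≤ A) (qb : |B| ≤ M)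
    (qc : -M ≤ ci) (qc' : ci ≤ M) (hneg' : e * U - d * (E -1) <0)
    (gv : e * Ux = d * (-k * E)) (gw : d * (k ^2 * E) ≤ e * Uxx)
    (ae :0 ≤ (M +1) * (e * U - d * (E -1)) - (e * (A * Uxx + B * Ux + ci * U) - d * (k * ka * E))) :
    False := by
  have Aa :0 < A := lt_of_lt_of_le POS qa
  have ec : e * (A * Uxx + B * Ux + ci * U) =
    A * (e * Uxx) + B * (e * Ux) + ci * (e * U) := RIN
  rw [ec, gv] at ae
  have ag : A * (d * (k ^2 * E)) ≤ A * (e * Uxx) := mul_le_mul_of_nonneg_left gw Aa.le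
  have ah : (ci - (M +1)) * (e * U - d * (E -1)) >0 :=
    mul_pos_of_neg_of_neg LIN hneg'
  have wa : k ^2 / M ≤ A * k ^2 := by
    rw [div_eq_inv_mul]; exact mul_le_mul_of_nonneg_right qa POS
  have wb : B * k ≤ M * k := mul_le_mul_of_nonneg_right (abs_le.1 qb).2 bh.le
  have wf : k * ka ≤ k * |ka| := mul_le_mul_of_nonneg_left (le_abs_self _) bh.le
  have ak :2 * M < A * k ^2 - B * k - k * ka := LIN
  have ap :2 * M * (d * E) < (A * k ^2 - B * k - k * ka) * (d * E) :=
    mul_lt_mul_of_pos_right ak POS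
  have aw : -M * (d * (E -1)) ≤ ci * (d * (E -1)) :=
    mul_le_mul_of_nonneg_right qc (mul_nonneg de.le LIN)
  have bv :0 ≤ M * d := POS
  have io :0 ≤ M * (d * E) := POS
  linarith
theorem left_test {f : RtR} {x d : Real} (h : HasDerivAt f d x)
    (hl : ∀ᶠ y in 𝓝[<] x, f y ≤ f x) :0 ≤ d := by
  have ho := (hasDerivWithinAt_iff_tendsto_slope' (s := Iio x) SIM).1 (h.hasDerivWithinAt)
  refine ge_of_tendsto ho ?_
  filter_upwards [hl, self_mem_nhdsWithin] with y hy hyx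
  rw [slope_def_field]
  exact div_nonneg_of_nonpos LIN (by have : y < x := hyx; linarith)
namespace Ctx
variable {T M : Real} {l r : RtR} {a b c u : RRR} (C : Ctx T M l r a b c u)
include C
theorem mem {x t : Real} (af :0 < t) (ho : t ≤ T) (hl : l t ≤ x) (hr : x ≤ r t) :
    (x, t) ∈ domLat l r T := ⟨⟨af, ho⟩, hl, hr⟩
theorem hx {x t : Real} (af :0 < t) (ho : t ≤ T) (hl : l t ≤ x) (hr : x ≤ r t) :
    HasDerivAt (fun y => u y t) (pdx u x t) x :=
  (C.sol.diff_x (x, t) (C.mem af ho hl hr)).hasDerivAt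
theorem hxx {x t : Real} (af :0 < t) (ho : t ≤ T) (hl : l t ≤ x) (hr : x ≤ r t) :
    HasDerivAt (fun y => pdx u y t) (pdxx u x t) x :=
  (C.sol.diff_xx (x, t) (C.mem af ho hl hr)).hasDerivAt
theorem ht {x t : Real} (af :0 < t) (ho : t ≤ T) (hl : l t ≤ x) (hr : x ≤ r t) :
    HasDerivAt (fun y => u x y) (pdt u x t) t :=
  (C.sol.diff_t (x, t) (C.mem af ho hl hr)).hasDerivAt
theorem eqn {x t : Real} (af :0 < t) (ho : t ≤ T) (hl : l t ≤ x) (hr : x ≤ r t) :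
    pdt u x t = a x t * pdxx u x t + b x t * pdx u x t + c x t * u x t :=
  C.sol.eqn (x, t) (C.mem af ho hl hr)
theorem evx {x t : Real} (af :0 < t) (ho : t ≤ T) (hl : l t < x) (hr : x < r t) :
    ∀ᶠ y in 𝓝 x, HasDerivAt (fun y => u y t) (pdx u y t) y := by
  filter_upwards [lt_mem_nhds hl, gt_mem_nhds hr] with y aa ae
  exact C.hx af ho aa.le ae.le
theorem ext : ∃ v : Real × Real → Real, Continuous v ∧
    ∀ x t,0 ≤ t → t ≤ T → l t ≤ x → x ≤ r t → v (x, t) = u x t := by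
  let s : RtR := fun t => max 0 (min T t)
  have hs : Continuous s := FUN
  have cl := C.cl
  have cr := C.cr
  refine ⟨fun p => u (max (l (s p.2)) (min (r (s p.2)) p.1)) (s p.2), ?_, ?_⟩
  · refine C.sol.cont.comp_continuous
      (f := fun p : Real × Real => (max (l (s p.2)) (min (r (s p.2)) p.1), s p.2)) FUN ?_
    intro p
    have : s p.2 ∈ Icc 0 T := ⟨le_max_left _ _, max_le C.Ta.le (min_le_left _ _)⟩
    refine ⟨this, le_max_left _ _, max_le (C.lt _ this).le (min_le_left _ _)⟩
  · intro x t af ho hl hr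
    have : s t = t := by simp [s, af, ho]
    simp [this, hl, hr]
end Ctx
def AltOn (u : RRR) (e p q t : Real) (n : ℕ) (f : ℕ → Real) : Prop :=
  (∀ i < n, f i ∈ Ioo p q) ∧ (∀ i, i +1 < n → f i < f (i +1)) ∧
    ∀ i < n,0 < e * (-1) ^ i * u (f i) t
namespace Ctx
variable {T M : Real} {l r : RtR} {a b c u : RRR} (C : Ctx T M l r a b c u)
include C
theorem prod {s s' e : Real} (af :0 < s) (hss : s ≤ s') (hT : s' < T) {n : ℕ} (hn :1 ≤ n)
    {α β : RtR} (cα : Continuous α) (cβ : Continuous β)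
    (hα : ∀ τ ∈ Icc s s', l τ ≤ α τ) (hβ : ∀ τ ∈ Icc s s', β τ ≤ r τ)
    (wα : ∀ τ ∈ Icc s s', e * u (α τ) τ ≤0)
    (wβ : ∀ τ ∈ Icc s s', e * (-1) ^ (n -1) * u (β τ) τ ≤0)
    (no : ¬ ∃ f, AltOn u e (α s) (β s) s n f) : ¬ ∃ f, AltOn u e (α s') (β s') s' n f := by
  rintro ⟨f, fa, fd, ff⟩
  obtain ⟨v, vc, hv⟩ := C.ext
  let Lm : Real := n * M +1
  let K : Set (Real × (Fin n → Real)) := {p | p.1 ∈ Icc s s' ∧ (∀ i, p.2 i ∈ Icc (α p.1) (β p.1)) ∧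
    Monotone p.2}
  let Φ : Real × (Fin n → Real) → Real := fun p => Real.exp (-Lm * p.1) *
    ∏ i : Fin n, max 0 (e * (-1) ^ (i : ℕ) * v (p.2 i, p.1))
  have Φc : Continuous Φ := by
    refine Continuous.mul FUN (continuous_finset_prod _ fun i _ => ?_)
    fun_prop
  have fmono : ∀ i j, j < n → i ≤ j → f i ≤ f j := by
    intro i j hj hij
    induction j, hij using Nat.le_induction with
    | base => exact le_rfl
    | succ k hk ih => exact (ih OME).trans (fd k hj).le
  have Kc : IsCompact K := by
    obtain ⟨A, hA⟩ := (isCompact_Icc (a := s) (b := s')).bddBelow_image cα.continuousOn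
    obtain ⟨B, hB⟩ := (isCompact_Icc (a := s) (b := s')).bddAbove_image cβ.continuousOn
    refine IsCompact.of_isClosed_subset
      ((isCompact_Icc (a := s) (b := s')).prod (isCompact_Icc (a := fun _ : Fin n => A) (b := fun _ => B))) ?_ ?_
    · have ec : K = {p | p.1 ∈ Icc s s'} ∩ ({p | ∀ i, p.2 i ∈ Icc (α p.1) (β p.1)} ∩
        {p | ∀ i j, i ≤ j → p.2 i ≤ p.2 j}) := by
        ext p; rfl
      rw [ec]
      refine (isClosed_Icc.preimage continuous_fst).inter (IsClosed.inter ?_ ?_)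
      · simp only [ofPred_forall]
        refine isClosed_iInter fun i => ?_
        exact (isClosed_le (f := fun p : Real × (Fin n → Real) => α p.1) (g := fun p => p.2 i) FUN
          FUN).inter (isClosed_le (f := fun p : Real × (Fin n → Real) => p.2 i)
          (g := fun p => β p.1) FUN FUN)
      · simp only [ofPred_forall]
        refine isClosed_iInter fun i => isClosed_iInter fun j => isClosed_iInter fun _ => ?_
        exact isClosed_le FUN FUN
    · rintro p ⟨ho, aa, ae⟩
      exact ⟨ho, fun i => (hA ⟨_, ho, rfl⟩).trans (aa i).1, fun i => (aa i).2.trans (hB ⟨_, ho, rfl⟩)⟩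
  have vu : ∀ τ ∈ Icc s s', ∀ x ∈ Icc (α τ) (β τ), v (x, τ) = u x τ := fun τ hτ x hx =>
    hv x τ (af.le.trans hτ.1) (hτ.2.trans hT.le) ((hα τ hτ).trans hx.1) (hx.2.trans (hβ τ hτ))
  have hP : ((s', fun i : Fin n => f i) : Real × (Fin n → Real)) ∈ K :=
    ⟨⟨hss, le_rfl⟩, fun i => Ioo_subset_Icc_self (fa i i.2), fun i j hij => fmono i j j.2 hij⟩
  obtain ⟨⟨τ, y⟩, hK, hmax⟩ := Kc.exists_isMaxOn ⟨_, hP⟩ Φc.continuousOn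
  have hpos :0 < Φ (τ, y) := by
    refine lt_of_lt_of_le ?_ (hmax hP)
    refine mul_pos (Real.exp_pos _) (Finset.prod_pos fun i _ => lt_max_of_lt_right ?_)
    show 0 < e * (-1) ^ (i : ℕ) * v (f i, s')
    rw [vu s' ⟨hss, le_rfl⟩ _ (Ioo_subset_Icc_self (fa i i.2))]
    exact ff i i.2
  obtain ⟨hτ, hy, hmono⟩ := hK
  simp only at hτ hy hmono
  have hp : ∀ i : Fin n,0 < e * (-1) ^ (i : ℕ) * v (y i, τ) := by
    intro i
    have ho : ∏ i : Fin n, max 0 (e * (-1) ^ (i : ℕ) * v (y i, τ)) ≠0 := fun h => by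
      simp [Φ, h] at hpos
    have aa := (Finset.prod_ne_zero_iff.1 ho) i (Finset.mem_univ _)
    by_contra ae
    exact aa (max_eq_left (not_lt.1 ae))
  have hp' : ∀ i : Fin n,0 < e * (-1) ^ (i : ℕ) * u (y i) τ := fun i => by
    rw [← vu τ hτ _ (hy i)]; exact hp i
  have hlt : ∀ i j : Fin n, (i : ℕ) +1 = j → y i < y j := by
    intro i j hij
    refine lt_of_le_of_ne (hmono (by rw [Fin.le_def]; omega)) fun h => ?_
    have ho := hp i
    have aa := hp j
    rw [← h, ← hij, pow_succ] at aa
    linarith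
  have hst : StrictMono y := by
    intro i j hij
    have hij' : (i : ℕ) < j := hij
    exact (hlt i ⟨i +1, OME⟩ rfl).trans_le (hmono (by rw [Fin.le_def]; simp; omega))
  have hin : ∀ i : Fin n, y i ∈ Ioo (α τ) (β τ) := by
    intro i
    constructor
    · have ho : α τ < y ⟨0, hn⟩ := by
        refine lt_of_le_of_ne (hy _).1 fun h => ?_
        have := hp' ⟨0, hn⟩
        rw [← h] at this
        simp at this
        linarith [wα τ hτ]
      exact ho.trans_le (hmono (by rw [Fin.le_def]; simp))
    · have ho : y ⟨n -1, OME⟩ < β τ := by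
        refine lt_of_le_of_ne (hy _).2 fun h => ?_
        have := hp' ⟨n -1, OME⟩
        rw [h] at this
        simp at this
        linarith [wβ τ hτ]
      exact (hmono (by rw [Fin.le_def]; simp; omega)).trans_lt ho
  have hsτ : s < τ := by
    refine lt_of_le_of_ne hτ.1 fun h => no ?_
    refine ⟨fun i => if h : i < n then y ⟨i, h⟩ else 0, ?_, ?_, ?_⟩
    · intro i hi; simp only [hi, dif_pos]; rw [h]; exact hin _
    · intro i hi
      have hi' : i < n := OME
      simp only [hi, hi', dif_pos]; exact hlt _ _ rfl
    · intro i hi; simp only [hi, dif_pos]; rw [h]; exact hp' ⟨i, hi⟩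
  have tc :0 < τ := af.trans hsτ
  have τT : τ ≤ T := hτ.2.trans hT.le
  have il : ∀ i, l τ < y i := fun i => (hα τ hτ).trans_lt (hin i).1
  have ir : ∀ i, y i < r τ := fun i => (hin i).2.trans_le (hβ τ hτ)
  have hspace : ∀ i : Fin n, e * (-1) ^ (i : ℕ) * pdt u (y i) τ ≤
      M * (e * (-1) ^ (i : ℕ) * u (y i) τ) := by
    intro i
    set w : Real := e * (-1) ^ (i : ℕ)
    have hlm : IsLocalMax (fun x => w * u x τ) (y i) := by
      have ho : ∀ j : Fin n, i < j → ∀ᶠ x in 𝓝 (y i), x < y j := fun j hj => gt_mem_nhds (hst hj)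
      have aa : ∀ j : Fin n, j < i → ∀ᶠ x in 𝓝 (y i), y j < x := fun j hj => lt_mem_nhds (hst hj)
      have dy : ∀ᶠ x in 𝓝 (y i), ∀ j : Fin n, i < j → x < y j := by
        simp only [eventually_all]; exact ho
      have bq : ∀ᶠ x in 𝓝 (y i), ∀ j : Fin n, j < i → y j < x := by
        simp only [eventually_all]; exact aa
      filter_upwards [dy, bq, lt_mem_nhds (hin i).1, gt_mem_nhds (hin i).2] with x ho aa ae ag
      have hK' : ((τ, Function.update y i x) : Real × (Fin n → Real)) ∈ K := by
        refine ⟨hτ, fun j => ?_, fun j k hjk => ?_⟩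
        · by_cases hj : j = i
          · subst hj; simpa using ⟨ae.le, ag.le⟩
          · simpa [hj] using hy j
        · by_cases hj : j = i
          · by_cases hk : k = i
            · rw [hj, hk]
            · subst hj
              simpa [hk] using (ho k (lt_of_le_of_ne hjk (Ne.symm hk))).le
          · by_cases hk : k = i
            · subst hk
              simpa [hj] using (aa j (lt_of_le_of_ne hjk hj)).le
            · simpa [hj, hk] using hmono hjk
      have ah : Φ (τ, Function.update y i x) ≤ Φ (τ, y) := hmax hK'
      have ak := le_of_mul_le_mul_left ah (Real.exp_pos _)
      simp only at ak
      rw [← Finset.mul_prod_erase _ _ (Finset.mem_univ i),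
        ← Finset.mul_prod_erase Finset.univ (fun j : Fin n => max 0 (e * (-1) ^ (j : ℕ) * v (y j, τ)))
          (Finset.mem_univ i)] at ak
      have ap : ∏ j ∈ Finset.univ.erase i, max 0 (e * (-1) ^ (j : ℕ) * v (Function.update y i x j, τ))
          = ∏ j ∈ Finset.univ.erase i, max 0 (e * (-1) ^ (j : ℕ) * v (y j, τ)) := by
        refine Finset.prod_congr rfl fun j hj => ?_
        rw [Function.update_of_ne (Finset.ne_of_mem_erase hj)]
      rw [ap] at ak
      have aw :0 < ∏ j ∈ Finset.univ.erase i, max 0 (e * (-1) ^ (j : ℕ) * v (y j, τ)) :=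
        Finset.prod_pos fun j _ => lt_max_of_lt_right (hp j)
      have bv := le_of_mul_le_mul_right ak aw
      rw [Function.update_self, max_eq_right (hp i).le, vu τ hτ x ⟨ae.le, ag.le⟩,
        vu τ hτ _ (hy i)] at bv
      exact (le_max_right _ _).trans bv
    have ho : ∀ᶠ x in 𝓝 (y i), HasDerivAt (fun x => w * u x τ) (w * pdx u x τ) x :=
      (C.evx tc τT (il i) (ir i)).mono fun x hx => hx.const_mul w
    obtain ⟨gb, gd⟩ := snd_test hlm ho ((C.hxx tc τT (il i).le (ir i).le).const_mul w)
    have aa := C.eqn tc τT (il i).le (ir i).le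
    have ae := (C.ab _ _ tc τT (il i).le (ir i).le).1
    have ag := (abs_le.1 (C.cb _ _ tc τT (il i).le (ir i).le)).2
    have ah :0 < w * u (y i) τ := hp' i
    have ak :0 < a (y i) τ := lt_of_lt_of_le (by have := C.Mb; positivity) ae
    rw [aa]
    have : w * (a (y i) τ * pdxx u (y i) τ + b (y i) τ * pdx u (y i) τ + c (y i) τ * u (y i) τ)
      = a (y i) τ * (w * pdxx u (y i) τ) + b (y i) τ * (w * pdx u (y i) τ)
        + c (y i) τ * (w * u (y i) τ) := RIN
    rw [this, gb]
    nlinarith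
  have hd : HasDerivAt (fun σ => -Lm * σ + ∑ i : Fin n, Real.log (e * (-1) ^ (i : ℕ) * u (y i) σ))
      (-Lm *1 + ∑ i : Fin n, (e * (-1) ^ (i : ℕ) * pdt u (y i) τ) / (e * (-1) ^ (i : ℕ) * u (y i) τ)) τ := by
    refine ((hasDerivAt_id τ).const_mul _).add (HasDerivAt.fun_sum fun i _ => ?_)
    exact ((C.ht tc τT (il i).le (ir i).le).const_mul _).log (hp' i).ne'
  have hle : ∀ᶠ σ in 𝓝[<] τ, -Lm * σ + ∑ i : Fin n, Real.log (e * (-1) ^ (i : ℕ) * u (y i) σ) ≤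
      -Lm * τ + ∑ i : Fin n, Real.log (e * (-1) ^ (i : ℕ) * u (y i) τ) := by
    have kb : ∀ᶠ σ in 𝓝 τ, ∀ i : Fin n, α σ < y i ∧ y i < β σ ∧
        0 < e * (-1) ^ (i : ℕ) * v (y i, σ) := by
      rw [eventually_all]
      intro i
      have ja : ∀ᶠ σ in 𝓝 τ, α σ < y i := cα.continuousAt.eventually (gt_mem_nhds (hin i).1)
      have jc : ∀ᶠ σ in 𝓝 τ, y i < β σ := cβ.continuousAt.eventually (lt_mem_nhds (hin i).2)
      have jb : ∀ᶠ σ in 𝓝 τ,0 < e * (-1) ^ (i : ℕ) * v (y i, σ) := by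
        have : Continuous fun σ => e * (-1) ^ (i : ℕ) * v (y i, σ) := FUN
        exact this.continuousAt.eventually (lt_mem_nhds (hp i))
      filter_upwards [ja, jc, jb] with σ ho aa ae using ⟨ho, aa, ae⟩
    filter_upwards [nhdsWithin_le_nhds kb, nhdsWithin_le_nhds (lt_mem_nhds hsτ),
      self_mem_nhdsWithin] with σ ho aa ae
    have bw : σ < τ := ae
    have hσ : σ ∈ Icc s s' := ⟨aa.le, bw.le.trans hτ.2⟩
    have hK' : (σ, y) ∈ K := ⟨hσ, fun i => ⟨(ho i).1.le, (ho i).2.1.le⟩, hmono⟩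
    have ah : Φ (σ, y) ≤ Φ (τ, y) := hmax hK'
    have key : ∀ ρ ∈ Icc s s', (∀ i : Fin n,0 < e * (-1) ^ (i : ℕ) * v (y i, ρ)) →
        (∀ i, y i ∈ Icc (α ρ) (β ρ)) →
        0 < Φ (ρ, y) ∧ Real.log (Φ (ρ, y)) = -Lm * ρ + ∑ i : Fin n, Real.log (e * (-1) ^ (i : ℕ) * u (y i) ρ) := by
      intro ρ hρ hq hq'
      have ec : Φ (ρ, y) = Real.exp (-Lm * ρ) * ∏ i : Fin n, (e * (-1) ^ (i : ℕ) * u (y i) ρ) := by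
        simp only [Φ]
        congr 1
        refine Finset.prod_congr rfl fun i _ => ?_
        rw [max_eq_right (hq i).le, vu ρ hρ _ (hq' i)]
      have ed : ∀ i : Fin n,0 < e * (-1) ^ (i : ℕ) * u (y i) ρ := fun i => by
        rw [← vu ρ hρ _ (hq' i)]; exact hq i
      have eg :0 < ∏ i : Fin n, (e * (-1) ^ (i : ℕ) * u (y i) ρ) := Finset.prod_pos fun i _ => ed i
      rw [ec]
      refine ⟨mul_pos (Real.exp_pos _) eg, ?_⟩
      rw [Real.log_mul (Real.exp_pos _).ne' eg.ne', Real.log_exp,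
        Real.log_prod fun i _ => (ed i).ne']
    obtain ⟨qd, qe⟩ := key σ hσ (fun i => (ho i).2.2) fun i => ⟨(ho i).1.le, (ho i).2.1.le⟩
    obtain ⟨qf, qh⟩ := key τ hτ hp hy
    rw [← qe, ← qh]
    exact Real.log_le_log qd ah
  have hfin := left_test hd hle
  have hsum : ∑ i : Fin n, (e * (-1) ^ (i : ℕ) * pdt u (y i) τ) / (e * (-1) ^ (i : ℕ) * u (y i) τ) ≤ n * M := by
    have : ∑ i : Fin n, (e * (-1) ^ (i : ℕ) * pdt u (y i) τ) / (e * (-1) ^ (i : ℕ) * u (y i) τ) ≤ ∑ _i : Fin n, M :=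
      Finset.sum_le_sum fun i _ => (div_le_iff₀ (hp' i)).2 (hspace i)
    simpa using this
  simp only [Lm] at hfin
  linarith
end Ctx
namespace Ctx
variable {T M : Real} {l r : RtR} {a b c u : RRR} (C : Ctx T M l r a b c u)
include C
theorem barrier {p eb X ya ka e : Real} (af :0 < p - eb) (bz :0 ≤ eb) (hT : p < T)
    (dn : X - ya ≤ ka * eb)
    (hl : ∀ σ ∈ Icc (p - eb) p, l σ < ya)
    (hr : ∀ σ ∈ Icc (p - eb) p, ∀ x, ya ≤ x → x ≤ X - ka * (p - σ) → x ≤ r σ)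
    (hr' : ∀ σ ∈ Icc (p - eb) p, ∀ x, ya ≤ x → x < X - ka * (p - σ) → x < r σ)
    (hv : ∀ σ ∈ Icc (p - eb) p, ∀ x, ya ≤ x → x ≤ X - ka * (p - σ) →0 ≤ e * u x σ)
    (hy : ∀ σ ∈ Icc (p - eb) p, ya ≤ r σ ∧ 0 < e * u ya σ) :
    ∃ d >0, ∃ k >0, ∀ x, ya ≤ x → x ≤ X → d * (Real.exp (k * (X - x)) -1) ≤ e * u x p := by
  obtain ⟨v, vc, hvu⟩ := C.ext
  have Mb := C.Mb
  obtain ⟨k, bh, hk⟩ : ∃ k >0, k * |ka| - k ^2 / M + M * k +2 * M <0 := by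
    refine ⟨M * (|ka| + M +2 * M) + M, POS, ?_⟩
    set q := |ka|
    have hq :0 ≤ q := abs_nonneg _
    have : (M * (q + M +2 * M) + M) ^2 / M = (M * (q + M +2 * M) + M) * (q + M +2 * M +1) := by
      field_simp
    rw [this]
    have ho :1 ≤ M * (q + M +2 * M) + M := by nlinarith [mul_nonneg (by linarith :0 ≤ M) hq]
    set k := M * (q + M +2 * M) + M
    have aa : k * q - k * (q + M +2 * M +1) + M * k +2 * M = -(k * (2 * M +1)) +2 * M := RIN
    rw [aa]
    nlinarith
  let ψ : RRR := fun x σ => Real.exp (k * (X - ka * (p - σ) - x)) -1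
  have hI : (Icc (p - eb) p).Nonempty := ⟨p, by constructor <;> linarith⟩
  have vI : ∀ σ ∈ Icc (p - eb) p,0 ≤ σ ∧ σ ≤ T ∧ 0 < σ := fun σ hσ =>
    ⟨by linarith [hσ.1], by linarith [hσ.2], by linarith [hσ.1]⟩
  obtain ⟨sh, bm, hm⟩ := isCompact_Icc.exists_isMinOn hI
    (f := fun σ => e * v (ya, σ)) FUN
  obtain ⟨sj, dz, hM⟩ := isCompact_Icc.exists_isMaxOn hI (f := fun σ => ψ ya σ) FUN
  have ma :0 < e * v (ya, sh) := by
    rw [hvu _ _ (vI _ bm).1 (vI _ bm).2.1 (hl _ bm).le (hy _ bm).1]; exact (hy _ bm).2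
  obtain ⟨d, de, hd⟩ : ∃ d >0, ∀ σ ∈ Icc (p - eb) p, d * ψ ya σ < e * v (ya, σ) := by
    refine ⟨e * v (ya, sh) / (|ψ ya sj| +1), POS, fun σ hσ => ?_⟩
    have ho : ψ ya σ ≤ ψ ya sj := hM hσ
    have aa : e * v (ya, sh) ≤ e * v (ya, σ) := hm hσ
    refine lt_of_lt_of_le ?_ aa
    rw [div_mul_eq_mul_div, div_lt_iff₀ POS]
    have := le_abs_self (ψ ya sj)
    exact mul_lt_mul_of_pos_left LIN ma
  refine ⟨d, de, k, bh, ?_⟩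
  let K : Set (Real × Real) := {q | q.2 ∈ Icc (p - eb) p ∧ ya ≤ q.1 ∧ q.1 ≤ X - ka * (p - q.2)}
  let Φ : Real × Real → Real := fun q => Real.exp (-(M +1) * q.2) * (e * v q - d * ψ q.1 q.2)
  have Kc : IsCompact K := by
    have hB := (isCompact_Icc (a := p - eb) (b := p)).bddAbove_image
      (f := fun σ => X - ka * (p - σ)) FUN
    obtain ⟨B, hB⟩ := hB
    refine IsCompact.of_isClosed_subset ((isCompact_Icc (a := ya) (b := B)).prod
      (isCompact_Icc (a := p - eb) (b := p))) ?_ ?_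
    · refine (isClosed_Icc.preimage continuous_snd).inter (IsClosed.inter
        (isClosed_le (f := fun _ : Real × Real => ya) (g := fun q => q.1) FUN FUN)
        (isClosed_le (f := fun q : Real × Real => q.1) (g := fun q => X - ka * (p - q.2))
          FUN FUN))
    · rintro q ⟨ho, aa, ae⟩
      exact ⟨⟨aa, ae.trans (hB ⟨q.2, ho, rfl⟩)⟩, ho⟩
  have Kv : ∀ q ∈ K, v q = u q.1 q.2 := fun q hq =>
    hvu _ _ (vI _ hq.1).1 (vI _ hq.1).2.1 ((hl _ hq.1).le.trans hq.2.1) (hr _ hq.1 _ hq.2.1 hq.2.2)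
  intro x cm ay
  have hxK : (x, p) ∈ K := ⟨⟨LIN, le_rfl⟩, cm, by simpa using ay⟩
  by_contra! hneg
  obtain ⟨⟨z, τ⟩, hK, hmin⟩ := Kc.exists_isMinOn ⟨_, hxK⟩ (f := Φ) FUN
  have hΦ : Φ (z, τ) <0 := by
    refine lt_of_le_of_lt (hmin hxK) ?_
    refine mul_neg_of_pos_of_neg (Real.exp_pos _) ?_
    rw [Kv _ hxK]
    simp only [ψ]
    simp only [sub_self, mul_zero, sub_zero]
    linarith
  have hneg' : e * v (z, τ) - d * ψ z τ <0 := by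
    by_contra h
    exact absurd (mul_nonneg (Real.exp_pos (-(M +1) * τ)).le (not_lt.1 h)) (not_le.2 hΦ)
  have hzy : ya < z := by
    refine lt_of_le_of_ne hK.2.1 fun h => ?_
    have := hd τ hK.1
    rw [h] at this
    linarith
  have hzX : z < X - ka * (p - τ) := by
    refine lt_of_le_of_ne hK.2.2 fun h => ?_
    have ho := hv τ hK.1 z hK.2.1 hK.2.2
    rw [Kv _ hK] at hneg'
    simp only at hneg' h
    have aa : ψ z τ =0 := by simp only [ψ]; rw [← h]; simp
    rw [aa] at hneg'
    linarith
  have hτ : p - eb < τ := by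
    refine lt_of_le_of_ne hK.1.1 fun h => ?_
    rw [← h] at hzX
    have : ka * (p - (p - eb)) = ka * eb := RIN
    linarith
  have ta := (vI τ hK.1).2.2
  have tT := (vI τ hK.1).2.1
  have zl : l τ < z := (hl τ hK.1).trans hzy
  have zr : z < r τ := hr' τ hK.1 z hK.2.1 hzX
  rw [Kv _ hK] at hneg'
  simp only at hneg'
  set E := Real.exp (k * (X - ka * (p - τ) - z)) with hE
  have dm :1 ≤ E := Real.one_le_exp (by
    have := hzX; exact mul_nonneg bh.le LIN)
  have dψx : ∀ y, HasDerivAt (fun y => ψ y τ) (-k * Real.exp (k * (X - ka * (p - τ) - y))) y := by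
    intro y
    have := (((hasDerivAt_id y).const_sub (X - ka * (p - τ))).const_mul k).exp.sub_const 1
    exact this.congr_deriv (by simp; ring)
  have dψxx : HasDerivAt (fun y => -k * Real.exp (k * (X - ka * (p - τ) - y))) (k ^2 * E) z := by
    have := ((((hasDerivAt_id z).const_sub (X - ka * (p - τ))).const_mul k).exp).const_mul (-k)
    exact this.congr_deriv (by simp [hE]; ring)
  have dψt : HasDerivAt (fun s => ψ z s) (k * ka * E) τ := by
    have := ((((((hasDerivAt_id τ).const_sub p).const_mul ka).const_sub X).sub_const z).const_mul k).exp.sub_const 1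
    exact this.congr_deriv (by simp [hE]; ring)
  have hlm : IsLocalMax (fun y => -(e * u y τ - d * ψ y τ)) z := by
    filter_upwards [lt_mem_nhds hzy, gt_mem_nhds hzX] with y ho aa
    have hK' : (y, τ) ∈ K := ⟨hK.1, ho.le, aa.le⟩
    have ah : Φ (z, τ) ≤ Φ (y, τ) := hmin hK'
    have ak := le_of_mul_le_mul_left ah (Real.exp_pos _)
    rw [Kv _ hK, Kv _ hK'] at ak
    simp only at ak
    linarith
  obtain ⟨gb, gd⟩ := snd_test hlm
    ((C.evx ta tT zl zr).mono fun y hy => ((hy.const_mul e).sub ((dψx y).const_mul d)).neg)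
    (((C.hxx ta tT zl.le zr.le).const_mul e).sub (dψxx.const_mul d)).neg
  have hdt : HasDerivAt (fun s => -(Real.exp (-(M +1) * s) * (e * u z s - d * ψ z s)))
      (-(Real.exp (-(M +1) * τ) * (-(M +1)) * (e * u z τ - d * ψ z τ) +
        Real.exp (-(M +1) * τ) * (e * pdt u z τ - d * (k * ka * E)))) τ := by
    have ho : HasDerivAt (fun s => Real.exp (-(M +1) * s)) (Real.exp (-(M +1) * τ) * (-(M +1))) τ := by
      have := ((hasDerivAt_id τ).const_mul (-(M +1))).exp
      simpa using this
    exact (ho.mul (((C.ht ta tT zl.le zr.le).const_mul e).sub (dψt.const_mul d))).neg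
  have hlt := left_test hdt (by
    have ce : ∀ᶠ s in 𝓝 τ, z < X - ka * (p - s) :=
      (by fun_prop : Continuous fun s => X - ka * (p - s)).continuousAt.eventually (lt_mem_nhds hzX)
    filter_upwards [nhdsWithin_le_nhds ce, nhdsWithin_le_nhds (lt_mem_nhds hτ),
      self_mem_nhdsWithin] with s ho aa ae
    have bw : s < τ := ae
    have hK' : (z, s) ∈ K := ⟨⟨aa.le, bw.le.trans hK.1.2⟩, hzy.le, ho.le⟩
    have ah : Φ (z, τ) ≤ Φ (z, s) := hmin hK'
    simp only [Φ] at ah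
    rw [Kv _ hK, Kv _ hK'] at ah
    simp only at ah
    linarith)
  have ae :0 ≤ (M +1) * (e * u z τ - d * ψ z τ) - (e * pdt u z τ - d * (k * ka * E)) := by
    have hp := Real.exp_pos (-(M +1) * τ)
    by_contra h
    push Not at h
    nlinarith
  have qd := C.eqn ta tT zl.le zr.le
  obtain ⟨qa, qa'⟩ := C.ab _ _ ta tT zl.le zr.le
  have qb := C.bb _ _ ta tT zl.le zr.le
  obtain ⟨qc, qc'⟩ := abs_le.1 (C.cb _ _ ta tT zl.le zr.le)
  have hψ : ψ z τ = E -1 := rfl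
  rw [qd] at ae
  rw [hψ] at hneg' ae
  rw [← hE] at gb
  exact bar_alg dm de bh Mb hk qa qb qc qc' hneg' LIN LIN ae
end Ctx
set_option autoImplicit false
def SG (e : Real) : Prop := e =1 ∨ e = -1
theorem SG.neg {e : Real} (h : SG e) : SG (-e) := by
  rcases h with h | h <;> simp [SG, h]
theorem SG.mul {e d : Real} (h : SG e) (h' : SG d) : SG (e * d) := by
  rcases h with h | h <;> rcases h' with h' | h' <;> simp [SG, h, h']
theorem SG.pow (n : ℕ) : SG ((-1) ^ n) := neg_one_pow_eq_or Real n
theorem SG.eq {e d : Real} (h : SG e) (h' : SG d) : e = d ∨ e = -d := by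
  rcases h with h | h <;> rcases h' with h' | h' <;> simp [h, h']
theorem SG.of {x : Real} (h : x ≠0) : ∃ e, SG e ∧ 0 < e * x := by
  rcases lt_or_gt_of_ne h with h | h
  · exact ⟨-1, Or.inr rfl, LIN⟩
  · exact ⟨1, Or.inl rfl, LIN⟩
section alt
variable {u : RRR} {e p q t : Real} {n : ℕ} {f : ℕ → Real}
theorem AltOn.le (h : AltOn u e p q t n f) {m : ℕ} (hm : m ≤ n) : AltOn u e p q t m f :=
  ⟨fun i hi => h.1 i OME, fun i hi => h.2.1 i OME, fun i hi => h.2.2 i OME⟩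
theorem AltOn.tail (h : AltOn u e p q t (n +1) f) : AltOn u (-e) p q t n (fun i => f (i +1)) :=
  ⟨fun i hi => h.1 _ OME, fun i hi => h.2.1 _ OME, fun i hi => by
    have := h.2.2 (i +1) OME; rw [pow_succ] at this; linarith⟩
theorem AltOn.cons (h : AltOn u e p q t n f) {x : Real} (hx : x ∈ Ioo p q) (hx' :1 ≤ n → x < f 0)
    (hu :0 < -e * u x t) : AltOn u (-e) p q t (n +1) (fun i => if i =0 then x else f (i -1)) := by
  refine ⟨fun i hi => ?_, fun i hi => ?_, fun i hi => ?_⟩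
  · cases i with
    | zero => simpa using hx
    | succ k => simpa using h.1 k OME
  · cases i with
    | zero => simpa using hx' OME
    | succ k => simpa using h.2.1 k OME
  · cases i with
    | zero => simpa using hu
    | succ k => have := h.2.2 k OME; simp [pow_succ]; linarith
theorem AltOn.snoc (h : AltOn u e p q t n f) {x : Real} (hx : x ∈ Ioo p q) (hx' :1 ≤ n → f (n -1) < x)
    (hu :0 < e * (-1) ^ n * u x t) : AltOn u e p q t (n +1) (fun i => if i = n then x else f i) := by
  refine ⟨fun i hi => ?_, fun i hi => ?_, fun i hi => ?_⟩
  · by_cases hi' : i = n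
    · simpa [hi'] using hx
    · simpa [hi'] using h.1 i OME
  · have ho : i ≠ n := OME
    by_cases hi' : i +1 = n
    · have := hx' OME; simp [hi', ho]; rwa [← hi', Nat.add_sub_cancel] at this
    · simpa [hi', ho] using h.2.1 i OME
  · by_cases hi' : i = n
    · simpa [hi'] using hu
    · simpa [hi'] using h.2.2 i OME
theorem alt_zero : AltOn u e p q t 0 f := ⟨SIM, SIM, SIM⟩
def Lpt (u : RRR) (e p t : Real) : Prop := ∀ m, p < m → ∃ x ∈ Ioo p m,0 < e * u x t
def Rpt (u : RRR) (e q t : Real) : Prop := ∀ m, m < q → ∃ x ∈ Ioo m q,0 < e * u x t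
theorem AltOn.consL (hpq : p < q) (h : AltOn u e p q t n f) (hL : Lpt u (-e) p t) :
    ∃ g, AltOn u (-e) p q t (n +1) g := by
  by_cases hn :1 ≤ n
  · obtain ⟨x, hx, hu⟩ := hL (f 0) (h.1 0 hn).1
    exact ⟨_, h.cons ⟨hx.1, hx.2.trans (h.1 0 hn).2⟩ (fun _ => hx.2) hu⟩
  · obtain ⟨x, hx, hu⟩ := hL q hpq
    exact ⟨_, h.cons hx (fun h => absurd h hn) hu⟩
theorem AltOn.snocR (hpq : p < q) (h : AltOn u e p q t n f) (hL : Rpt u (e * (-1) ^ n) q t) :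
    ∃ g, AltOn u e p q t (n +1) g := by
  by_cases hn :1 ≤ n
  · obtain ⟨x, hx, hu⟩ := hL (f (n -1)) (h.1 _ OME).2
    exact ⟨_, h.snoc ⟨(h.1 _ OME).1.trans hx.1, hx.2⟩ (fun _ => hx.1) hu⟩
  · obtain ⟨x, hx, hu⟩ := hL p hpq
    exact ⟨_, h.snoc hx (fun h => absurd h hn) hu⟩
theorem sgnL (hpq : p < q) (no : ∃ e, SG e ∧ ¬ ∃ f, AltOn u e p q t n f)
    (uc : ∀ m, p < m → m ≤ q → ∃ x ∈ Ioo p m, u x t ≠0) :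
    ∃ e, SG e ∧ Lpt u e p t ∧ ∃ m, p < m ∧ ∀ x ∈ Ioo p m,0 ≤ e * u x t := by
  obtain ⟨d, hd, no⟩ := no
  have ho : ∃ e, SG e ∧ ¬ Lpt u (-e) p t := by
    by_contra! hc
    refine no ?_
    clear no
    have : ∀ k, ∀ e, SG e → ∃ f, AltOn u e p q t k f := by
      intro k
      induction k with
      | zero => exact fun e _ => ⟨fun _ =>0, alt_zero⟩
      | succ k ih =>
        intro e he
        obtain ⟨f, hf⟩ := ih (-e) he.neg
        have := hf.consL hpq (by simpa using hc _ he.neg)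
        simpa using this
    exact this n d hd
  obtain ⟨e, he, aa⟩ := ho
  simp only [Lpt] at aa
  push Not at aa
  obtain ⟨m, hm, ae⟩ := aa
  refine ⟨e, he, ?_, m, hm, fun x hx => by have := ae x hx; linarith⟩
  intro m' hm'
  obtain ⟨x, hx, hu⟩ := uc (min q (min m m')) (by simp [hm, hm', hpq]) (min_le_left _ _)
  have ay : x < m := hx.2.trans_le ((min_le_right _ _).trans (min_le_left _ _))
  refine ⟨x, ⟨hx.1, hx.2.trans_le ((min_le_right _ _).trans (min_le_right _ _))⟩, ?_⟩
  have := ae x ⟨hx.1, ay⟩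
  refine lt_of_le_of_ne LIN fun h => ?_
  rcases he with he | he <;> simp [he] at h <;> first | exact hu h | exact hu h.symm
theorem sgnR (hpq : p < q) (no : ∃ e, SG e ∧ ¬ ∃ f, AltOn u e p q t n f)
    (uc : ∀ m, m < q → p ≤ m → ∃ x ∈ Ioo m q, u x t ≠0) :
    ∃ e, SG e ∧ Rpt u e q t ∧ ∃ m, m < q ∧ ∀ x ∈ Ioo m q,0 ≤ e * u x t := by
  obtain ⟨d, hd, no⟩ := no
  have ho : ∃ e, SG e ∧ ¬ Rpt u (-e) q t := by
    by_contra! hc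
    refine no ?_
    clear no
    have : ∀ k, ∃ f, AltOn u d p q t k f := by
      intro k
      induction k with
      | zero => exact ⟨fun _ =>0, alt_zero⟩
      | succ k ih =>
        obtain ⟨f, hf⟩ := ih
        have := hc _ (hd.mul (SG.pow k)).neg
        rw [neg_neg] at this
        exact hf.snocR hpq this
    exact this n
  obtain ⟨e, he, aa⟩ := ho
  simp only [Rpt] at aa
  push Not at aa
  obtain ⟨m, hm, ae⟩ := aa
  refine ⟨e, he, ?_, m, hm, fun x hx => by have := ae x hx; linarith⟩
  intro m' hm'
  obtain ⟨x, hx, hu⟩ := uc (max p (max m m')) (by simp [hm, hm', hpq]) (le_max_left _ _)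
  have ay : m < x := lt_of_le_of_lt ((le_max_left _ _).trans (le_max_right _ _)) hx.1
  refine ⟨x, ⟨lt_of_le_of_lt ((le_max_right _ _).trans (le_max_right _ _)) hx.1, hx.2⟩, ?_⟩
  have := ae x ⟨ay, hx.2⟩
  refine lt_of_le_of_ne LIN fun h => ?_
  rcases he with he | he <;> simp [he] at h <;> first | exact hu h | exact hu h.symm
end alt
theorem real_ind {s tb : Real} {P : Real → Prop} (hs : P s)
    (hr : ∀ t, s ≤ t → t < tb → P t → ∃ δ >0, ∀ τ ∈ Ioo t (t + δ), P τ)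
    (hl : ∀ t, s < t → t ≤ tb → (∀ τ, s ≤ τ → τ < t → P τ) → P t) :
    ∀ t, s ≤ t → t ≤ tb → P t := by
  by_contra! hc
  obtain ⟨t, ho, aa, ae⟩ := hc
  let B : Set Real := {t | s ≤ t ∧ t ≤ tb ∧ ¬ P t}
  have hne : B.Nonempty := ⟨t, ho, aa, ae⟩
  have hbd : BddBelow B := ⟨s, fun x hx => hx.1⟩
  have gb : s ≤ sInf B := le_csInf hne fun x hx => hx.1
  have gd : sInf B ≤ tb := (csInf_le hbd ⟨ho, aa, ae⟩).trans aa
  have gc : ∀ τ, s ≤ τ → τ < sInf B → P τ := by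
    intro τ ai aj
    by_contra h
    exact absurd (csInf_le hbd (show τ ∈ B from ⟨ai, LIN, h⟩)) (not_le.2 aj)
  have gf : P (sInf B) := by
    rcases gb.eq_or_lt with h | h
    · rw [← h]; exact hs
    · exact hl _ h gd gc
  have gh : sInf B < tb := by
    refine lt_of_le_of_ne gd fun h => ?_
    have := csInf_le hbd (show t ∈ B from ⟨ho, aa, ae⟩)
    have : t = sInf B := LIN
    exact ae (this ▸ gf)
  obtain ⟨δ, de, hδ⟩ := hr _ gb gh gf
  obtain ⟨x, hx, hx'⟩ := exists_lt_of_csInf_lt hne (show sInf B < sInf B + δ by linarith)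
  have : sInf B ≤ x := csInf_le hbd hx
  rcases this.eq_or_lt with h | h
  · exact hx.2.2 (h ▸ gf)
  · exact hx.2.2 (hδ x ⟨h, hx'⟩)
set_option autoImplicit false
namespace Ctx
variable {T M : Real} {l r : RtR} {a b c u : RRR} (C : Ctx T M l r a b c u)
include C
theorem pcont {x t e : Real} (af :0 < t) (ho : t < T) (hl : l t < x) (hr : x < r t) (hu :0 < e * u x t) :
    ∀ᶠ σ in 𝓝 t, l σ < x ∧ x < r σ ∧ 0 < e * u x σ := by
  obtain ⟨v, vc, hv⟩ := C.ext
  have ec : ∀ᶠ σ in 𝓝 t, l σ < x := C.cl.continuousAt.eventually (gt_mem_nhds hl)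
  have ed : ∀ᶠ σ in 𝓝 t, x < r σ := C.cr.continuousAt.eventually (lt_mem_nhds hr)
  have eg : ∀ᶠ σ in 𝓝 t,0 < e * v (x, σ) := by
    have : Continuous fun σ => e * v (x, σ) := FUN
    refine this.continuousAt.eventually (lt_mem_nhds ?_)
    show 0 < e * v (x, t)
    rw [hv _ _ af.le ho.le hl.le hr.le]; exact hu
  filter_upwards [ec, ed, eg, lt_mem_nhds af, gt_mem_nhds ho] with σ gb gd gc gf gh
  rw [hv _ _ gf.le gh.le gb.le gd.le] at gc
  exact ⟨gb, gd, gc⟩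
theorem persist {t e : Real} {n : ℕ} {f : ℕ → Real} (af :0 < t) (ho : t < T)
    (h : AltOn u e (l t) (r t) t n f) : ∀ᶠ σ in 𝓝 t, AltOn u e (l σ) (r σ) σ n f := by
  have : ∀ᶠ σ in 𝓝 t, ∀ i ∈ Finset.range n, l σ < f i ∧ f i < r σ ∧ 0 < e * (-1) ^ i * u (f i) σ := by
    rw [Filter.eventually_all_finset]
    intro i hi
    have hi := Finset.mem_range.1 hi
    exact C.pcont af ho (h.1 i hi).1 (h.1 i hi).2 (h.2.2 i hi)
  filter_upwards [this] with σ hσ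
  exact ⟨fun i hi => ⟨(hσ i (Finset.mem_range.2 hi)).1, (hσ i (Finset.mem_range.2 hi)).2.1⟩, h.2.1,
    fun i hi => (hσ i (Finset.mem_range.2 hi)).2.2⟩
theorem wcont : ∃ wa wb : RtR, Continuous wa ∧ Continuous wb ∧ ∀ t,0 ≤ t → t ≤ T →
    wa t = u (l t) t ∧ wb t = u (r t) t := by
  obtain ⟨v, vc, hv⟩ := C.ext
  have := C.cl
  have := C.cr
  refine ⟨fun t => v (l t, t), fun t => v (r t, t), FUN, FUN, fun t af ho => ?_⟩
  have := C.lt t ⟨af, ho⟩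
  exact ⟨hv _ _ af ho le_rfl this.le, hv _ _ af ho this.le le_rfl⟩
theorem hopf2 {q eb y π : Real} (af :0 < q - eb) (bz :0 < eb) (hT : q < T) (hπ : SG π)
    (H : H2at u r 1 q) (bn : u (r q) q =0) (hw : ∀ σ ∈ Ioo (q - eb) q,0 < π * u (r σ) σ)
    (hy : ∀ σ ∈ Icc (q - eb) q, l σ < y ∧ y < r σ ∧ 0 < π * u y σ ∧
      ∀ x ∈ Ioo y (r σ),0 ≤ π * u x σ) : False := by
  obtain ⟨⟨L, hL⟩, H1, H2⟩ := H
  have hux :0 ≤ π * pdx u (r q) q := by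
    rcases hπ with h | h
    · rw [h]; exact H1 ⟨eb, bz, fun t ht => by have := hw t ht; rw [h] at this; linarith⟩
    · have := H2 ⟨eb, bz, fun t ht => by have := hw t ht; rw [h] at this; linarith⟩
      rw [h]; linarith
  have hsl : ∀ᶠ σ in 𝓝[<] q, r q - (|L| +1) * (q - σ) < r σ := by
    have ho := (hasDerivWithinAt_iff_tendsto_slope' (s := Iio q) SIM).1 hL
    filter_upwards [ho.eventually (gt_mem_nhds (show L < |L| +1 by linarith [le_abs_self L])),
      self_mem_nhdsWithin] with σ aa ae
    have ae : σ < q := ae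
    rw [slope_def_field, div_lt_iff_of_neg LIN] at aa
    linarith
  obtain ⟨ec, ip, hsl⟩ : ∃ ec >0, ∀ σ ∈ Ioo (q - ec) q, r q - (|L| +1) * (q - σ) < r σ := by
    obtain ⟨q', hq', h⟩ := (mem_nhdsLT_iff_exists_Ioo_subset).1 hsl
    have hq' : q' < q := hq'
    exact ⟨q - q', LIN, fun σ hσ => h ⟨by linarith [hσ.1], hσ.2⟩⟩
  set ed := min eb (ec /2)
  have ei :0 < ed := POS
  have lb : ed ≤ eb := min_le_left _ _
  have lc : ed ≤ ec /2 := min_le_right _ _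
  have lk := C.lt q ⟨LIN, hT.le⟩
  have hyq := hy q ⟨LIN, le_rfl⟩
  set ka := |L| +1 + (r q - y) / ed
  have dn : |L| +1 ≤ ka := by
    have :0 ≤ (r q - y) / ed := div_nonneg (by linarith [hyq.2.1]) ei.le
    linarith
  have hin : ∀ σ ∈ Icc (q - ed) q, σ ∈ Icc (q - eb) q := fun σ hσ => ⟨by linarith [hσ.1], hσ.2⟩
  have key : ∀ σ ∈ Icc (q - ed) q, r q - ka * (q - σ) ≤ r σ := by
    intro σ hσ
    rcases hσ.2.eq_or_lt with h | h
    · rw [h]; simp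
    · have := hsl σ ⟨by linarith [hσ.1], h⟩
      have aa := mul_le_mul_of_nonneg_right dn (by linarith :0 ≤ q - σ)
      linarith
  have hv : ∀ σ ∈ Icc (q - ed) q, ∀ x, y ≤ x → x ≤ r σ →0 ≤ π * u x σ := by
    intro σ hσ x ho aa
    have ae := hy σ (hin σ hσ)
    rcases ho.eq_or_lt with h | h
    · rw [← h]; exact ae.2.2.1.le
    rcases aa.eq_or_lt with h' | h'
    · rw [h']
      rcases hσ.2.eq_or_lt with ag | ag
      · rw [ag, bn]; simp
      · by_cases ah : q - eb < σ
        · exact (hw σ ⟨ah, ag⟩).le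
        ·
          obtain ⟨v, vc, hvu⟩ := C.ext
          have ak : ∀ᶠ z in 𝓝[<] (r σ),0 ≤ π * v (z, σ) := by
            filter_upwards [Ioo_mem_nhdsLT ae.2.1] with z hz
            rw [hvu z σ (by linarith [hσ.1]) (by linarith [hσ.2]) (by linarith [hz.1]) hz.2.le]
            exact ae.2.2.2 z hz
          have ap : Tendsto (fun z => π * v (z, σ)) (𝓝[<] (r σ)) (𝓝 (π * v (r σ, σ))) :=
            ((by fun_prop : Continuous fun z => π * v (z, σ)).tendsto _).mono_left nhdsWithin_le_nhds
          have aw := ge_of_tendsto ap ak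
          rwa [hvu _ σ (by linarith [hσ.1]) (by linarith [hσ.2]) LIN le_rfl] at aw
    · exact ae.2.2.2 x ⟨h, h'⟩
  obtain ⟨d, de, k, hk, hb⟩ := C.barrier (p := q) (eb := ed) (X := r q) (ya := y) (ka := ka) (e := π)
    LIN ei.le hT
    (by
      have : (r q - y) / ed * ed = r q - y := div_mul_cancel₀ _ ei.ne'
      simp only [ka]
      nlinarith [abs_nonneg L])
    (fun σ hσ => (hy σ (hin σ hσ)).1) (fun σ hσ x _ h => h.trans (key σ hσ))
    (fun σ hσ x _ h => h.trans_le (key σ hσ)) (fun σ hσ x ho h => hv σ hσ x ho (h.trans (key σ hσ)))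
    (fun σ hσ => ⟨(hy σ (hin σ hσ)).2.1.le, (hy σ (hin σ hσ)).2.2.1⟩)
  have hd : HasDerivAt (fun x => -(π * u x q) + d * k * (r q - x)) (-(π * pdx u (r q) q) + d * k * (-1)) (r q) :=
    ((C.hx LIN hT.le lk.le le_rfl).const_mul π).neg.add
      (((hasDerivAt_id (r q)).const_sub (r q)).const_mul (d * k))
  have := left_test hd (by
    filter_upwards [Ioo_mem_nhdsLT hyq.2.1] with x hx
    have ho := hb x hx.1.le hx.2.le
    have aa := Real.add_one_le_exp (k * (r q - x))
    have ae : d * (k * (r q - x)) ≤ d * (Real.exp (k * (r q - x)) -1) :=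
      mul_le_mul_of_nonneg_left LIN de.le
    rw [bn]
    simp
    linarith)
  nlinarith [mul_pos de hk]
theorem gap {t z z' y e : Real} (af :0 < t) (hT : t < T) (hl : l t < z) (hr : z' < r t)
    (hy : y ∈ Ioo z z') (hu : u y t =0) (hz :0 < e * u z t) (hz' :0 < e * u z' t) :
    ∀ᶠ τ in 𝓝[<] t, ∃ x ∈ Ioo z z',0 < -e * u x τ := by
  have hzz := hy.1.trans hy.2
  have ec := C.pcont af hT hl (hzz.trans hr) hz
  have ed := C.pcont af hT (hl.trans hzz) hr hz'
  obtain ⟨q', hq', h⟩ := (mem_nhdsLT_iff_exists_Ioo_subset).1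
    (nhdsWithin_le_nhds ((ec.and ed).and (lt_mem_nhds af)))
  have hq' : q' < t := hq'
  filter_upwards [Ioo_mem_nhdsLT hq'] with τ hτ
  by_contra! hc
  have hI : ∀ σ ∈ Icc τ t, (l σ < z ∧ z < r σ ∧ 0 < e * u z σ) ∧ (l σ < z' ∧ z' < r σ ∧ 0 < e * u z' σ) := by
    intro σ hσ
    rcases hσ.2.eq_or_lt with ho | ho
    · rw [ho]; exact ⟨ec.self_of_nhds, ed.self_of_nhds⟩
    · exact (h ⟨hτ.1.trans_le hσ.1, ho⟩).1
  have tc :0 < τ := (h hτ).2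
  have hpos : ∀ σ ∈ Icc τ t, ∀ x, z ≤ x → x ≤ z' →0 ≤ e * u x σ := by
    intro σ hσ x ho aa
    rcases ho.eq_or_lt with ho | ho
    · rw [← ho]; exact (hI σ hσ).1.2.2.le
    rcases aa.eq_or_lt with aa | aa
    · rw [aa]; exact (hI σ hσ).2.2.2.le
    by_contra hn
    refine C.prod (s := τ) (s' := σ) (e := -e) tc hσ.1 (hσ.2.trans_lt hT) (n :=1) le_rfl
      (α := fun _ => z) (β := fun _ => z') continuous_const continuous_const
      (fun ρ hρ => (hI ρ ⟨hρ.1, hρ.2.trans hσ.2⟩).1.1.le) (fun ρ hρ => (hI ρ ⟨hρ.1, hρ.2.trans hσ.2⟩).2.2.1.le)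
      (fun ρ hρ => by have := (hI ρ ⟨hρ.1, hρ.2.trans hσ.2⟩).1.2.2; linarith)
      (fun ρ hρ => by have := (hI ρ ⟨hρ.1, hρ.2.trans hσ.2⟩).2.2.2; simp; linarith) ?_ ?_
    · rintro ⟨f, gb, gd, gc⟩
      have := gc 0 OME
      have := hc (f 0) (gb 0 OME)
      simp at *
      linarith
    · refine ⟨fun _ => x, fun i hi => ⟨ho, aa⟩, fun i hi => by omega, fun i hi => ?_⟩
      have : i =0 := OME
      subst this
      simp
      linarith
  have ht :0 < t - τ := by linarith [hτ.2]
  have hmul : (z' - z) / (t - τ) * (t - τ) = z' - z := div_mul_cancel₀ _ ht.ne'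
  have hkn :0 ≤ (z' - z) / (t - τ) := div_nonneg LIN ht.le
  have hle : ∀ σ ∈ Icc τ t, z' - (z' - z) / (t - τ) * (t - σ) ≤ z' := fun σ hσ => by
    have := mul_nonneg hkn (by linarith [hσ.2] :0 ≤ t - σ)
    linarith
  have heq : t - (t - τ) = τ := RIN
  obtain ⟨d, de, k, hk, hb⟩ := C.barrier (p := t) (eb := t - τ) (X := z') (ya := z)
    (ka := (z' - z) / (t - τ)) (e := e) LIN ht.le hT hmul.ge
    (fun σ hσ => (hI σ (heq ▸ hσ)).1.1)
    (fun σ hσ x _ h => (h.trans (hle σ (heq ▸ hσ))).trans (hI σ (heq ▸ hσ)).2.2.1.le)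
    (fun σ hσ x _ h => (h.trans_le (hle σ (heq ▸ hσ))).trans (hI σ (heq ▸ hσ)).2.2.1)
    (fun σ hσ x ho h => hpos σ (heq ▸ hσ) x ho (h.trans (hle σ (heq ▸ hσ))))
    (fun σ hσ => ⟨(hI σ (heq ▸ hσ)).1.2.1.le, (hI σ (heq ▸ hσ)).1.2.2⟩)
  have ho := hb y hy.1.le hy.2.le
  rw [hu, mul_zero] at ho
  have aa :1 < Real.exp (k * (z' - y)) := Real.one_lt_exp_iff.2 (mul_pos hk (by linarith [hy.2]))
  nlinarith
end Ctx
set_option autoImplicit false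
def NoAlt (u : RRR) (l r : RtR) (t : Real) (n : ℕ) : Prop :=
  ∀ e, SG e → ¬ ∃ f, AltOn u e (l t) (r t) t n f
theorem NoAlt.mono {u : RRR} {l r : RtR} {t : Real} {n m : ℕ} (h : NoAlt u l r t n) (hm : n ≤ m) :
    NoAlt u l r t m := fun e he ⟨f, hf⟩ => h e he ⟨f, hf.le hm⟩
structure Ca (T M : Real) (l r : RtR) (a b c u : RRR) : Prop extends Ctx T M l r a b c u where
  uc : ∀ t ∈ Ioo 0 T, ∀ p q, l t ≤ p → p < q → q ≤ r t → ∃ x ∈ Ioo p q, u x t ≠0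
  He : ∀ s ∈ Ioo (0:Real) T, IsNZstar (bdryTrace u r) s → H2at u r 1 s
  Hf : ∀ s ∈ Ioo (0:Real) T, bdryTrace u l s =0 → H3at u l r l (-1) s
  Hg : ∀ s ∈ Ioo (0:Real) T, bdryTrace u r s =0 → H3at u l r r 1 s
namespace Ca
variable {T M : Real} {l r : RtR} {a b c u : RRR} (C : Ca T M l r a b c u)
include C
theorem sgn_mul {e x : Real} (he : SG e) (h :0 < e * x) {y : Real} (hy :0 ≤ x * y) :0 ≤ e * y := by
  rcases he with h' | h' <;> rw [h'] at h ⊢ <;> nlinarith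
theorem wd {t pa : Real} (ht : t ∈ Ioo 0 T) (ho : SG pa) (hL : Lpt u pa (l t) t) :
    ∃ δ >0, ∀ τ ∈ Ico t (t + δ),0 ≤ pa * u (l τ) τ := by
  obtain ⟨wa, wb, ce, ch, hw⟩ := C.wcont
  obtain ⟨v, vc, hv⟩ := C.ext
  have lt := C.lt t ⟨ht.1.le, ht.2.le⟩
  by_cases h : u (l t) t =0
  · obtain ⟨ε, ef, δ, da, H⟩ := C.Hf t ht h
    obtain ⟨x, hx, hu⟩ := hL (min (r t) (l t + δ)) (by simp [lt, da])
    have xb := hx.2.trans_le (min_le_left _ _)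
    have xe := hx.2.trans_le (min_le_right _ _)
    refine ⟨ε, ef, fun τ hτ => ?_⟩
    rcases hτ.1.eq_or_lt with h' | h'
    · rw [← h', h]; simp
    have := H τ ⟨h', hτ.2⟩ x ⟨hx.1.le, xb.le⟩ hx.1.ne' (by rw [abs_of_pos] <;> linarith [hx.1])
    exact C.sgn_mul ho hu LIN
  · have aa :0 ≤ pa * v (l t, t) := by
      by_contra hn
      push Not at hn
      have : ∀ᶠ z in 𝓝 (l t), pa * v (z, t) <0 :=
        (by fun_prop : Continuous fun z => pa * v (z, t)).continuousAt.eventually (gt_mem_nhds hn)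
      obtain ⟨m, hm, hm'⟩ := (mem_nhdsGT_iff_exists_Ioo_subset).1 (nhdsWithin_le_nhds this)
      obtain ⟨x, hx, hu⟩ := hL (min (r t) m) (by simp [lt]; exact hm)
      have := hm' ⟨hx.1, hx.2.trans_le (min_le_right _ _)⟩
      have this : pa * v (x, t) <0 := this
      rw [hv x t ht.1.le ht.2.le hx.1.le (hx.2.trans_le (min_le_left _ _)).le] at this
      linarith
    rw [hv _ t ht.1.le ht.2.le le_rfl lt.le] at aa
    have ae :0 < pa * wa t := by
      rw [(hw t ht.1.le ht.2.le).1]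
      refine lt_of_le_of_ne aa fun h' => ?_
      rcases ho with ho | ho <;> simp [ho] at h' <;> first | exact h h' | exact h h'.symm
    have ag : ∀ᶠ τ in 𝓝 t,0 < pa * wa τ ∧ 0 < τ ∧ τ < T :=
      ((by fun_prop : Continuous fun z => pa * wa z).continuousAt.eventually (lt_mem_nhds ae)).and
        ((lt_mem_nhds ht.1).and (gt_mem_nhds ht.2))
    obtain ⟨δ, da, hδ⟩ := Metric.eventually_nhds_iff.1 ag
    refine ⟨δ, da, fun τ hτ => ?_⟩
    have := hδ (y := τ) (by rw [Real.dist_eq, abs_of_nonneg] <;> linarith [hτ.1, hτ.2])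
    rw [(hw τ this.2.1.le this.2.2.le).1] at this
    exact this.1.le
theorem we {t pb : Real} (ht : t ∈ Ioo 0 T) (ho : SG pb) (hL : Rpt u pb (r t) t) :
    ∃ δ >0, (u (r t) t =0 → ∀ τ ∈ Ico t (t + δ), pb * u (r τ) τ ≤0) ∧
      (u (r t) t ≠0 → ∀ τ ∈ Ico t (t + δ),0 < pb * u (r τ) τ) := by
  obtain ⟨wa, wb, ce, ch, hw⟩ := C.wcont
  obtain ⟨v, vc, hv⟩ := C.ext
  have lt := C.lt t ⟨ht.1.le, ht.2.le⟩
  by_cases h : u (r t) t =0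
  · obtain ⟨ε, ef, δ, da, H⟩ := C.Hg t ht h
    obtain ⟨x, hx, hu⟩ := hL (max (l t) (r t - δ)) (by simp [lt, da])
    have xb := lt_of_le_of_lt (le_max_left _ _) hx.1
    have xe := lt_of_le_of_lt (le_max_right _ _) hx.1
    refine ⟨ε, ef, fun _ τ hτ => ?_, fun h' => absurd h h'⟩
    rcases hτ.1.eq_or_lt with h' | h'
    · rw [← h', h]; simp
    have := H τ ⟨h', hτ.2⟩ x ⟨xb.le, hx.2.le⟩ hx.2.ne (by rw [abs_of_neg] <;> linarith [hx.2])
    have := C.sgn_mul ho hu (y := -u (r τ) τ) LIN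
    linarith
  · have aa :0 ≤ pb * v (r t, t) := by
      by_contra hn
      push Not at hn
      have : ∀ᶠ z in 𝓝 (r t), pb * v (z, t) <0 :=
        (by fun_prop : Continuous fun z => pb * v (z, t)).continuousAt.eventually (gt_mem_nhds hn)
      obtain ⟨m, hm, hm'⟩ := (mem_nhdsLT_iff_exists_Ioo_subset).1 (nhdsWithin_le_nhds this)
      obtain ⟨x, hx, hu⟩ := hL (max (l t) m) (by simp [lt]; exact hm)
      have := hm' ⟨lt_of_le_of_lt (le_max_right _ _) hx.1, hx.2⟩
      have this : pb * v (x, t) <0 := this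
      rw [hv x t ht.1.le ht.2.le (lt_of_le_of_lt (le_max_left _ _) hx.1).le hx.2.le] at this
      linarith
    rw [hv _ t ht.1.le ht.2.le lt.le le_rfl] at aa
    have ae :0 < pb * wb t := by
      rw [(hw t ht.1.le ht.2.le).2]
      refine lt_of_le_of_ne aa fun h' => ?_
      rcases ho with ho | ho <;> simp [ho] at h' <;> first | exact h h' | exact h h'.symm
    have ag : ∀ᶠ τ in 𝓝 t,0 < pb * wb τ ∧ 0 < τ ∧ τ < T :=
      ((by fun_prop : Continuous fun z => pb * wb z).continuousAt.eventually (lt_mem_nhds ae)).and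
        ((lt_mem_nhds ht.1).and (gt_mem_nhds ht.2))
    obtain ⟨δ, da, hδ⟩ := Metric.eventually_nhds_iff.1 ag
    refine ⟨δ, da, fun h' => absurd h' h, fun _ τ hτ => ?_⟩
    have := hδ (y := τ) (by rw [Real.dist_eq, abs_of_nonneg] <;> linarith [hτ.1, hτ.2])
    rw [(hw τ this.2.1.le this.2.2.le).2] at this
    exact this.1
theorem pull {t τ e : Real} {n : ℕ} (af :0 < t) (h : t ≤ τ) (hT : τ < T)
    (ho : ∀ σ ∈ Icc t τ, e * u (l σ) σ ≤0)
    (aa :1 ≤ n → ∀ σ ∈ Icc t τ, e * (-1) ^ (n -1) * u (r σ) σ ≤0)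
    (hf : ∃ f, AltOn u e (l τ) (r τ) τ n f) : ∃ f, AltOn u e (l t) (r t) t n f := by
  by_cases hn :1 ≤ n
  · by_contra hc
    exact C.prod af h hT hn C.cl C.cr (fun _ _ => le_rfl) (fun _ _ => le_rfl) ho (aa hn) hc hf
  · have : n =0 := OME
    subst this
    exact ⟨fun _ =>0, alt_zero⟩
theorem reduce {t τ e pa qe : Real} {m : ℕ} (af :0 < t) (h : t ≤ τ) (hT : τ < T) (he : SG e)
    (ao : SG pa) (br : SG qe)
    (ho : ∀ σ ∈ Icc t τ,0 ≤ pa * u (l σ) σ) (aa : ∀ σ ∈ Icc t τ,0 ≤ qe * u (r σ) σ)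
    (hf : ∃ f, AltOn u e (l τ) (r τ) τ (m +2) f) :
    ∃ n, m ≤ n ∧ -pa * (-1) ^ n = qe ∧ ∃ f, AltOn u (-pa) (l t) (r t) t n f := by
  have sd : ∃ f, (e = -pa ∧ AltOn u (-pa) (l τ) (r τ) τ (m +2) f) ∨
      AltOn u (-pa) (l τ) (r τ) τ (m +1) f := by
    obtain ⟨f, hf⟩ := hf
    rcases he.eq ao with h | h
    · exact ⟨_, Or.inr (h ▸ hf.tail)⟩
    · exact ⟨f, Or.inl ⟨h, h ▸ hf⟩⟩
  have sc : ∃ n, m ≤ n ∧ -pa * (-1) ^ n = qe ∧ ∃ f, AltOn u (-pa) (l τ) (r τ) τ n f := by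
    obtain ⟨f, hf⟩ := sd
    have hf : AltOn u (-pa) (l τ) (r τ) τ (m +1) f := by
      rcases hf with h | h
      · exact h.2.le OME
      · exact h
    rcases (ao.neg.mul (SG.pow m)).eq br with h | h
    · exact ⟨m, le_rfl, h, f, hf.le OME⟩
    · exact ⟨m +1, OME, by rw [pow_succ]; linarith, f, hf⟩
  obtain ⟨n, hn, hq, hf⟩ := sc
  refine ⟨n, hn, hq, C.pull af h hT (fun σ hσ => by linarith [ho σ hσ]) (fun hn σ hσ => ?_) hf⟩
  obtain ⟨k, rfl⟩ : ∃ k, n = k +1 := ⟨n -1, OME⟩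
  have := aa σ hσ
  rw [← hq, pow_succ] at this
  simp only [Nat.add_sub_cancel]
  linarith
theorem nohopf {p sa π e : Real} {n : ℕ} {f : ℕ → Real} (af :0 < sa) (hσ : sa < p) (hT : p < T) (hπ : SG π)
    (bn : u (r p) p =0) (hw : ∀ σ ∈ Ico sa p,0 < π * u (r σ) σ)
    (hf : ∀ σ ∈ Icc sa p, AltOn u e (l σ) (r σ) σ (n +1) f) (hs : e * (-1) ^ n = π)
    (hno : ∀ σ ∈ Icc sa p, ¬ ∃ f, AltOn u e (l σ) (r σ) σ (n +2) f) : False := by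
  have hnz : IsNZstar (bdryTrace u r) p := by
    refine ⟨bn, p - sa, LIN, fun t ht h => ?_⟩
    have := hw t ⟨by linarith [ht.1], ht.2⟩
    rw [show u (r t) t =0 from h] at this
    simp at this
  refine C.hopf2 (q := p) (eb := p - sa) (y := f n) (π := π) LIN LIN hT hπ
    (C.He p ⟨LIN, hT⟩ hnz) bn (fun σ hσ' => hw σ ⟨by linarith [hσ'.1], hσ'.2⟩)
    (fun σ hσ' => ?_)
  have hσ'' : σ ∈ Icc sa p := ⟨by linarith [hσ'.1], hσ'.2⟩
  have hf' := hf σ hσ''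
  have hin := hf'.1 n OME
  refine ⟨hin.1, hin.2, hs ▸ hf'.2.2 n OME, fun x hx => ?_⟩
  by_contra hn
  push Not at hn
  exact hno σ hσ'' ⟨_, hf'.snoc (x := x) ⟨hin.1.trans hx.1, hx.2⟩ (fun _ => by simpa using hx.1)
    (by rw [pow_succ, ← mul_assoc, hs]; linarith)⟩
def PK (u : RRR) (l r : RtR) (K : ℕ) (t : Real) : Prop :=
  NoAlt u l r t (K +2) ∧ (u (r t) t =0 → NoAlt u l r t (K +1))
theorem right_step {t : Real} {K : ℕ} (ht : t ∈ Ioo 0 T) (hP : PK u l r K t) :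
    ∃ δ >0, ∀ τ ∈ Ioo t (t + δ), PK u l r K τ := by
  have lt := C.lt t ⟨ht.1.le, ht.2.le⟩
  obtain ⟨pa, ao, hL, -⟩ := sgnL (u := u) (t := t) lt ⟨1, Or.inl rfl, hP.1 1 (Or.inl rfl)⟩
    (fun m ho aa => C.uc t ht _ _ le_rfl ho aa)
  obtain ⟨pb, bi, hR, -⟩ := sgnR (u := u) (t := t) lt ⟨1, Or.inl rfl, hP.1 1 (Or.inl rfl)⟩
    (fun m ho aa => C.uc t ht _ _ aa ho le_rfl)
  obtain ⟨dg, db, en⟩ := C.wd ht ao hL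
  obtain ⟨dh, dc, bo, eo⟩ := C.we ht bi hR
  refine ⟨min (min dg dh) (T - t), by have := ht.2; simp [db, dc]; linarith, ?_⟩
  have hmin : ∀ τ ∈ Ioo t (t + min (min dg dh) (T - t)), τ < T ∧ (∀ σ ∈ Icc t τ,0 ≤ pa * u (l σ) σ) ∧
      ∀ σ ∈ Icc t τ, σ ∈ Ico t (t + dh) := by
    intro τ hτ
    have ai : min (min dg dh) (T - t) ≤ dg := (min_le_left _ _).trans (min_le_left _ _)
    have aj : min (min dg dh) (T - t) ≤ dh := (min_le_left _ _).trans (min_le_right _ _)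
    have ar : min (min dg dh) (T - t) ≤ T - t := min_le_right _ _
    exact ⟨by linarith [hτ.2], fun σ hσ => en σ ⟨hσ.1, by linarith [hτ.2, hσ.2]⟩,
      fun σ hσ => ⟨hσ.1, by linarith [hτ.2, hσ.2]⟩⟩
  have hcons : ∀ n, (∃ f, AltOn u (-pa) (l t) (r t) t n f) → ∃ f, AltOn u pa (l t) (r t) t (n +1) f := by
    rintro n ⟨f, hf⟩
    have := hf.consL lt (by rwa [neg_neg])
    rwa [neg_neg] at this
  intro τ hτ
  obtain ⟨τT, ho, aa⟩ := hmin τ hτ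
  by_cases hw : u (r t) t =0
  · have bp := hP.2 hw
    have ae : ∀ σ ∈ Icc t τ, pb * u (r σ) σ ≤0 := fun σ hσ => bo hw σ (aa σ hσ)
    refine ⟨fun e he hf => ?_, fun hz e he hf => ?_⟩
    · obtain ⟨n, hn, hq, hf⟩ := C.reduce ht.1 hτ.1.le τT he ao bi.neg ho
        (fun σ hσ => by linarith [ae σ hσ]) hf
      obtain ⟨g, hg⟩ := hcons n hf
      exact bp _ ao ⟨g, hg.le OME⟩
    · have hQt : ¬ ∃ f, AltOn u (-pa) (l t) (r t) t K f := fun h => bp _ ao (hcons _ h)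
      have hfK : ∃ f, AltOn u (-pa) (l τ) (r τ) τ K f := by
        obtain ⟨f, hf⟩ := hf
        rcases he.eq ao with h | h
        · exact ⟨_, h ▸ hf.tail⟩
        · exact ⟨f, h ▸ hf.le OME⟩
      have cn : ∀ σ ∈ Icc t τ, -pa * u (l σ) σ ≤0 := fun σ hσ => by linarith [ho σ hσ]
      cases K with
      | zero => exact hQt ⟨fun _ =>0, alt_zero⟩
      | succ k =>
      rcases (ao.neg.mul (SG.pow k)).eq bi with hs | hs
      · exact hQt (C.pull ht.1 hτ.1.le τT cn
          (fun _ σ hσ => by simp only [Nat.add_sub_cancel]; rw [hs]; exact ae σ hσ) hfK)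
      · have hno : ∀ σ ∈ Icc t τ, ¬ ∃ f, AltOn u (-pa) (l σ) (r σ) σ (k +2) f := by
          intro σ hσ h
          refine bp.mono OME _ ao.neg (C.pull ht.1 hσ.1 (hσ.2.trans_lt τT)
            (fun ρ hρ => cn ρ ⟨hρ.1, hρ.2.trans hσ.2⟩) (fun _ ρ hρ => ?_) h)
          have := ae ρ ⟨hρ.1, hρ.2.trans hσ.2⟩
          show -pa * (-1) ^ (k +1) * u (r ρ) ρ ≤0
          rw [pow_succ]
          rw [← mul_assoc, hs]
          linarith
        obtain ⟨wa, wb, ce, ch, hww⟩ := C.wcont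
        have bs : ∀ σ ∈ Icc t τ, wb σ = u (r σ) σ := fun σ hσ =>
          (hww σ (by linarith [ht.1, hσ.1]) (by linarith [hσ.2])).2
        let B : Set Real := {p | p ∈ Icc t τ ∧ ∀ σ ∈ Icc p τ, wb σ =0}
        have hτB : τ ∈ B := ⟨⟨hτ.1.le, le_rfl⟩, fun σ hσ => by
          have : σ = τ := le_antisymm hσ.2 hσ.1
          rw [this, bs τ ⟨hτ.1.le, le_rfl⟩]; exact hz⟩
        have hbd : BddBelow B := ⟨t, fun x hx => hx.1.1⟩
        set p := sInf B
        have hp : p ∈ Icc t τ := ⟨le_csInf ⟨_, hτB⟩ fun x hx => hx.1.1, csInf_le hbd hτB⟩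
        have hpz' : ∀ σ ∈ Ioc p τ, wb σ =0 := fun σ hσ => by
          obtain ⟨x, hx, hx'⟩ := exists_lt_of_csInf_lt ⟨_, hτB⟩ hσ.1
          exact hx.2 σ ⟨hx'.le, hσ.2⟩
        have co : wb p =0 := by
          rcases hp.2.eq_or_lt with h | h
          · rw [h]; exact hτB.2 τ ⟨le_rfl, le_rfl⟩
          · have ap : Tendsto wb (𝓝[>] p) (𝓝 (wb p)) := (ch.tendsto _).mono_left nhdsWithin_le_nhds
            have aw : wb =ᶠ[𝓝[>] p] fun _ =>0 := by
              filter_upwards [Ioo_mem_nhdsGT h] with z hz using hpz' z ⟨hz.1, hz.2.le⟩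
            exact tendsto_nhds_unique ap ((tendsto_congr' aw).2 tendsto_const_nhds)
        have hpz : ∀ σ ∈ Icc p τ, u (r σ) σ =0 := fun σ hσ => by
          rw [← bs σ ⟨hp.1.trans hσ.1, hσ.2⟩]
          rcases hσ.1.eq_or_lt with h | h
          · rw [← h]; exact co
          · exact hpz' σ ⟨h, hσ.2⟩
        have hfp : ∃ f, AltOn u (-pa) (l p) (r p) p (k +1) f :=
          C.pull (ht.1.trans_le hp.1) hp.2 τT (fun σ hσ => cn σ ⟨hp.1.trans hσ.1, hσ.2⟩)
            (fun _ σ hσ => by rw [hpz σ hσ]; simp) hfK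
        rcases hp.1.eq_or_lt with h | h
        · exact hQt (h ▸ hfp)
        · obtain ⟨f, hfp⟩ := hfp
          have pT : p < T := hp.2.trans_lt τT
          obtain ⟨m, hm, hm'⟩ := (mem_nhdsLT_iff_exists_Ioo_subset).1 (nhdsWithin_le_nhds
            (C.persist (h.trans' ht.1) pT hfp))
          have hm : m < p := hm
          obtain ⟨sa, cs, hσn⟩ : ∃ σ ∈ Ioo (max m t) p, wb σ ≠0 := by
            by_contra! hc
            obtain ⟨z, aq, au⟩ := exists_between (show max m t < p by simp [hm, h])
            have htz : t ≤ z := (le_max_right _ _).trans aq.le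
            have : z ∈ B := ⟨⟨htz, au.le.trans hp.2⟩, fun σ hσ => by
              rcases lt_or_ge σ p with h' | h'
              · exact hc σ ⟨aq.trans_le hσ.1, h'⟩
              · rcases h'.eq_or_lt with h' | h'
                · rw [← h']; exact co
                · exact hpz' σ ⟨h', hσ.2⟩⟩
            exact absurd (csInf_le hbd this) (not_le.2 au)
          have hmσ : m < sa := (le_max_left _ _).trans_lt cs.1
          have htσ : t < sa := (le_max_right _ _).trans_lt cs.1
          let D : Set Real := {z | z ∈ Icc sa p ∧ wb z =0}
          have Dc : IsCompact D := by
            have : D = Icc sa p ∩ wb ⁻¹' {0} := rfl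
            rw [this]; exact isCompact_Icc.inter_right (isClosed_singleton.preimage ch)
          have hpD : p ∈ D := ⟨⟨cs.2.le, le_rfl⟩, co⟩
          obtain ⟨q, hq, hqm⟩ := Dc.exists_isLeast ⟨_, hpD⟩
          have hqσ : sa < q := lt_of_le_of_ne hq.1.1 fun h => hσn (h ▸ hq.2)
          have hqt : ∀ σ ∈ Icc sa q, σ ∈ Icc t τ := fun σ hσ =>
            ⟨htσ.le.trans hσ.1, hσ.2.trans (hq.1.2.trans hp.2)⟩
          refine C.nohopf (p := q) (sa := sa) (π := -pb) (e := -pa) (n := k) (f := f)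
            (ht.1.trans htσ) hqσ (hq.1.2.trans_lt pT) bi.neg ?_ ?_ ?_ hs
            (fun σ hσ => hno σ (hqt σ hσ))
          · rw [← bs q (hqt q ⟨hqσ.le, le_rfl⟩)]; exact hq.2
          · intro σ hσ
            have hI := hqt σ ⟨hσ.1, hσ.2.le⟩
            have ah : wb σ ≠0 := fun h => absurd (hqm ⟨⟨hσ.1, hσ.2.le.trans hq.1.2⟩, h⟩) (not_le.2 hσ.2)
            have ak := ae σ hI
            rw [bs σ hI] at ah
            refine lt_of_le_of_ne LIN fun h => ah ?_
            rcases bi with h' | h' <;> rw [h'] at h <;> linarith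
          · intro σ hσ
            rcases (hσ.2.trans hq.1.2).eq_or_lt with h | h
            · rw [h]; exact hfp
            · exact hm' ⟨hmσ.trans_le hσ.1, h⟩
  · have ae : ∀ σ ∈ Icc t τ,0 < pb * u (r σ) σ := fun σ hσ => eo hw σ (aa σ hσ)
    refine ⟨fun e he hf => ?_, fun hz => ?_⟩
    · obtain ⟨n, hn, hq, hf⟩ := C.reduce ht.1 hτ.1.le τT he ao bi ho
        (fun σ hσ => (ae σ hσ).le) hf
      obtain ⟨g, hg⟩ := hcons n hf
      obtain ⟨g', hg'⟩ := hg.snocR lt (by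
        have : pa * (-1) ^ (n +1) = pb := by rw [pow_succ]; linarith
        rwa [this])
      exact hP.1 _ ao ⟨g', hg'.le OME⟩
    · have := ae τ ⟨hτ.1.le, le_rfl⟩
      rw [hz] at this
      simp at this
theorem left_step {s t : Real} {K : ℕ} (af :0 < s) (hst : s < t) (hT : t < T)
    (hP : ∀ τ, s ≤ τ → τ < t → PK u l r K τ) : PK u l r K t := by
  have ev : ∀ n e, (∃ f, AltOn u e (l t) (r t) t n f) → ∃ f, AltOn u e (l t) (r t) t n f ∧
      ∃ m, s ≤ m ∧ m < t ∧ ∀ τ ∈ Icc m t, AltOn u e (l τ) (r τ) τ n f := by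
    rintro n e ⟨f, hf⟩
    obtain ⟨m, hm, hm'⟩ := (mem_nhdsLT_iff_exists_Ioo_subset).1 (nhdsWithin_le_nhds
      (C.persist (af.trans hst) hT hf))
    have hm : m < t := hm
    obtain ⟨z, aq, au⟩ := exists_between (show max m s < t by simp [hm, hst])
    refine ⟨f, hf, z, (le_max_right _ _).trans aq.le, au, fun τ hτ => ?_⟩
    rcases hτ.2.eq_or_lt with h | h
    · rw [h]; exact hf
    · exact hm' ⟨((le_max_left _ _).trans_lt aq).trans_le hτ.1, h⟩
  refine ⟨fun e he hf => ?_, fun hz e he hf => ?_⟩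
  · obtain ⟨f, -, m, ho, aa, ae⟩ := ev _ _ hf
    exact (hP m ho aa).1 e he ⟨f, ae m ⟨le_rfl, aa.le⟩⟩
  · obtain ⟨f, -, m, ho, aa, ae⟩ := ev _ _ hf
    obtain ⟨wa, wb, ce, ch, hww⟩ := C.wcont
    have bo : ∀ σ ∈ Icc m t, wb σ = u (r σ) σ := fun σ hσ =>
      (hww σ (by linarith [hσ.1]) (by linarith [hσ.2])).2
    have hn : ∀ σ ∈ Ico m t, wb σ ≠0 := fun σ hσ h => by
      rw [bo σ ⟨hσ.1, hσ.2.le⟩] at h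
      exact (hP σ (ho.trans hσ.1) hσ.2).2 h e he ⟨f, ae σ ⟨hσ.1, hσ.2.le⟩⟩
    obtain ⟨π, hπ, hπm⟩ := SG.of (hn m ⟨le_rfl, aa⟩)
    have hπ' : ∀ σ ∈ Ico m t,0 < π * wb σ := by
      intro σ hσ
      by_contra hc
      push Not at hc
      have := intermediate_value_Icc' hσ.1 (f := fun z => π * wb z) FUN ⟨hc, hπm.le⟩
      obtain ⟨z, hz, hz'⟩ := this
      refine hn z ⟨hz.1, hz.2.trans_lt hσ.2⟩ ?_
      simp only at hz'
      rcases hπ with h' | h' <;> rw [h'] at hz' <;> linarith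
    rcases (he.mul (SG.pow K)).eq hπ with hs | hs
    · refine C.nohopf (p := t) (sa := m) (π := π) (e := e) (n := K) (f := f) (af.trans_le ho) aa hT hπ
        hz (fun σ hσ => by rw [← bo σ ⟨hσ.1, hσ.2.le⟩]; exact hπ' σ hσ) ae hs (fun σ hσ h => ?_)
      rcases hσ.2.eq_or_lt with h' | h'
      · obtain ⟨f, -, m, ho, aa, ae⟩ := ev _ _ (h' ▸ h)
        exact (hP m ho aa).1 e he ⟨f, ae m ⟨le_rfl, aa.le⟩⟩
      · exact (hP σ (ho.trans hσ.1) h').1 e he h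
    · have ma :0 < m := af.trans_le ho
      have mT : m < T := aa.trans hT
      have lt := C.lt m ⟨ma.le, mT.le⟩
      have hR : Rpt u (e * (-1) ^ (K +1)) (r m) m := by
        have ec : e * (-1) ^ (K +1) = π := by rw [pow_succ, ← mul_assoc, hs]; ring
        rw [ec]
        intro x hx
        obtain ⟨v, vc, hv⟩ := C.ext
        have ah :0 < π * v (r m, m) := by
          rw [hv _ _ ma.le mT.le lt.le le_rfl, ← bo m ⟨le_rfl, aa.le⟩]; exact hπm
        have ak : ∀ᶠ z in 𝓝 (r m),0 < π * v (z, m) :=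
          (by fun_prop : Continuous fun z => π * v (z, m)).continuousAt.eventually (lt_mem_nhds ah)
        have ap := (nhdsWithin_le_nhds ak : _ ∈ 𝓝[<] (r m))
        obtain ⟨z, aq, au⟩ := Filter.nonempty_of_mem (Filter.inter_mem ap (Ioo_mem_nhdsLT
          (show max x (l m) < r m by simp [hx, lt])))
        have aq :0 < π * v (z, m) := aq
        have hzl := (le_max_right _ _).trans au.1.le
        rw [hv _ _ ma.le mT.le hzl au.2.le] at aq
        exact ⟨z, ⟨(le_max_left _ _).trans_lt au.1, au.2⟩, aq⟩
      exact (hP m ho aa).1 e he ((ae m ⟨le_rfl, aa.le⟩).snocR lt hR)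
theorem noalt {s tb : Real} {N : ℕ} (af :0 < s) (hT : tb < T) (hs : NoAlt u l r s N) :
    ∀ t, s ≤ t → t ≤ tb → NoAlt u l r t (N +2) := by
  intro t ho aa
  exact (real_ind (P := PK u l r N) ⟨hs.mono OME, fun _ => hs.mono OME⟩
    (fun t gb gd gc => C.right_step ⟨LIN, LIN⟩ gc)
    (fun t gb gd gc => C.left_step af gb LIN gc) t ho aa).1
theorem final {s t : Real} {N : ℕ} (af :0 < s) (hst : s < t) (hT : t < T) (hs : NoAlt u l r s N) :
    (zeroSet u l r t).Finite := by
  by_contra hinf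
  have hno := C.noalt af hT hs
  have ta := af.trans hst
  have hinf' : ({x ∈ Ioo (l t) (r t) | u x t =0}).Infinite := by
    intro hf
    refine hinf ((hf.union (Set.toFinite {l t, r t})).subset fun x hx => ?_)
    rcases hx.1.1.eq_or_lt with h | h
    · right; simp [h]
    rcases hx.1.2.eq_or_lt with h' | h'
    · right; simp [h']
    · left; exact ⟨⟨h, h'⟩, hx.2⟩
  obtain ⟨Y, hY, hYc⟩ := hinf'.exists_subset_card_eq (N +2)
  let y := Y.orderEmbOfFin hYc
  have hy : ∀ i, y i ∈ Ioo (l t) (r t) ∧ u (y i) t =0 := fun i => hY (Y.orderEmbOfFin_mem hYc i)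
  have main : ∀ j, j ≤ N +2 → ∃ z ∈ Ioo (l t) (r t), (∀ h : j < N +2, z < y ⟨j, h⟩) ∧ u z t ≠0 ∧
      ∀ᶠ τ in 𝓝[<] t, ∃ n, j ≤ n ∧ ∃ e f, SG e ∧ AltOn u e (l τ) (r τ) τ (n +1) f ∧ f n = z := by
    intro j
    induction j with
    | zero =>
      intro _
      obtain ⟨z, hz, hu⟩ := C.uc t ⟨ta, hT⟩ (l t) (y ⟨0, OME⟩) le_rfl (hy _).1.1 (hy _).1.2.le
      refine ⟨z, ⟨hz.1, hz.2.trans (hy _).1.2⟩, fun _ => hz.2, hu, ?_⟩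
      obtain ⟨e, he, heu⟩ := SG.of hu
      filter_upwards [nhdsWithin_le_nhds (C.pcont ta hT hz.1 (hz.2.trans (hy _).1.2) heu)] with τ hτ
      refine ⟨0, le_rfl, e, fun _ => z, he, ⟨fun i hi => ⟨hτ.1, hτ.2.1⟩, fun i hi => by omega, fun i hi => ?_⟩, rfl⟩
      have : i =0 := OME
      subst this
      simpa using hτ.2.2
    | succ j ih =>
      intro hj
      obtain ⟨z, hz, hzy, hzu, hev⟩ := ih OME
      have hzy := hzy OME
      set yj := y ⟨j, OME⟩ with hyj
      obtain ⟨q, ep, br, er⟩ : ∃ q, yj < q ∧ q ≤ r t ∧ ∀ h : j +1 < N +2, q ≤ y ⟨j +1, h⟩ := by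
        by_cases h : j +1 < N +2
        · exact ⟨y ⟨j +1, h⟩, y.strictMono (by simp [Fin.lt_def]), (hy _).1.2.le, fun _ => le_rfl⟩
        · exact ⟨r t, (hy _).1.2, le_rfl, fun h' => absurd h' h⟩
      obtain ⟨z', hz', hu'⟩ := C.uc t ⟨ta, hT⟩ yj q (hy _).1.1.le ep br
      have hz'r : z' < r t := hz'.2.trans_le br
      have hzz : z < z' := hzy.trans hz'.1
      refine ⟨z', ⟨hz.1.trans hzz, hz'r⟩, fun h => hz'.2.trans_le (er h), hu', ?_⟩
      obtain ⟨d, hd, hdu⟩ := SG.of hzu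
      obtain ⟨d', hd', hdu'⟩ := SG.of hu'
      have pa := C.pcont ta hT hz.1 hz.2 hdu
      have pb := C.pcont ta hT (hz.1.trans hzz) hz'r hdu'
      rcases hd'.eq hd with hdd | hdd
      · rw [hdd] at hdu' pb
        have hg := C.gap ta hT hz.1 hz'r ⟨hzy, hz'.1⟩ (hy _).2 hdu hdu'
        filter_upwards [hg, nhdsWithin_le_nhds pa, nhdsWithin_le_nhds pb, hev] with τ gb gd gc gf
        obtain ⟨n, hn, e, f, he, hf, hfz⟩ := gf
        obtain ⟨x, hx, hxu⟩ := gb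
        have hes : e * (-1) ^ n = d := by
          have ah := hf.2.2 n OME
          rw [hfz] at ah
          rcases (he.mul (SG.pow n)).eq hd with h | h
          · exact h
          · rw [h] at ah; linarith [gd.2.2]
        have kb := hf.snoc (x := x) ⟨gd.1.trans hx.1, hx.2.trans gc.2.1⟩
          (fun _ => by simpa [hfz] using hx.1) (by rw [pow_succ, ← mul_assoc, hes]; linarith)
        have kc := kb.snoc (x := z') ⟨gc.1, gc.2.1⟩ (fun _ => by simpa using hx.2)
          (by rw [pow_succ, pow_succ, ← mul_assoc, ← mul_assoc, hes]; linarith [gc.2.2])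
        exact ⟨n +2, OME, e, _, he, kc, SIM⟩
      · filter_upwards [nhdsWithin_le_nhds pa, nhdsWithin_le_nhds pb, hev] with τ gd gc gf
        obtain ⟨n, hn, e, f, he, hf, hfz⟩ := gf
        have hes : e * (-1) ^ n = d := by
          have ah := hf.2.2 n OME
          rw [hfz] at ah
          rcases (he.mul (SG.pow n)).eq hd with h | h
          · exact h
          · rw [h] at ah; linarith [gd.2.2]
        have kc := hf.snoc (x := z') ⟨gc.1, gc.2.1⟩ (fun _ => by simpa [hfz] using hzz)
          (by rw [pow_succ, ← mul_assoc, hes]; rw [hdd] at gc; linarith [gc.2.2])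
        exact ⟨n +1, OME, e, _, he, kc, SIM⟩
  obtain ⟨z, -, -, -, hev⟩ := main (N +2) le_rfl
  obtain ⟨τ, ⟨n, hn, e, f, he, hf, -⟩, hτ⟩ := (hev.and (Ioo_mem_nhdsLT hst)).exists
  exact hno τ hτ.1.le hτ.2.le e he ⟨f, hf.le OME⟩
end Ca
set_option autoImplicit false
noncomputable def gk (x τ y : Real) : Real := Real.exp (-(y - x) ^2 / (4 * τ))
theorem gk_pos (x τ y : Real) :0 < gk x τ y := Real.exp_pos _
theorem gk_le (x y : Real) {τ : Real} (h :0 ≤ τ) : gk x τ y ≤1 := by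
  unfold gk; rw [Real.exp_le_one_iff]
  exact div_nonpos_of_nonpos_of_nonneg (by nlinarith [sq_nonneg (y - x)]) POS
theorem gk_cont (x τ : Real) : Continuous (gk x τ) := by unfold gk; fun_prop
theorem gk_dy (x : Real) {τ : Real} (h :0 < τ) (y : Real) :
    HasDerivAt (gk x τ) (-((y - x) / (2 * τ)) * gk x τ y) y := by
  have ho : HasDerivAt (fun y => -(y - x) ^2 / (4 * τ)) (-(2 * (y - x)) / (4 * τ)) y := by
    have := ((((hasDerivAt_id y).sub_const x).pow 2).neg).div_const (4 * τ)
    exact this.congr_deriv SIM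
  exact ho.exp.congr_deriv (by unfold gk; field_simp; ring)
theorem gk_dt (x ts y : Real) {t : Real} (h : t < ts) :
    HasDerivAt (fun s => gk x (ts - s) y) (-((y - x) ^2 / (4 * (ts - t) ^2)) * gk x (ts - t) y) t := by
  have af : ts - t ≠0 := LIN
  have ho : HasDerivAt (fun s => -(y - x) ^2 / (4 * (ts - s))) (-(y - x) ^2 / (4 * (ts - t) ^2)) t := by
    have := (hasDerivAt_const t (-(y - x) ^2)).div (((hasDerivAt_id t).const_sub ts).const_mul 4)
      (by simpa using af)
    exact this.congr_deriv (by simp; field_simp)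
  exact ho.exp.congr_deriv (by unfold gk; field_simp)
theorem ii_bdd {L B : Real} {f : RtR} (hL :0 < L)
    (hm : AEStronglyMeasurable f (volume.restrict (JJ L)))
    (hb : ∀ y ∈ JJ L, |f y| ≤ B) : IntervalIntegrable f volume (-L) L := by
  rw [intervalIntegrable_iff_integrableOn_Icc_of_le LIN]
  exact Integrable.of_bound hm B
    (by rw [ae_restrict_iff' measurableSet_Icc]; exact .of_forall hb)
theorem la {a b p q : Real} {f g : RtR} (hf : IntervalIntegrable f volume a b)
    (hg : IntervalIntegrable g volume a b) :
    ∫ y in a..b, (p * f y + q * g y) = p * (∫ y in a..b, f y) + q * ∫ y in a..b, g y := by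
  rw [intervalIntegral.integral_add (hf.const_mul p) (hg.const_mul q), intervalIntegral.integral_const_mul, intervalIntegral.integral_const_mul]
structure SL (L x τ : Real) (w wa wb f : RtR) : Prop where
  La :0 < L
  tc :0 < τ
  db : ∀ y ∈ JJ L, HasDerivAt w (wa y) y
  dc : ∀ y ∈ JJ L, HasDerivAt wa (wb y) y
  ch : ContinuousOn wb (JJ L)
  bc : w (-L) =0
  be : w L =0
  bf : wa (-L) =0
  bg : wa L =0
  fm : AEStronglyMeasurable f (volume.restrict (JJ L))
  fb : ∃ B, ∀ y ∈ JJ L, |f y| ≤ B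
namespace SL
variable {L x τ : Real} {w wa wb f : RtR}
theorem c (h : SL L x τ w wa wb f) : ContinuousOn w (JJ L) :=
  fun y hy => (h.db y hy).continuousAt.continuousWithinAt
theorem ce (h : SL L x τ w wa wb f) : ContinuousOn wa (JJ L) :=
  fun y hy => (h.dc y hy).continuousAt.continuousWithinAt
theorem ii (h : SL L x τ w wa wb f) {k : RtR} (hk : ContinuousOn k (JJ L)) :
    IntervalIntegrable k volume (-L) L := by
  apply ContinuousOn.intervalIntegrable; rwa [uIcc_of_le (by linarith [h.La])]
theorem fi (h : SL L x τ w wa wb f) {k : RtR} (hk : ContinuousOn k (JJ L)) :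
    IntervalIntegrable (fun y => f y * k y) volume (-L) L := by
  obtain ⟨B, hB⟩ := h.fb
  exact (ii_bdd h.La h.fm hB).mul_continuousOn (by rwa [uIcc_of_le (by linarith [h.La])])
theorem ffi (h : SL L x τ w wa wb f) :
    IntervalIntegrable (fun y => f y ^2 * gk x τ y) volume (-L) L := by
  obtain ⟨B, hB⟩ := h.fb
  refine (ii_bdd (B := B ^2) h.La (h.fm.pow 2) fun y hy => ?_).mul_continuousOn (gk_cont _ _).continuousOn
  simp only [Pi.pow_apply, abs_pow]
  exact pow_le_pow_left₀ (abs_nonneg _) (hB y hy) 2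
theorem ibp {p pa qd qe : RtR} (hL :0 < L) (hτ :0 < τ)
    (hp : ∀ y ∈ JJ L, HasDerivAt p (pa y) y) (hq : ∀ y ∈ JJ L, HasDerivAt qd (qe y) y)
    (cp : ContinuousOn pa (JJ L)) (cq : ContinuousOn qe (JJ L))
    (ec : p (-L) =0) (ed : p L =0) :
    ∫ y in (-L)..L, pa y * qd y * gk x τ y =
      -∫ y in (-L)..L, p y * (qe y - (y - x) / (2 * τ) * qd y) * gk x τ y := by
  have hu : uIcc (-L) L = JJ L := uIcc_of_le LIN
  have et : ContinuousOn p (JJ L) := fun y hy => (hp y hy).continuousAt.continuousWithinAt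
  have dp : ContinuousOn qd (JJ L) := fun y hy => (hq y hy).continuousAt.continuousWithinAt
  have cg := (gk_cont x τ).continuousOn (s := JJ L)
  have kb : ContinuousOn (fun y => pa y * qd y * gk x τ y) (JJ L) := (cp.mul dp).mul cg
  have kc : ContinuousOn (fun y => p y * (qe y - (y - x) / (2 * τ) * qd y) * gk x τ y) (JJ L) :=
    (et.mul (cq.sub (((by fun_prop : Continuous fun y => (y - x) / (2 * τ)).continuousOn).mul dp))).mul cg
  have := intervalIntegral.integral_eq_sub_of_hasDerivAt (a := -L) (b := L) (f := fun y => p y * qd y * gk x τ y)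
    (f' := fun y => pa y * qd y * gk x τ y + p y * (qe y - (y - x) / (2 * τ) * qd y) * gk x τ y)
    (by rw [hu]; intro y hy
        exact (((hp y hy).mul (hq y hy)).mul (gk_dy x hτ y)).congr_deriv (by simp; ring))
    (by apply ContinuousOn.intervalIntegrable; rw [hu]; exact kb.add kc)
  rw [intervalIntegral.integral_add (by apply ContinuousOn.intervalIntegrable; rwa [hu])
    (by apply ContinuousOn.intervalIntegrable; rwa [hu])] at this
  simp only [ec, ed] at this
  linarith
theorem E_eq (h : SL L x τ w wa wb f) : ∫ y in (-L)..L, wa y ^2 * gk x τ y =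
    -∫ y in (-L)..L, w y * (wb y - (y - x) / (2 * τ) * wa y) * gk x τ y := by
  rw [← ibp h.La h.tc h.db h.dc h.ce h.ch h.bc h.be]
  congr 1; ext y; ring
theorem Hd (h : SL L x τ w wa wb f) :
    ∫ y in (-L)..L, (2 * w y * (f y + wb y) * gk x τ y
      + w y ^2 * (-((y - x) ^2 / (4 * τ ^2)) * gk x τ y)) =
    -2 * (∫ y in (-L)..L, wa y ^2 * gk x τ y) +2 * (∫ y in (-L)..L, f y * (w y * gk x τ y))
      - (∫ y in (-L)..L, w y ^2 * gk x τ y) / (2 * τ) := by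
  have hu : uIcc (-L) L = JJ L := uIcc_of_le (by linarith [h.La])
  have cg := (gk_cont x τ).continuousOn (s := JJ L)
  have cz : ContinuousOn (fun y => (y - x)) (JJ L) := FUN
  have ci := h.c
  have ce := h.ce
  have ch := h.ch
  have tc := h.tc
  have := intervalIntegral.integral_eq_sub_of_hasDerivAt (a := -L) (b := L)
    (f := fun y =>2 * w y * wa y * gk x τ y + w y ^2 * ((y - x) / (2 * τ)) * gk x τ y)
    (f' := fun y =>2 * (wa y ^2 * gk x τ y) + (2 * w y * wb y * gk x τ y +
      w y ^2 * gk x τ y / (2 * τ) + w y ^2 * (-((y - x) ^2 / (4 * τ ^2)) * gk x τ y)))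
    (by rw [hu]; intro y hy
        have za : HasDerivAt (fun y => (y - x) / (2 * τ)) (1 / (2 * τ)) y :=
          ((hasDerivAt_id y).sub_const x).div_const _
        exact (((((h.db y hy).const_mul 2).mul (h.dc y hy)).mul (gk_dy x h.tc y)).add
          ((((h.db y hy).pow 2).mul za).mul (gk_dy x h.tc y))).congr_deriv (by simp; field_simp; ring))
    (by apply ContinuousOn.intervalIntegrable; rw [hu]; fun_prop)
  simp only [h.bc, h.be] at this
  have ec : ∫ y in (-L)..L, (2 * w y * (f y + wb y) * gk x τ y
      + w y ^2 * (-((y - x) ^2 / (4 * τ ^2)) * gk x τ y)) =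
      ∫ y in (-L)..L, ((2 * (wa y ^2 * gk x τ y) + (2 * w y * wb y * gk x τ y +
      w y ^2 * gk x τ y / (2 * τ) + w y ^2 * (-((y - x) ^2 / (4 * τ ^2)) * gk x τ y)))
      + (2 * (f y * (w y * gk x τ y)) + (-2 * (wa y ^2 * gk x τ y)
        + (-1 / (2 * τ)) * (w y ^2 * gk x τ y)))) := by
    congr 1; ext y; field_simp; ring
  have ia := h.ii (k := fun y => wa y ^2 * gk x τ y) FUN
  have ic := h.ii (k := fun y => w y ^2 * gk x τ y) FUN
  have ie := h.fi (k := fun y => w y * gk x τ y) FUN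
  rw [ec, intervalIntegral.integral_add (h.ii FUN) ((ie.const_mul 2).add ((ia.const_mul _).add (ic.const_mul _))), this,
    intervalIntegral.integral_add (ie.const_mul 2) ((ia.const_mul _).add (ic.const_mul _)), la ia ic, intervalIntegral.integral_const_mul]
  ring
theorem Ed (h : SL L x τ w wa wb f) :
    ∫ y in (-L)..L, (-2 * ((f y + wb y) * (wb y - (y - x) / (2 * τ) * wa y) * gk x τ y)
      + wa y ^2 * (-((y - x) ^2 / (4 * τ ^2)) * gk x τ y)) =
    -2 * (∫ y in (-L)..L, (wb y - (y - x) / (2 * τ) * wa y) ^2 * gk x τ y)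
      -2 * (∫ y in (-L)..L, f y * ((wb y - (y - x) / (2 * τ) * wa y) * gk x τ y))
      + (∫ y in (-L)..L, wa y ^2 * gk x τ y) / (2 * τ) := by
  have hu : uIcc (-L) L = JJ L := uIcc_of_le (by linarith [h.La])
  have cg := (gk_cont x τ).continuousOn (s := JJ L)
  have cz : ContinuousOn (fun y => (y - x)) (JJ L) := FUN
  have ci := h.c
  have ce := h.ce
  have ch := h.ch
  have tc := h.tc
  have := intervalIntegral.integral_eq_sub_of_hasDerivAt (a := -L) (b := L)
    (f := fun y => (y - x) / (2 * τ) * wa y ^2 * gk x τ y)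
    (f' := fun y => wa y ^2 * gk x τ y / (2 * τ) + (y - x) / τ * wa y * wb y * gk x τ y
      - (y - x) ^2 / (4 * τ ^2) * wa y ^2 * gk x τ y)
    (by rw [hu]; intro y hy
        have za : HasDerivAt (fun y => (y - x) / (2 * τ)) (1 / (2 * τ)) y :=
          ((hasDerivAt_id y).sub_const x).div_const _
        exact ((za.mul ((h.dc y hy).pow 2)).mul (gk_dy x h.tc y)).congr_deriv
          (by simp; field_simp; ring))
    (by apply ContinuousOn.intervalIntegrable; rw [hu]; fun_prop)
  simp only [h.bf, h.bg] at this
  have ec : ∫ y in (-L)..L, (-2 * ((f y + wb y) * (wb y - (y - x) / (2 * τ) * wa y) * gk x τ y)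
      + wa y ^2 * (-((y - x) ^2 / (4 * τ ^2)) * gk x τ y)) =
      ∫ y in (-L)..L, ((-1) * ((wa y ^2 * gk x τ y / (2 * τ) + (y - x) / τ * wa y * wb y * gk x τ y
      - (y - x) ^2 / (4 * τ ^2) * wa y ^2 * gk x τ y))
      + (-2 * (f y * ((wb y - (y - x) / (2 * τ) * wa y) * gk x τ y)) +
       (-2 * ((wb y - (y - x) / (2 * τ) * wa y) ^2 * gk x τ y)
        + (1 / (2 * τ)) * (wa y ^2 * gk x τ y)))) := by
    congr 1; ext y; field_simp; ring
  have ia := h.ii (k := fun y => wa y ^2 * gk x τ y) FUN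
  have ic := h.ii (k := fun y => (wb y - (y - x) / (2 * τ) * wa y) ^2 * gk x τ y) FUN
  have ie := h.fi (k := fun y => (wb y - (y - x) / (2 * τ) * wa y) * gk x τ y) FUN
  rw [ec, intervalIntegral.integral_add ((h.ii FUN).const_mul _) ((ie.const_mul _).add ((ic.const_mul _).add (ia.const_mul _))),
    intervalIntegral.integral_const_mul, this,
    intervalIntegral.integral_add (ie.const_mul _) ((ic.const_mul _).add (ia.const_mul _)), la ic ia, intervalIntegral.integral_const_mul]
  ring
theorem RRd (h : SL L x τ w wa wb f) (k : Real) :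
    ∫ y in (-L)..L, (wb y - (y - x) / (2 * τ) * wa y + k * w y) ^2 * gk x τ y =
    (∫ y in (-L)..L, (wb y - (y - x) / (2 * τ) * wa y) ^2 * gk x τ y)
      -2 * k * (∫ y in (-L)..L, wa y ^2 * gk x τ y)
      + k ^2 * (∫ y in (-L)..L, w y ^2 * gk x τ y) := by
  have cg := (gk_cont x τ).continuousOn (s := JJ L)
  have cz : ContinuousOn (fun y => (y - x)) (JJ L) := FUN
  have ci := h.c
  have ce := h.ce
  have ch := h.ch
  have tc := h.tc
  have ia := h.ii (k := fun y => w y * (wb y - (y - x) / (2 * τ) * wa y) * gk x τ y) FUN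
  have ic := h.ii (k := fun y => (wb y - (y - x) / (2 * τ) * wa y) ^2 * gk x τ y) FUN
  have ie := h.ii (k := fun y => w y ^2 * gk x τ y) FUN
  rw [h.E_eq]
  have ec : ∫ y in (-L)..L, (wb y - (y - x) / (2 * τ) * wa y + k * w y) ^2 * gk x τ y =
     ∫ y in (-L)..L, ((wb y - (y - x) / (2 * τ) * wa y) ^2 * gk x τ y +
       ((2 * k) * (w y * (wb y - (y - x) / (2 * τ) * wa y) * gk x τ y) + k ^2 * (w y ^2 * gk x τ y))) := by
    congr 1; ext y; ring
  rw [ec, intervalIntegral.integral_add ic ((ia.const_mul _).add (ie.const_mul _)), la ia ie]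
  ring
theorem imono (hL :0 < L) {p q : RtR} (hp : IntervalIntegrable p volume (-L) L)
    (hq : IntervalIntegrable q volume (-L) L) (hpq : ∀ y ∈ JJ L, p y ≤ q y) :
    ∫ y in (-L)..L, p y ≤ ∫ y in (-L)..L, q y :=
  intervalIntegral.integral_mono_on LIN hp hq hpq
theorem cross (h : SL L x τ w wa wb f) (k : Real) :
    -2 * ((∫ y in (-L)..L, f y * ((wb y - (y - x) / (2 * τ) * wa y) * gk x τ y))
      + k * (∫ y in (-L)..L, f y * (w y * gk x τ y))) ≤
    (∫ y in (-L)..L, f y ^2 * gk x τ y)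
     + ∫ y in (-L)..L, (wb y - (y - x) / (2 * τ) * wa y + k * w y) ^2 * gk x τ y := by
  have cg := (gk_cont x τ).continuousOn (s := JJ L)
  have cz : ContinuousOn (fun y => (y - x)) (JJ L) := FUN
  have ci := h.c
  have ce := h.ce
  have ch := h.ch
  have ia := h.fi (k := fun y => (wb y - (y - x) / (2 * τ) * wa y) * gk x τ y) FUN
  have ic := h.fi (k := fun y => w y * gk x τ y) FUN
  have ie := h.ii (k := fun y => (wb y - (y - x) / (2 * τ) * wa y + k * w y) ^2 * gk x τ y) FUN
  have := imono h.La (((ia.const_mul 1).add (ic.const_mul k)).const_mul (-2)) (h.ffi.add ie) (fun y _ => by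
    have := gk_pos x τ y
    have e : f y ^2 * gk x τ y + (wb y - (y - x) / (2 * τ) * wa y + k * w y) ^2 * gk x τ y -
      -2 * (1 * (f y * ((wb y - (y - x) / (2 * τ) * wa y) * gk x τ y)) + k * (f y * (w y * gk x τ y)))
      = (f y + (wb y - (y - x) / (2 * τ) * wa y + k * w y)) ^2 * gk x τ y := RIN
    have :0 ≤ (f y + (wb y - (y - x) / (2 * τ) * wa y + k * w y)) ^2 * gk x τ y := POS
    linarith)
  rw [intervalIntegral.integral_const_mul] at this
  rw [la ia ic, intervalIntegral.integral_add h.ffi ie, one_mul] at this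
  exact this
theorem Dbd (h : SL L x τ w wa wb f) {θ : Real} (hθ :0 < θ) :
    |2 * ∫ y in (-L)..L, f y * (w y * gk x τ y)| ≤
    θ * (∫ y in (-L)..L, w y ^2 * gk x τ y) + (∫ y in (-L)..L, f y ^2 * gk x τ y) / θ := by
  have cg := (gk_cont x τ).continuousOn (s := JJ L)
  have ci := h.c
  have ic := h.fi (k := fun y => w y * gk x τ y) FUN
  have ie := h.ii (k := fun y => w y ^2 * gk x τ y) FUN
  have key : ∀ e : Real, e ^2 =1 → (2 * e) * (∫ y in (-L)..L, f y * (w y * gk x τ y)) ≤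
    θ * (∫ y in (-L)..L, w y ^2 * gk x τ y) + θ⁻¹ * (∫ y in (-L)..L, f y ^2 * gk x τ y) := by
    intro e he
    have := imono h.La (ic.const_mul (2 * e)) ((ie.const_mul θ).add (h.ffi.const_mul θ⁻¹)) (fun y _ => by
      have := gk_pos x τ y
      have ec : θ * (w y ^2 * gk x τ y) + θ⁻¹ * (f y ^2 * gk x τ y) -2 * e * (f y * (w y * gk x τ y)) =
        θ⁻¹ * (θ * w y - e * f y) ^2 * gk x τ y := by
        field_simp
        linear_combination (-(f y ^2)) * he
      have :0 ≤ θ⁻¹ * (θ * w y - e * f y) ^2 * gk x τ y := POS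
      linarith)
    rw [intervalIntegral.integral_const_mul] at this
    rwa [la ie h.ffi] at this
  rw [abs_le, div_eq_inv_mul]
  have kb := key 1 (by norm_num)
  have kc := key (-1) (by norm_num)
  constructor <;> linarith
end SL
set_option autoImplicit false
structure FW (W Wa Wb Wt : RRR) (L r α β M C B : Real) : Prop where
  rb :0 < r
  rL : r < L
  Ma :0 ≤ M
  Cb :0 ≤ C
  Ba :0 ≤ B
  db : ∀ y ∈ JJ L, ∀ t ∈ Icc α β, HasDerivAt (fun y => W y t) (Wa y t) y
  dc : ∀ y ∈ JJ L, ∀ t ∈ Icc α β, HasDerivAt (fun y => Wa y t) (Wb y t) y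
  dt : ∀ y ∈ JJ L, ∀ t ∈ Icc α β, HasDerivAt (fun t => W y t) (Wt y t) t
  ce : ContinuousOn (UC Wa) (JJ L ×ˢ Icc α β)
  ch : ContinuousOn (UC Wb) (JJ L ×ˢ Icc α β)
  bd : ∀ y ∈ JJ L, ∀ t ∈ Icc α β, |W y t| ≤ B ∧ |Wa y t| ≤ B ∧ |Wb y t| ≤ B ∧ |Wt y t| ≤ B
  z : ∀ t ∈ Icc α β, W (-L) t =0 ∧ W L t =0 ∧ Wa (-L) t =0 ∧ Wa L t =0
  iq : ∀ y ∈ JJ L, ∀ t ∈ Icc α β,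
    |Wt y t - Wb y t| ≤ M * (|W y t| + |Wa y t|) + (if r ≤ |y| then C else 0)
theorem dint {K : RtR} {ψ : RRR} {φ : RtR} {t L C : Real} (hL :0 < L)
    (ho : ∀ᶠ s in 𝓝 t, K s - K t = ∫ y in (-L)..L, ψ y s)
    (aa : ∀ᶠ s in 𝓝 t, ContinuousOn (fun y => ψ y s) (JJ L))
    (ae : ∀ y ∈ JJ L, Tendsto (fun s => (s - t)⁻¹ * ψ y s) (𝓝[≠] t) (𝓝 (φ y)))
    (ag : ∀ᶠ s in 𝓝 t, ∀ y ∈ JJ L, |ψ y s| ≤ C * |s - t|) :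
    HasDerivAt K (∫ y in (-L)..L, φ y) t := by
  rw [hasDerivAt_iff_tendsto_slope]
  have hu : uIoc (-L) L = Ioc (-L) L := uIoc_of_le LIN
  have key : Tendsto (fun s => ∫ y in (-L)..L, (s - t)⁻¹ * ψ y s) (𝓝[≠] t)
      (𝓝 (∫ y in (-L)..L, φ y)) := by
    apply intervalIntegral.tendsto_integral_filter_of_dominated_convergence (fun _ => C)
    · filter_upwards [nhdsWithin_le_nhds aa] with s hs
      rw [hu]
      exact ((continuousOn_const.mul hs).mono Ioc_subset_Icc_self).aestronglyMeasurable measurableSet_Ioc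
    · filter_upwards [nhdsWithin_le_nhds ag, self_mem_nhdsWithin] with s hs hne
      refine .of_forall fun y hy => ?_
      rw [hu] at hy
      have af :0 < |s - t| := abs_pos.2 (sub_ne_zero.2 hne)
      rw [Real.norm_eq_abs, abs_mul, abs_inv, inv_mul_le_iff₀ af, mul_comm]
      exact hs y (Ioc_subset_Icc_self hy)
    · simp
    · refine .of_forall fun y hy => ?_
      rw [hu] at hy
      exact ae y (Ioc_subset_Icc_self hy)
  refine key.congr' ?_
  filter_upwards [nhdsWithin_le_nhds ho] with s hs
  rw [slope_def_field, hs, intervalIntegral.integral_const_mul, div_eq_inv_mul]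
theorem gk_lip (x L ts t : Real) (hL :0 < L) (h : t < ts) : ∃ K,0 ≤ K ∧ ∀ᶠ s in 𝓝 t, ∀ y ∈ JJ L,
    |gk x (ts - s) y - gk x (ts - t) y| ≤ K * |s - t| := by
  refine ⟨(L + |x|) ^2 / (ts - t) ^2, POS, ?_⟩
  have hm : (t + ts) /2 > t := LIN
  filter_upwards [gt_mem_nhds hm] with s hs y hy
  have := (convex_Iic ((t + ts) /2)).norm_image_sub_le_of_norm_hasDerivWithin_le
    (C := (L + |x|) ^2 / (ts - t) ^2)
    (f := fun s => gk x (ts - s) y) (fun s hs => (gk_dt x ts y (t := s) (by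
      have : s ≤ (t + ts) /2 := hs
      linarith)).hasDerivWithinAt)
    (fun s hs => ?_) (show t ∈ Iic _ from hm.le) (show s ∈ Iic _ from hs.le)
  · simpa [Real.norm_eq_abs] using this
  · have hs' : s ≤ (t + ts) /2 := hs
    have e : (ts - t) /2 ≤ ts - s := LIN
    have af :0 < ts - s := LIN
    rw [norm_mul, norm_neg, Real.norm_of_nonneg POS, Real.norm_of_nonneg (gk_pos _ _ _).le]
    have bc : (y - x) ^2 ≤ (L + |x|) ^2 := by
      apply sq_le_sq'
      · have := le_abs_self x; linarith [hy.1]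
      · have := neg_abs_le x; linarith [hy.2]
    have be : (ts - t) ^2 ≤4 * (ts - s) ^2 := by nlinarith
    calc _ ≤ (y - x) ^2 / (4 * (ts - s) ^2) *1 := by
          gcongr; exact gk_le _ _ af.le
      _ ≤ _ := by
          rw [mul_one]
          have :0 < ts - t := LIN
          gcongr
namespace FW
variable {W Wa Wb Wt : RRR} {L r α β M C B : Real}
theorem La (h : FW W Wa Wb Wt L r α β M C B) :0 < L := h.rb.trans h.rL
theorem lipt (h : FW W Wa Wb Wt L r α β M C B) {y s t : Real} (hy : y ∈ JJ L) (hs : s ∈ Icc α β)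
    (ht : t ∈ Icc α β) : |W y s - W y t| ≤ B * |s - t| :=
  (convex_Icc α β).norm_image_sub_le_of_norm_hasDerivWithin_le
    (fun v hv => (h.dt y hy v hv).hasDerivWithinAt) (fun v hv => (h.bd y hy v hv).2.2.2) ht hs
theorem cj (h : FW W Wa Wb Wt L r α β M C B) {t : Real} (ht : t ∈ Icc α β) :
    ContinuousOn (fun y => Wa y t) (JJ L) :=
  fun y hy => (h.dc y hy t ht).continuousAt.continuousWithinAt
theorem cy (h : FW W Wa Wb Wt L r α β M C B) {t : Real} (ht : t ∈ Icc α β) :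
    ContinuousOn (fun y => W y t) (JJ L) :=
  fun y hy => (h.db y hy t ht).continuousAt.continuousWithinAt
theorem ck (h : FW W Wa Wb Wt L r α β M C B) {t : Real} (ht : t ∈ Icc α β) :
    ContinuousOn (fun y => Wb y t) (JJ L) :=
  h.ch.comp (f := fun y => (y, t)) FUN fun y hy => ⟨hy, ht⟩
theorem sl (h : FW W Wa Wb Wt L r α β M C B) {x t ts : Real} (ht : t ∈ Ioo α β) (hts : t < ts) :
    SL L x (ts - t) (fun y => W y t) (fun y => Wa y t) (fun y => Wb y t)
      (fun y => Wt y t - Wb y t) := by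
  have ht' := Ioo_subset_Icc_self ht
  obtain ⟨za, zb, ze, zf⟩ := h.z t ht'
  refine ⟨h.La, LIN, fun y hy => h.db y hy t ht', fun y hy => h.dc y hy t ht', h.ck ht',
    za, zb, ze, zf, ?_, B + B, fun y hy => ?_⟩
  · refine AEStronglyMeasurable.sub ?_ ((h.ck ht').aestronglyMeasurable measurableSet_Icc)
    obtain ⟨s, -, bj, bu⟩ := exists_seq_strictAnti_tendsto' ht.2
    refine aestronglyMeasurable_of_tendsto_ae (f := fun n y => (s n - t)⁻¹ * (W y (s n) - W y t)) atTop
      (fun n => ?_) ?_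
    · have hn : s n ∈ Icc α β := ⟨by linarith [ht.1, (bj n).1], (bj n).2.le⟩
      exact (continuousOn_const.mul ((h.cy hn).sub (h.cy ht'))).aestronglyMeasurable measurableSet_Icc
    · rw [ae_restrict_iff' measurableSet_Icc]
      refine .of_forall fun y hy => ?_
      have ho := (hasDerivAt_iff_tendsto_slope.1 (h.dt y hy t ht')).comp
        (tendsto_nhdsWithin_iff.2 ⟨bu, .of_forall fun n => (bj n).1.ne'⟩)
      refine ho.congr fun n => ?_
      simp [slope_def_field, div_eq_inv_mul]
  · obtain ⟨-, -, qd, qe⟩ := h.bd y hy t ht'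
    exact (abs_sub _ _).trans (add_le_add qe qd)
end FW
noncomputable def fH (W : RRR) (L x ts t : Real) : Real := ∫ y in (-L)..L, W y t ^2 * gk x (ts - t) y
namespace FW
variable {W Wa Wb Wt : RRR} {L r α β M C B : Real}
theorem dH (h : FW W Wa Wb Wt L r α β M C B) {x t ts : Real} (ht : t ∈ Ioo α β) (hts : t < ts) :
    HasDerivAt (fH W L x ts) (-2 * fH Wa L x ts t
      +2 * (∫ y in (-L)..L, (Wt y t - Wb y t) * (W y t * gk x (ts - t) y))
      - fH W L x ts t / (2 * (ts - t))) t := by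
  have ht' := Ioo_subset_Icc_self ht
  have hS := h.sl (x := x) ht hts
  have e := hS.Hd
  simp only [sub_add_cancel] at e
  unfold fH
  rw [← e]
  obtain ⟨K, Kb, hK⟩ := gk_lip x L ts t h.La hts
  have hI : ∀ᶠ s in 𝓝 t, s ∈ Icc α β := Icc_mem_nhds ht.1 ht.2
  have hlt : ∀ᶠ s in 𝓝 t, s < ts := gt_mem_nhds hts
  refine dint (ψ := fun y s => W y s ^2 * gk x (ts - s) y - W y t ^2 * gk x (ts - t) y) (C :=2 * B * B + B ^2 * K) h.La ?_ ?_ ?_ ?_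
  · filter_upwards [hI] with s hs
    exact (intervalIntegral.integral_sub (hS.ii (((h.cy hs).pow 2).mul (gk_cont _ _).continuousOn))
      (hS.ii (((h.cy ht').pow 2).mul (gk_cont _ _).continuousOn))).symm
  · filter_upwards [hI] with s hs
    exact (((h.cy hs).pow 2).mul (gk_cont _ _).continuousOn).sub
      (((h.cy ht').pow 2).mul (gk_cont _ _).continuousOn)
  · intro y hy
    have := hasDerivAt_iff_tendsto_slope.1 (((h.dt y hy t ht').pow 2).mul (gk_dt x ts y hts))
    refine (this.congr fun s => ?_).trans_eq ?_
    · rw [slope_def_field, div_eq_inv_mul]; rfl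
    · congr 1; simp
  · filter_upwards [hI, hlt, hK] with s hs hl hk y hy
    have qd := h.lipt hy hs ht'
    have qe := h.bd y hy s hs
    have qf := h.bd y hy t ht'
    have qh := hk y hy
    have gb := gk_le x y (τ := ts - s) LIN
    have gg := gk_pos x (ts - s) y
    have e : W y s ^2 * gk x (ts - s) y - W y t ^2 * gk x (ts - t) y =
      (W y s - W y t) * (W y s + W y t) * gk x (ts - s) y
       + W y t ^2 * (gk x (ts - s) y - gk x (ts - t) y) := RIN
    rw [e]
    refine (abs_add_le _ _).trans ?_
    rw [abs_mul, abs_mul, abs_mul, abs_of_pos gg, abs_of_nonneg (sq_nonneg (W y t))]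
    have qj : |W y s + W y t| ≤2 * B := (abs_add_le _ _).trans (by linarith [qe.1, qf.1])
    have qk : W y t ^2 ≤ B ^2 := sq_le_sq' (abs_le.1 qf.1).1 (abs_le.1 qf.1).2
    have Ba := h.Ba
    calc _ ≤ (B * |s - t|) * (2 * B) *1 + B ^2 * (K * |s - t|) := GCO
      _ = _ := RIN
theorem dE (h : FW W Wa Wb Wt L r α β M C B) {x t ts : Real} (ht : t ∈ Ioo α β) (hts : t < ts) :
    HasDerivAt (fH Wa L x ts) (
    -2 * (∫ y in (-L)..L, (Wb y t - (y - x) / (2 * (ts - t)) * Wa y t) ^2 * gk x (ts - t) y)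
      -2 * (∫ y in (-L)..L, (Wt y t - Wb y t) * ((Wb y t - (y - x) / (2 * (ts - t)) * Wa y t) * gk x (ts - t) y))
      + fH Wa L x ts t / (2 * (ts - t))) t := by
  have ht' := Ioo_subset_Icc_self ht
  have hS := h.sl (x := x) ht hts
  have e := hS.Ed
  simp only [sub_add_cancel] at e
  unfold fH
  rw [← e]
  obtain ⟨K, Kb, hK⟩ := gk_lip x L ts t h.La hts
  have tc :0 < ts - t := LIN
  have hI : ∀ᶠ s in 𝓝 t, s ∈ Icc α β := Icc_mem_nhds ht.1 ht.2
  have hlt : ∀ᶠ s in 𝓝 t, s < ts := gt_mem_nhds hts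
  set ψ : RRR := fun y s => -((W y s - W y t) * ((Wb y s + Wb y t) - (y - x) / (2 * (ts - t)) * (Wa y s + Wa y t)) * gk x (ts - t) y)
      + Wa y s ^2 * (gk x (ts - s) y - gk x (ts - t) y) with hψ
  have cz : ContinuousOn (fun y => (y - x) / (2 * (ts - t))) (JJ L) := FUN
  have cg : ∀ s, ContinuousOn (gk x s) (JJ L) := fun s => (gk_cont _ _).continuousOn
  have cc : ∀ s ∈ Icc α β, ContinuousOn (fun y => -((W y s - W y t) * ((Wb y s + Wb y t) - (y - x) / (2 * (ts - t)) * (Wa y s + Wa y t)) * gk x (ts - t) y)) (JJ L) := by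
    intro s hs
    exact ((((h.cy hs).sub (h.cy ht')).mul (((h.ck hs).add (h.ck ht')).sub
      (cz.mul ((h.cj hs).add (h.cj ht'))))).mul (cg _)).neg
  have cc' : ∀ s ∈ Icc α β, ContinuousOn (fun y => Wa y s ^2 * (gk x (ts - s) y - gk x (ts - t) y)) (JJ L) := by
    intro s hs
    exact ((h.cj hs).pow 2).mul ((cg _).sub (cg _))
  refine dint (ψ := ψ) (C := B * (2 * B + (L + |x|) / (2 * (ts - t)) * (2 * B)) + B ^2 * K) h.La ?_ ?_ ?_ ?_
  · filter_upwards [hI] with s hs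
    have ed : ∫ y in (-L)..L, ψ y s = (∫ y in (-L)..L, -((W y s - W y t) * ((Wb y s + Wb y t) - (y - x) / (2 * (ts - t)) * (Wa y s + Wa y t)) * gk x (ts - t) y))
       + ∫ y in (-L)..L, Wa y s ^2 * (gk x (ts - s) y - gk x (ts - t) y) :=
      intervalIntegral.integral_add (hS.ii (cc s hs)) (hS.ii (cc' s hs))
    rw [ed, intervalIntegral.integral_neg, ← SL.ibp (p := fun y => W y s - W y t) (pa := fun y => Wa y s - Wa y t)
      (qd := fun y => Wa y s + Wa y t) (qe := fun y => Wb y s + Wb y t) h.La tc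
      (fun y hy => (h.db y hy s hs).sub (h.db y hy t ht')) (fun y hy => (h.dc y hy s hs).add (h.dc y hy t ht'))
      ((h.cj hs).sub (h.cj ht')) ((h.ck hs).add (h.ck ht')) (by simp [(h.z s hs).1, (h.z t ht').1])
      (by simp [(h.z s hs).2.1, (h.z t ht').2.1]),
      ← intervalIntegral.integral_add (hS.ii (k := fun y => (Wa y s - Wa y t) * (Wa y s + Wa y t) * gk x (ts - t) y)
        ((((h.cj hs).sub (h.cj ht')).mul ((h.cj hs).add (h.cj ht'))).mul (cg _))) (hS.ii (cc' s hs)),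
      ← intervalIntegral.integral_sub (hS.ii (k := fun y => Wa y s ^2 * gk x (ts - s) y) (((h.cj hs).pow 2).mul (cg _)))
      (hS.ii (k := fun y => Wa y t ^2 * gk x (ts - t) y) (((h.cj ht').pow 2).mul (cg _)))]
    congr 1; ext y; ring
  · filter_upwards [hI] with s hs
    exact (cc s hs).add (cc' s hs)
  · intro y hy
    have kb := hasDerivAt_iff_tendsto_slope.1 (h.dt y hy t ht')
    have kc := hasDerivAt_iff_tendsto_slope.1 (gk_dt x ts y hts)
    have te : Tendsto (fun s => Wa y s) (𝓝[≠] t) (𝓝 (Wa y t)) := by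
      have : ContinuousOn (fun s => Wa y s) (Icc α β) :=
        h.ce.comp (f := fun s => (y, s)) FUN fun s hs => ⟨hy, hs⟩
      exact (this.continuousAt (Icc_mem_nhds ht.1 ht.2)).tendsto.mono_left nhdsWithin_le_nhds
    have tg : Tendsto (fun s => Wb y s) (𝓝[≠] t) (𝓝 (Wb y t)) := by
      have : ContinuousOn (fun s => Wb y s) (Icc α β) :=
        h.ch.comp (f := fun s => (y, s)) FUN fun s hs => ⟨hy, hs⟩
      exact (this.continuousAt (Icc_mem_nhds ht.1 ht.2)).tendsto.mono_left nhdsWithin_le_nhds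
    have := (((kb.mul ((tg.add_const (Wb y t)).sub ((te.add_const (Wa y t)).const_mul ((y - x) / (2 * (ts - t)))))).mul_const
      (gk x (ts - t) y)).neg).add ((te.pow 2).mul kc)
    refine (this.congr fun s => ?_).trans_eq ?_
    · simp only [slope_def_field, div_eq_inv_mul _ (s - t), hψ]; ring
    · congr 1; ring
  · filter_upwards [hI, hlt, hK] with s hs hl hk y hy
    have qd := h.lipt hy hs ht'
    have qe := h.bd y hy s hs
    have qf := h.bd y hy t ht'
    have qh := hk y hy
    have gb := gk_le x y (τ := ts - t) LIN
    have gg := gk_pos x (ts - t) y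
    have Ba := h.Ba
    refine (abs_add_le _ _).trans ?_
    rw [abs_neg, abs_mul, abs_mul, abs_mul, abs_of_pos gg, abs_of_nonneg (sq_nonneg (Wa y s))]
    have qj : |Wa y s + Wa y t| ≤2 * B := (abs_add_le _ _).trans (by linarith [qe.2.1, qf.2.1])
    have qo : |Wb y s + Wb y t| ≤2 * B := (abs_add_le _ _).trans (by linarith [qe.2.2.1, qf.2.2.1])
    have qk : Wa y s ^2 ≤ B ^2 := sq_le_sq' (abs_le.1 qe.2.1).1 (abs_le.1 qe.2.1).2
    have qp : |y - x| ≤ L + |x| := (abs_sub _ _).trans (by linarith [abs_le.2 hy])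
    have qq : |(Wb y s + Wb y t) - (y - x) / (2 * (ts - t)) * (Wa y s + Wa y t)| ≤
       2 * B + (L + |x|) / (2 * (ts - t)) * (2 * B) := by
      refine (abs_sub _ _).trans ?_
      have := h.La
      rw [abs_mul, abs_div, abs_of_pos (show 0 <2 * (ts - t) by positivity)]
      gcongr
    have := h.La
    calc _ ≤ (B * |s - t|) * (2 * B + (L + |x|) / (2 * (ts - t)) * (2 * B)) *1 + B ^2 * (K * |s - t|) := GCO
      _ = _ := RIN
end FW
set_option autoImplicit false
noncomputable def fN (W Wa : RRR) (L x ts t : Real) : Real := (ts - t) * fH Wa L x ts t / fH W L x ts t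
noncomputable def fR (W Wa Wb : RRR) (L x ts t : Real) : Real :=
  ∫ y in (-L)..L, (Wb y t - (y - x) / (2 * (ts - t)) * Wa y t + fH Wa L x ts t / fH W L x ts t * W y t) ^2
    * gk x (ts - t) y
theorem fH_nonneg (W : RRR) {L : Real} (hL :0 < L) (x ts t : Real) :0 ≤ fH W L x ts t :=
  intervalIntegral.integral_nonneg LIN fun y _ => mul_nonneg (sq_nonneg _) (gk_pos _ _ _).le
theorem fR_nonneg (W Wa Wb : RRR) {L : Real} (hL :0 < L) (x ts t : Real) :0 ≤ fR W Wa Wb L x ts t :=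
  intervalIntegral.integral_nonneg LIN fun y _ => mul_nonneg (sq_nonneg _) (gk_pos _ _ _).le
theorem fN_nonneg (W Wa : RRR) {L : Real} (hL :0 < L) (x : Real) {ts t : Real} (h : t < ts) :
    0 ≤ fN W Wa L x ts t :=
  div_nonneg (mul_nonneg LIN (fH_nonneg _ hL _ _ _)) (fH_nonneg _ hL _ _ _)
theorem dN_alg {τ H E D A Bq FF RR K : Real} (hτ :0 < τ) (hH :0 < H)
    (hR : RR = A -2 * (E / H) * E + (E / H) ^2 * H)
    (hc : -2 * (Bq + E / H * D) ≤ FF + RR) (hF : FF ≤ K * (H + E)) :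
    ((-1 * E + τ * (-2 * A -2 * Bq + E / (2 * τ))) * H - τ * E * (-2 * E +2 * D - H / (2 * τ))) / H ^2
      ≤ K * (τ + τ * E / H) - τ / H * RR := by
  have e : ((-1 * E + τ * (-2 * A -2 * Bq + E / (2 * τ))) * H - τ * E * (-2 * E +2 * D - H / (2 * τ))) / H ^2
    = τ / H * (-2 * (Bq + E / H * D) -2 * RR) := by
    rw [hR]; field_simp; ring
  rw [e]
  have ho : τ / H * (-2 * (Bq + E / H * D) -2 * RR) ≤ τ / H * (K * (H + E) - RR) :=
    mul_le_mul_of_nonneg_left LIN POS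
  refine ho.trans (le_of_eq ?_)
  field_simp
namespace FW
variable {W Wa Wb Wt : RRR} {L r α β M C B : Real}
theorem FFb (h : FW W Wa Wb Wt L r α β M C B) {x t ts κ : Real} (ht : t ∈ Ioo α β) (hts : t < ts)
    (hx : |x| ≤ r /2) (hκ : κ ≤ r ^2 /16) (hg : Real.exp (-κ / (ts - t)) < fH W L x ts t) :
    ∫ y in (-L)..L, (Wt y t - Wb y t) ^2 * gk x (ts - t) y ≤
      (3 * M ^2 +6 * C ^2 * L) * (fH W L x ts t + fH Wa L x ts t) := by
  have ht' := Ioo_subset_Icc_self ht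
  have hS := h.sl (x := x) ht hts
  have tc :0 < ts - t := LIN
  have ia := hS.ii (k := fun y => W y t ^2 * gk x (ts - t) y) (((h.cy ht').pow 2).mul (gk_cont _ _).continuousOn)
  have ic := hS.ii (k := fun y => Wa y t ^2 * gk x (ts - t) y) (((h.cj ht').pow 2).mul (gk_cont _ _).continuousOn)
  have ie := (ia.const_mul (3 * M ^2)).add (ic.const_mul (3 * M ^2))
  have ik : IntervalIntegrable (fun _ : Real =>3 * C ^2 * Real.exp (-κ / (ts - t))) volume (-L) L := SIM
  have := SL.imono h.La hS.ffi (ie.add ik) (fun y hy => ?_)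
  · rw [intervalIntegral.integral_add ie ik, la ia ic] at this
    refine this.trans ?_
    simp only [intervalIntegral.integral_const, smul_eq_mul]
    change 3 * M ^2 * fH W L x ts t +3 * M ^2 * fH Wa L x ts t + _ ≤ _
    have eb := fH_nonneg Wa h.La x ts t
    have La := h.La
    have : (L - -L) * (3 * C ^2 * Real.exp (-κ / (ts - t))) ≤6 * C ^2 * L * (fH W L x ts t + fH Wa L x ts t) := by
      have :6 * C ^2 * L * Real.exp (-κ / (ts - t)) ≤6 * C ^2 * L * (fH W L x ts t + fH Wa L x ts t) := by
        gcongr; linarith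
      linarith
    linarith
  · have gg := gk_pos x (ts - t) y
    have q := h.iq y hy t ht'
    have hM := h.Ma
    have tail : (if r ≤ |y| then C else 0) ^2 * gk x (ts - t) y ≤ C ^2 * Real.exp (-κ / (ts - t)) := by
      split_ifs with hr
      · gcongr
        unfold gk
        rw [Real.exp_le_exp, div_le_div_iff₀ POS tc]
        have : (r /2) ^2 ≤ (y - x) ^2 := by
          rw [← sq_abs (y - x)]
          have ho := abs_sub_abs_le_abs_sub y x
          have := h.rb
          exact pow_le_pow_left₀ LIN LIN 2
        nlinarith
      · simp; positivity
    have so : (Wt y t - Wb y t) ^2 ≤3 * M ^2 * W y t ^2 +3 * M ^2 * Wa y t ^2 +3 * (if r ≤ |y| then C else 0) ^2 := by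
      set c := (if r ≤ |y| then C else 0)
      have ho : (Wt y t - Wb y t) ^2 ≤ (M * (|W y t| + |Wa y t|) + c) ^2 := by
        rw [← sq_abs (Wt y t - Wb y t)]
        exact pow_le_pow_left₀ (abs_nonneg _) q 2
      rw [← sq_abs (W y t), ← sq_abs (Wa y t)]
      nlinarith [sq_nonneg (M * |W y t| - M * |Wa y t|), sq_nonneg (M * |W y t| - c), sq_nonneg (M * |Wa y t| - c)]
    calc _ ≤ (3 * M ^2 * W y t ^2 +3 * M ^2 * Wa y t ^2 +3 * (if r ≤ |y| then C else 0) ^2) * gk x (ts - t) y := GCO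
      _ ≤ _ := LIN
theorem dN (h : FW W Wa Wb Wt L r α β M C B) {x t ts κ K : Real} (ht : t ∈ Ioo α β) (hts : t < ts)
    (hx : |x| ≤ r /2) (hκ : κ ≤ r ^2 /16) (hg : Real.exp (-κ / (ts - t)) < fH W L x ts t)
    (hK :3 * M ^2 +6 * C ^2 * L ≤ K) :
    ∃ d, HasDerivAt (fN W Wa L x ts) d t ∧
      d ≤ K * ((ts - t) + fN W Wa L x ts t) - (ts - t) / fH W L x ts t * fR W Wa Wb L x ts t := by
  have hS := h.sl (x := x) ht hts
  have Hc :0 < fH W L x ts t := (Real.exp_pos _).trans hg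
  have eb := fH_nonneg Wa h.La x ts t
  refine ⟨_, ((((hasDerivAt_id t).const_sub ts).mul (h.dE ht hts)).div (h.dH ht hts) Hc.ne').congr_deriv rfl, ?_⟩
  refine dN_alg (τ := ts - t) LIN Hc (hS.RRd _) (hS.cross _) ((h.FFb ht hts hx hκ hg).trans ?_)
  gcongr
theorem dHq (h : FW W Wa Wb Wt L r α β M C B) {x t ts κ K : Real} (ht : t ∈ Ioo α β) (hts : t < ts)
    (hx : |x| ≤ r /2) (hκ : κ ≤ r ^2 /16) (hg : Real.exp (-κ / (ts - t)) < fH W L x ts t)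
    (hK :3 * M ^2 +6 * C ^2 * L ≤ K) :
    ∃ q, HasDerivAt (fH W L x ts) (fH W L x ts t * (-(2 * fN W Wa L x ts t +1 /2) + q) / (ts - t)) t ∧
      ∀ θ >0, |q| ≤ θ * (ts - t) + K * ((ts - t) + fN W Wa L x ts t) / θ := by
  have hS := h.sl (x := x) ht hts
  have Hc :0 < fH W L x ts t := (Real.exp_pos _).trans hg
  have tc :0 < ts - t := LIN
  have eb := fH_nonneg Wa h.La x ts t
  refine ⟨(ts - t) / fH W L x ts t * (2 * (∫ y in (-L)..L, (Wt y t - Wb y t) * (W y t * gk x (ts - t) y))),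
    (h.dH ht hts).congr_deriv ?_, fun θ hθ => ?_⟩
  · unfold fN; field_simp; ring
  · rw [abs_mul, abs_of_pos POS]
    have ho : ∫ y in (-L)..L, (Wt y t - Wb y t) ^2 * gk x (ts - t) y ≤ K * (fH W L x ts t + fH Wa L x ts t) := by
      refine (h.FFb ht hts hx hκ hg).trans ?_; gcongr
    have aa := hS.Dbd hθ
    calc _ ≤ (ts - t) / fH W L x ts t * (θ * fH W L x ts t + K * (fH W L x ts t + fH Wa L x ts t) / θ) := by
          gcongr; refine aa.trans ?_; unfold fH at ho ⊢; gcongr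
      _ = _ := by unfold fN; field_simp
end FW
set_option autoImplicit false
theorem mono_hd {f : RtR} {a b : Real} (hab : a ≤ b) (h : ∀ t ∈ Icc a b, ∃ d, HasDerivAt f d t ∧ 0 ≤ d) :
    f a ≤ f b := by
  have := monotoneOn_of_deriv_nonneg (convex_Icc a b) (f := f)
    (fun t ht => by obtain ⟨d, hd, -⟩ := h t ht; exact hd.continuousAt.continuousWithinAt)
    (fun t ht => by
      obtain ⟨d, hd, -⟩ := h t (interior_subset ht); exact hd.differentiableAt.differentiableWithinAt)
    (fun t ht => by obtain ⟨d, hd, af⟩ := h t (interior_subset ht); rwa [hd.deriv])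
  exact this ⟨le_rfl, hab⟩ ⟨hab, le_rfl⟩ hab
theorem boot {f : RtR} {a b : Real} (hc : ContinuousOn f (Icc a b)) (ha :1 < f a)
    (hs : ∀ s ∈ Ioc a b, (∀ t ∈ Ico a s,1 < f t) →1 < f s) : ∀ t ∈ Icc a b,1 < f t := by
  by_contra! hcon
  obtain ⟨tb, am, ho⟩ := hcon
  set S := {t ∈ Icc a b | f t ≤1}
  have hS : IsClosed S := hc.preimage_isClosed_of_isClosed isClosed_Icc isClosed_Iic
  have hbd : BddBelow S := ⟨a, fun t ht => ht.1.1⟩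
  have hm : sInf S ∈ S := hS.csInf_mem ⟨tb, am, ho⟩ hbd
  have hne : a ≠ sInf S := fun e => by rw [e] at ha; exact absurd hm.2 (not_le.2 ha)
  refine absurd (hs (sInf S) ⟨lt_of_le_of_ne hm.1.1 hne, hm.1.2⟩ fun t ht => ?_) (not_lt.2 hm.2)
  by_contra hcc
  exact absurd (csInf_le hbd (show t ∈ S from ⟨⟨ht.1, ht.2.le.trans hm.1.2⟩, not_lt.1 hcc⟩)) (not_le.2 ht.2)
def GS (W : RRR) (L κ x ts t : Real) : Prop := Real.exp (-κ / (ts - t)) < fH W L x ts t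
structure FC (W Wa Wb Wt : RRR) (L r α β M C B κ K : Real) : Prop
    extends FW W Wa Wb Wt L r α β M C B where
  ka :0 < κ
  kr : κ ≤ r ^2 /16
  Ka :1 ≤ K
  hK :3 * M ^2 +6 * C ^2 * L ≤ K
namespace FC
variable {W Wa Wb Wt : RRR} {L r α β M C B κ K : Real}
theorem dlog (h : FC W Wa Wb Wt L r α β M C B κ K) {x t ts : Real} (ht : t ∈ Ioo α β) (hts : t < ts)
    (hx : |x| ≤ r /2) (hg : GS W L κ x ts t) :
    ∃ q, HasDerivAt (fun t => Real.log (fH W L x ts t)) ((-(2 * fN W Wa L x ts t +1 /2) + q) / (ts - t)) t ∧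
      ∀ θ >0, |q| ≤ θ * (ts - t) + K * ((ts - t) + fN W Wa L x ts t) / θ := by
  obtain ⟨q, ho, aa⟩ := h.dHq ht hts hx h.kr hg h.hK
  have Hc :0 < fH W L x ts t := (Real.exp_pos _).trans hg
  exact ⟨q, (ho.log Hc.ne').congr_deriv (by field_simp), aa⟩
theorem Nmono (h : FC W Wa Wb Wt L r α β M C B κ K) {x ts a b : Real} (ha : α < a) (hb : b < β) (hbt : b < ts)
    (hab : a ≤ b) (ho : ts - a ≤1) (hx : |x| ≤ r /2) (hg : ∀ t ∈ Icc a b, GS W L κ x ts t) :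
    fN W Wa L x ts b +1 ≤ Real.exp (K * (b - a)) * (fN W Wa L x ts a +1) := by
  have := mono_hd (f := fun t => -(Real.exp (-K * t) * (fN W Wa L x ts t +1))) hab (fun t ht => by
    obtain ⟨d, hd, hle⟩ := h.dN ⟨ha.trans_le ht.1, ht.2.trans_lt hb⟩ (ht.2.trans_lt hbt) hx h.kr (hg t ht) h.hK
    have he : HasDerivAt (fun t : Real => Real.exp (-K * t)) (Real.exp (-K * t) * (-K)) t := by
      simpa using ((hasDerivAt_id t).const_mul (-K)).exp
    refine ⟨_, (he.mul (hd.add_const 1)).neg, ?_⟩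
    have Hc :0 < fH W L x ts t := (Real.exp_pos _).trans (hg t ht)
    have hτ :0 < ts - t := by linarith [ht.2]
    have Ra := fR_nonneg W Wa Wb h.La x ts t
    have :0 ≤ (ts - t) / fH W L x ts t * fR W Wa Wb L x ts t := POS
    have Ka := h.Ka
    have : d ≤ K * (fN W Wa L x ts t +1) := by
      have : K * (ts - t) ≤ K *1 := by gcongr; linarith [ht.1]
      linarith
    have e := Real.exp_pos (-K * t)
    have :0 ≤ Real.exp (-K * t) * (K * (fN W Wa L x ts t +1) - d) := mul_nonneg e.le LIN
    linarith)
  have ec : Real.exp (K * (b - a)) = Real.exp (K * b) * Real.exp (-K * a) := by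
    rw [← Real.exp_add]; ring_nf
  have ed : Real.exp (K * b) * Real.exp (-K * b) =1 := by rw [← Real.exp_add]; simp
  rw [ec]
  have ae := mul_le_mul_of_nonneg_left (neg_le_neg this) (Real.exp_pos (K * b)).le
  simp only [neg_neg] at ae
  calc _ = Real.exp (K * b) * (Real.exp (-K * b) * (fN W Wa L x ts b +1)) := by rw [← mul_assoc, ed, one_mul]
    _ ≤ _ := by rw [mul_assoc]; exact ae
theorem qb (h : FC W Wa Wb Wt L r α β M C B κ K) {τ q N Λ : Real} (hτ :0 ≤ τ) (hk : K * τ ≤1 /2)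
    (hq : ∀ θ >0, |q| ≤ θ * τ + K * (τ + N) / θ) (hN : N ≤2 * Λ +1) : -(6 * Λ +5) ≤ -(2 * N +1 /2) + q := by
  have Ka := h.Ka
  have ho := hq K LIN
  rw [mul_div_cancel_left₀ _ (by linarith : K ≠0)] at ho
  have : τ ≤ K * τ := by nlinarith
  linarith [(abs_le.1 ho).1]
theorem Hcont (h : FC W Wa Wb Wt L r α β M C B κ K) {x ts t : Real} (ht : t ∈ Ioo α β) (hts : t < ts) :
    ContinuousAt (fH W L x ts) t := (h.dH ht hts).continuousAt
theorem dbl (h : FC W Wa Wb Wt L r α β M C B κ K) {x ts a Λ : Real} (ha : α < a) (hb : ts ≤ β) (hat : a < ts)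
    (ho : ts - a ≤1) (hk : K * (ts - a) ≤1 /2) (hx : |x| ≤ r /2) (hg : GS W L κ x ts a)
    (hΛ :0 ≤ Λ) (hN : fN W Wa L x ts a ≤ Λ) (hs : (6 * Λ +5) * (ts - a) ≤ κ) :
    ∀ t ∈ Ico a ts, GS W L κ x ts t ∧ fN W Wa L x ts t ≤2 * Λ +1 := by
  have Ka := h.Ka
  have conv : ∀ t < ts, (GS W L κ x ts t ↔ 1 < fH W L x ts t * Real.exp (κ / (ts - t))) := by
    intro t ht
    unfold GS
    rw [neg_div, Real.exp_neg, inv_lt_iff_one_lt_mul₀ (Real.exp_pos _)]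
  have Nb : ∀ b ∈ Ico a ts, (∀ t ∈ Icc a b, GS W L κ x ts t) → fN W Wa L x ts b ≤2 * Λ +1 := by
    intro b hbb hgb
    have aa := h.Nmono ha (hbb.2.trans_le hb) hbb.2 hbb.1 ho hx hgb
    have ae : Real.exp (K * (b - a)) ≤2 := by
      have : Real.exp (K * (b - a)) ≤ Real.exp (1 /2) := by
        rw [Real.exp_le_exp]; nlinarith [hbb.2]
      have ag : Real.exp (1 /2) ^2 ≤2 ^2 := by
        rw [← Real.exp_nat_mul]; norm_num; linarith [Real.exp_one_lt_d9]
      exact this.trans ((pow_le_pow_iff_left₀ (Real.exp_pos _).le (by norm_num) two_ne_zero).1 ag)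
    have : Real.exp (K * (b - a)) * (fN W Wa L x ts a +1) ≤2 * (Λ +1) := by
      have := fN_nonneg W Wa h.La x hat
      gcongr
    linarith
  have mon : ∀ b ∈ Ico a ts, (∀ t ∈ Icc a b, GS W L κ x ts t) →
     fH W L x ts a * Real.exp (κ / (ts - a)) ≤ fH W L x ts b * Real.exp (κ / (ts - b)) := by
    intro b hbb hgb
    have := mono_hd (f := fun t => Real.log (fH W L x ts t) + κ / (ts - t)) hbb.1 (fun t ht => by
      have htt : t < ts := ht.2.trans_lt hbb.2
      obtain ⟨q, hd, hq⟩ := h.dlog ⟨ha.trans_le ht.1, (ht.2.trans_lt hbb.2).trans_le hb⟩ htt hx (hgb t ht)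
      have tc :0 < ts - t := LIN
      have dc : HasDerivAt (fun t => κ / (ts - t)) (κ / (ts - t) ^2) t := by
        have := (hasDerivAt_const t κ).div ((hasDerivAt_id t).const_sub ts) tc.ne'
        exact this.congr_deriv SIM
      refine ⟨_, hd.add dc, ?_⟩
      have hq' := h.qb tc.le (by nlinarith [ht.1]) hq
        (Nb t ⟨ht.1, htt⟩ fun t' ht' => hgb t' ⟨ht'.1, ht'.2.trans ht.2⟩)
      have e : (-(2 * fN W Wa L x ts t +1 /2) + q) / (ts - t) + κ / (ts - t) ^2 =
        ((-(2 * fN W Wa L x ts t +1 /2) + q) * (ts - t) + κ) / (ts - t) ^2 := by field_simp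
      rw [e]
      apply div_nonneg _ POS
      nlinarith [ht.1])
    have Ha :0 < fH W L x ts a := (Real.exp_pos _).trans hg
    have Hb :0 < fH W L x ts b := (Real.exp_pos _).trans (hgb b ⟨hbb.1, le_rfl⟩)
    have ah := Real.exp_le_exp.2 this
    rwa [Real.exp_add, Real.exp_add, Real.exp_log Ha, Real.exp_log Hb] at ah
  have ψc : ∀ t ∈ Ico a ts, ContinuousAt (fun t => fH W L x ts t * Real.exp (κ / (ts - t))) t := by
    intro t ht
    have : ts - t ≠0 := by linarith [ht.2]
    exact (h.Hcont ⟨ha.trans_le ht.1, ht.2.trans_le hb⟩ ht.2).mul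
      (Real.continuous_exp.continuousAt.comp (ContinuousAt.div FUN FUN this))
  have all : ∀ t ∈ Ico a ts, GS W L κ x ts t := by
    intro t ht
    rw [conv t ht.2]
    refine boot (f := fun t => fH W L x ts t * Real.exp (κ / (ts - t))) (a := a) (b := t)
      (fun s hs => (ψc s ⟨hs.1, hs.2.trans_lt ht.2⟩).continuousWithinAt) ((conv a hat).1 hg)
      (fun s hs hgs => ?_) t ⟨ht.1, le_rfl⟩
    have hsts : s < ts := hs.2.trans_lt ht.2
    refine ((conv a hat).1 hg).trans_le (ge_of_tendsto
      ((ψc s ⟨hs.1.le, hsts⟩).tendsto.mono_left (nhdsWithin_le_nhds (s := Iio s))) ?_)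
    filter_upwards [Ioo_mem_nhdsLT hs.1] with b hb'
    exact mon b ⟨hb'.1.le, hb'.2.trans hsts⟩ fun t' ht' =>
      (conv t' ((ht'.2.trans_lt hb'.2).trans hsts)).2 (hgs t' ⟨ht'.1, ht'.2.trans_lt hb'.2⟩)
  exact fun t ht => ⟨all t ht, Nb t ht fun t' ht' => all t' ⟨ht'.1, ht'.2.trans_lt ht.2⟩⟩
theorem lower (h : FC W Wa Wb Wt L r α β M C B κ K) {x ts a b n : Real} (ha : α < a) (hb : b < β) (hbt : b < ts)
    (hab : a ≤ b) (hx : |x| ≤ r /2) (hg : ∀ t ∈ Icc a b, GS W L κ x ts t)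
    (hn : ∀ t ∈ Icc a b, ∀ q, (∀ θ >0, |q| ≤ θ * (ts - t) + K * ((ts - t) + fN W Wa L x ts t) / θ) →
      -n ≤ -(2 * fN W Wa L x ts t +1 /2) + q) :
    Real.log (fH W L x ts a) - n * Real.log (ts - a) ≤ Real.log (fH W L x ts b) - n * Real.log (ts - b) := by
  refine mono_hd (f := fun t => Real.log (fH W L x ts t) - n * Real.log (ts - t)) hab (fun t ht => ?_)
  have tc :0 < ts - t := by linarith [ht.2]
  obtain ⟨q, hd, hq⟩ := h.dlog ⟨ha.trans_le ht.1, ht.2.trans_lt hb⟩ (ht.2.trans_lt hbt) hx (hg t ht)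
  refine ⟨_, hd.sub ((((hasDerivAt_id t).const_sub ts).log tc.ne').const_mul n), ?_⟩
  have := hn t ht q hq
  simp only [id]
  have e : (-(2 * fN W Wa L x ts t +1 /2) + q) / (ts - t) - n * (-1 / (ts - t)) =
    (-(2 * fN W Wa L x ts t +1 /2) + q + n) / (ts - t) := by field_simp; ring
  rw [e]
  exact div_nonneg LIN tc.le
theorem upper (h : FC W Wa Wb Wt L r α β M C B κ K) {x ts a b n : Real} (ha : α < a) (hb : b < β) (hbt : b < ts)
    (hab : a ≤ b) (hx : |x| ≤ r /2) (hg : ∀ t ∈ Icc a b, GS W L κ x ts t)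
    (hn : ∀ t ∈ Icc a b, ∀ q, (∀ θ >0, |q| ≤ θ * (ts - t) + K * ((ts - t) + fN W Wa L x ts t) / θ) →
      -(2 * fN W Wa L x ts t +1 /2) + q ≤ -n) :
    Real.log (fH W L x ts b) - n * Real.log (ts - b) ≤ Real.log (fH W L x ts a) - n * Real.log (ts - a) := by
  refine neg_le_neg_iff.1 (mono_hd (f := fun t => -(Real.log (fH W L x ts t) - n * Real.log (ts - t))) hab (fun t ht => ?_))
  have tc :0 < ts - t := by linarith [ht.2]
  obtain ⟨q, hd, hq⟩ := h.dlog ⟨ha.trans_le ht.1, ht.2.trans_lt hb⟩ (ht.2.trans_lt hbt) hx (hg t ht)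
  refine ⟨_, (hd.sub ((((hasDerivAt_id t).const_sub ts).log tc.ne').const_mul n)).neg, ?_⟩
  have := hn t ht q hq
  simp only [id]
  have e : -((-(2 * fN W Wa L x ts t +1 /2) + q) / (ts - t) - n * (-1 / (ts - t))) =
    (-(-(2 * fN W Wa L x ts t +1 /2) + q) - n) / (ts - t) := by field_simp; ring
  rw [e]
  exact div_nonneg LIN tc.le
end FC
set_option autoImplicit false
theorem fH_basecont {W : RRR} {L B a : Real} (hL :0 < L) (hc : ContinuousOn (fun y => W y a) (JJ L))
    (hB : ∀ y ∈ JJ L, |W y a| ≤ B) {x ts : Real} (hts : a < ts) :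
    ContinuousAt (fun p : Real × Real => fH W L p.1 p.2 a) (x, ts) := by
  have hu : uIoc (-L) L = Ioc (-L) L := uIoc_of_le LIN
  have hev : ∀ᶠ p : Real × Real in 𝓝 (x, ts), a < p.2 := continuousAt_snd.eventually (lt_mem_nhds hts)
  unfold fH
  refine intervalIntegral.continuousAt_of_dominated_interval (bound := fun _ => B ^2) ?_ ?_ SIM ?_
  · refine .of_forall fun p => ?_
    rw [hu]
    exact (((hc.pow 2).mul (gk_cont _ _).continuousOn).mono Ioc_subset_Icc_self).aestronglyMeasurable measurableSet_Ioc
  · filter_upwards [hev] with p hp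
    refine .of_forall fun y hy => ?_
    rw [hu] at hy
    have ho := hB y (Ioc_subset_Icc_self hy)
    rw [norm_mul, norm_pow, Real.norm_eq_abs, Real.norm_of_nonneg (gk_pos _ _ _).le]
    have hp : a < p.2 := hp
    have g := gk_le p.1 y (τ := p.2 - a) LIN
    calc _ ≤ B ^2 *1 := mul_le_mul (pow_le_pow_left₀ (abs_nonneg _) ho 2) g (gk_pos _ _ _).le (sq_nonneg _)
      _ = _ := mul_one _
  · refine .of_forall fun y hy => ?_
    refine continuousAt_const.mul ?_
    unfold gk
    refine Real.continuous_exp.continuousAt.comp (ContinuousAt.div FUN FUN ?_)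
    simp; linarith
theorem fH_ge {W : RRR} {L x ts t p q : Real} (hc : ContinuousOn (fun y => W y t) (JJ L))
    (hpq : p ≤ q) (hp : -L ≤ p) (hq : q ≤ L) :
    ∫ y in p..q, W y t ^2 * gk x (ts - t) y ≤ fH W L x ts t := by
  refine intervalIntegral.integral_mono_interval hp hpq hq
    (.of_forall fun y => mul_nonneg (sq_nonneg _) (gk_pos _ _ _).le) ?_
  apply ContinuousOn.intervalIntegrable
  rw [uIcc_of_le LIN]
  exact (hc.pow 2).mul (gk_cont _ _).continuousOn
theorem fH_gec {W : RRR} {L x ts t p q m : Real} (hc : ContinuousOn (fun y => W y t) (JJ L))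
    (hpq : p ≤ q) (hp : -L ≤ p) (hq : q ≤ L) (hm : ∀ y ∈ Icc p q, m ≤ W y t ^2 * gk x (ts - t) y) :
    (q - p) * m ≤ fH W L x ts t := by
  refine le_trans ?_ (fH_ge hc hpq hp hq)
  have : ∫ _ in p..q, m = (q - p) * m := SIM
  rw [← this]
  refine intervalIntegral.integral_mono_on hpq SIM ?_ hm
  apply ContinuousOn.intervalIntegrable
  rw [uIcc_of_le hpq]
  exact ((hc.pow 2).mul (gk_cont _ _).continuousOn).mono (Icc_subset_Icc hp hq)
namespace FC
variable {W Wa Wb Wt : RRR} {L r α β M C B κ K : Real}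
theorem zero_of_small (h : FC W Wa Wb Wt L r α β M C B κ K) {ya ta k : Real} (az : |ya| < r /2) (al : ta ∈ Ioo α β)
    (hk :0 < k) (hkr : k < r ^2 /4)
    (hs : ∀ δ >0, ∃ t, t < ta ∧ ta - t < δ ∧ fH W L ya ta t ≤ Real.exp (-k / (ta - t))) :
    ∀ y, (y - ya) ^2 < k → W y ta =0 := by
  intro yc av
  by_contra hne
  have rb := h.rb
  have rL := h.rL
  have iu := abs_lt.1 az
  have hd : |yc - ya| < r /2 := by
    rw [← sq_lt_sq₀ (abs_nonneg _) LIN, sq_abs]; linarith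
  have hd' := abs_lt.1 hd
  have dq := Ioo_subset_Icc_self al
  set ci := |W yc ta| with dr
  have iw :0 < ci := abs_pos.2 hne
  have cW : ContinuousAt (fun y => W y ta) yc := (h.db yc ⟨LIN, LIN⟩ ta dq).continuousAt
  have ec : ∀ᶠ y in 𝓝 yc,3 /4 * ci < |W y ta| := cW.abs.eventually (lt_mem_nhds (by show _ < |W yc ta|; linarith))
  have ed : ∀ᶠ y in 𝓝 yc, (y - ya) ^2 < k :=
    (by fun_prop : Continuous fun y => (y - ya) ^2).continuousAt.eventually (gt_mem_nhds av)
  obtain ⟨η, na, hη⟩ := Metric.eventually_nhds_iff.1 (ec.and ed)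
  have Ba := h.Ba
  set m := (ci /2) ^2 with hm
  have ma :0 < m := POS
  have lim : Tendsto (fun τ : Real => Real.exp (-(3 * k /4) / τ)) (𝓝[>] 0) (𝓝 0) := by
    refine Real.tendsto_exp_atBot.comp ?_
    have := (tendsto_inv_nhdsGT_zero (𝕜 := Real)).const_mul_atTop_of_neg (r := -(3 * k /4)) (show -(3 * k /4) <0 by linarith)
    exact this.congr fun τ => (div_eq_mul_inv _ _).symm
  have eg : ∀ᶠ τ in 𝓝[>] (0:Real), Real.exp (-(3 * k /4) / τ) < η * m := lim.eventually (gt_mem_nhds POS)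
  obtain ⟨δ, da, hδ⟩ := mem_nhdsGT_iff_exists_Ioo_subset.1 eg
  obtain ⟨t, ho, aa, ae⟩ := hs (min δ (min (ta - α) (ci / (4 * (B +1))))) (by
    have :0 < δ := da
    have := al.1
    simp; refine ⟨by assumption, LIN, POS⟩)
  simp only [lt_min_iff] at aa
  have tc :0 < ta - t := LIN
  have htI : t ∈ Icc α β := ⟨LIN, by linarith [al.2]⟩
  have big : (yc + η /2 - (yc - η /2)) * (m * Real.exp (-k / (4 * (ta - t)))) ≤ fH W L ya ta t := by
    have inI : ∀ y ∈ Icc (yc - η /2) (yc + η /2),3 /4 * ci < |W y ta| ∧ (y - ya) ^2 < k := fun y hy => hη (by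
        rw [Real.dist_eq, abs_lt]; constructor <;> linarith [hy.1, hy.2])
    have inL : ∀ y ∈ Icc (yc - η /2) (yc + η /2), y ∈ JJ L := fun y hy => by
      have : |y - ya| < r /2 := by
        rw [← sq_lt_sq₀ (abs_nonneg _) LIN, sq_abs]; linarith [(inI y hy).2]
      have := abs_lt.1 this
      constructor <;> linarith
    refine fH_gec (h.cy htI) LIN (inL _ ⟨le_rfl, LIN⟩).1 (inL _ ⟨LIN, le_rfl⟩).2 fun y hy => ?_
    obtain ⟨qd, qe⟩ := inI y hy
    have lc := h.lipt (inL y hy) dq htI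
    have lf : B * |ta - t| ≤ ci /4 := by
      rw [abs_of_pos tc]
      have : (ta - t) * (4 * (B +1)) < ci := (lt_div_iff₀ POS).1 aa.2.2
      nlinarith
    have lg : ci /2 ≤ |W y t| := by
      have := abs_sub_abs_le_abs_sub (W y ta) (W y t)
      linarith
    rw [← sq_abs (W y t)]
    refine mul_le_mul (pow_le_pow_left₀ POS lg 2) ?_ (Real.exp_pos _).le (sq_nonneg _)
    unfold gk
    gcongr
  have ag := hδ ⟨tc, aa.1⟩
  have ag : Real.exp (-(3 * k /4) / (ta - t)) < η * m := ag
  have ej : Real.exp (-k / (ta - t)) = Real.exp (-(3 * k /4) / (ta - t)) * Real.exp (-k / (4 * (ta - t))) := by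
    rw [← Real.exp_add]; congr 1; field_simp; ring
  have := (big.trans ae).trans_eq ej
  have eu := Real.exp_pos (-k / (4 * (ta - t)))
  have : (η * m) * Real.exp (-k / (4 * (ta - t))) ≤ Real.exp (-(3 * k /4) / (ta - t)) * Real.exp (-k / (4 * (ta - t))) := by
    refine le_trans (le_of_eq ?_) this; ring
  exact absurd (le_of_mul_le_mul_right this eu) (not_le.2 ag)
theorem dich (h : FC W Wa Wb Wt L r α β M C B κ K) {ya ta : Real} (az : |ya| < r /2) (al : ta ∈ Ioo α β)
    (hne : ¬ ∃ ρ >0, ∀ y, |y - ya| < ρ → W y ta =0) {ε : Real} (hε :0 < ε) :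
    ∃ a, α < a ∧ a < ta ∧ ta - a < ε ∧ GS W L κ ya ta a ∧ (6 * fN W Wa L ya ta a +5) * (ta - a) < κ := by
  by_contra! hcon
  have ka := h.ka
  have Ka := h.Ka
  have rb := h.rb
  by_cases hs : ∀ δ >0, ∃ t, t < ta ∧ ta - t < δ ∧ fH W L ya ta t ≤ Real.exp (-(κ /32) / (ta - t))
  · have hz := h.zero_of_small az al (show 0 < κ /32 by positivity) (by have := h.kr; nlinarith) hs
    refine hne ⟨Real.sqrt (κ /32), POS, fun y hy => hz y ?_⟩
    have := (sq_lt_sq₀ (abs_nonneg _) POS).2 hy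
    rwa [sq_abs, Real.sq_sqrt POS] at this
  · push Not at hs
    obtain ⟨δ, da, hδ⟩ := hs
    set e := min (min (min δ ε) (ta - α)) (min (κ /20) (1 / (2 * K))) with he
    have eb :0 < e := by
      have := al.1
      simp only [he, lt_min_iff]; exact ⟨⟨⟨da, hε⟩, LIN⟩, POS, POS⟩
    have hall : ∀ t, t < ta → ta - t < e → α < t ∧ GS W L κ ya ta t ∧ -(κ /32) / (ta - t) < Real.log (fH W L ya ta t)
       ∧ κ ≤8 * (ta - t) * fN W Wa L ya ta t ∧ K * (ta - t) ≤1 /2 ∧ ta - t < κ /20 := by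
      intro t ho aa
      simp only [he, lt_min_iff] at aa
      obtain ⟨⟨⟨aa, ae⟩, ag⟩, ah, ak⟩ := aa
      have tc :0 < ta - t := LIN
      have gb := hδ t ho aa
      have gd : GS W L κ ya ta t := by
        refine lt_of_le_of_lt ?_ gb
        rw [Real.exp_le_exp]; gcongr; linarith
      have gc := hcon t LIN ho ae gd
      refine ⟨LIN, gd, ?_, by nlinarith, ?_, ah⟩
      · rwa [Real.lt_log_iff_exp_lt ((Real.exp_pos _).trans gb)]
      · have := (lt_div_iff₀ POS).1 ak; linarith
    have mon : ∀ b, ta - e /2 ≤ b → b < ta → Real.log (fH W L ya ta b) + κ /16 / (ta - b) ≤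
       Real.log (fH W L ya ta (ta - e /2)) + κ /16 / (ta - (ta - e /2)) := by
      intro b hb hb'
      refine neg_le_neg_iff.1 (mono_hd (f := fun t => -(Real.log (fH W L ya ta t) + κ /16 / (ta - t))) hb fun t ht => ?_)
      have htt : t < ta := ht.2.trans_lt hb'
      have tc :0 < ta - t := LIN
      obtain ⟨ai, aj, -, cx, ds, ix⟩ := hall t htt (by linarith [ht.1])
      obtain ⟨q, hd, hq⟩ := h.dlog ⟨ai, htt.trans al.2⟩ htt az.le aj
      have dc : HasDerivAt (fun t => κ /16 / (ta - t)) (κ /16 / (ta - t) ^2) t := by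
        have := (hasDerivAt_const t (κ /16)).div ((hasDerivAt_id t).const_sub ta) tc.ne'
        exact this.congr_deriv SIM
      refine ⟨_, (hd.add dc).neg, ?_⟩
      have qd := hq K LIN
      rw [mul_div_cancel_left₀ _ (by linarith : K ≠0)] at qd
      have qe : ta - t ≤ K * (ta - t) := by nlinarith
      have qf := (abs_le.1 qd).2
      set N := fN W Wa L ya ta t
      have Nc :2 ≤ N := by
        by_contra hc; push Not at hc
        nlinarith
      have qh : -(2 * N +1 /2) + q ≤ -(N /2) := LIN
      have ee : -((-(2 * N +1 /2) + q) / (ta - t) + κ /16 / (ta - t) ^2) =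
        (-(-(2 * N +1 /2) + q) * (ta - t) - κ /16) / (ta - t) ^2 := by field_simp; ring
      rw [ee]
      apply div_nonneg _ POS
      nlinarith
    set c := Real.log (fH W L ya ta (ta - e /2)) + κ /16 / (ta - (ta - e /2)) with hc
    have fin : ∀ τ,0 < τ → τ ≤ e /2 → κ /32 ≤ c * τ := by
      intro τ ho aa
      have mc := mon (ta - τ) LIN LIN
      obtain ⟨-, -, ar, -⟩ := hall (ta - τ) LIN LIN
      rw [sub_sub_cancel] at mc ar
      have : κ /32 / τ ≤ c := by
        have : κ /16 / τ = κ /32 / τ + κ /32 / τ := RIN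
        have : -(κ /32) / τ = -(κ /32 / τ) := RIN
        linarith
      rwa [div_le_iff₀ ho] at this
    have fa := fin (min (e /2) (κ / (64 * (|c| +1)))) POS (min_le_left _ _)
    have fd : c * min (e /2) (κ / (64 * (|c| +1))) ≤ |c| * (κ / (64 * (|c| +1))) := by
      have af :0 < min (e /2) (κ / (64 * (|c| +1))) := POS
      calc _ ≤ |c| * min (e /2) (κ / (64 * (|c| +1))) := by gcongr; exact le_abs_self c
        _ ≤ _ := by gcongr; exact min_le_right _ _
    have ff : |c| * (κ / (64 * (|c| +1))) ≤ κ /64 := by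
      rw [mul_div_assoc', div_le_div_iff₀ POS POS]
      nlinarith [abs_nonneg c]
    linarith
structure UF (W Wa : RRR) (L r α β κ K ya ta a Λ δ : Real) : Prop where
  da :0 < δ
  αa : α < a
  Lb :0 ≤ Λ
  aδ : a + δ < ta
  hx : ∀ x, |x - ya| < δ → |x| ≤ r /2
  hb : ta + δ ≤ β
  ho : ta + δ - a ≤1
  hk : K * (ta + δ - a) ≤1 /2
  gs : ∀ x ts, |x - ya| < δ → |ts - ta| < δ → ∀ t ∈ Ico a ts, GS W L κ x ts t
  nb : ∀ x ts, |x - ya| < δ → |ts - ta| < δ → ∀ t ∈ Ico a ts, fN W Wa L x ts t ≤2 * Λ +1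
theorem unif (h : FC W Wa Wb Wt L r α β M C B κ K) {ya ta : Real} (az : |ya| < r /2) (al : ta ∈ Ioo α β)
    (hne : ¬ ∃ ρ >0, ∀ y, |y - ya| < ρ → W y ta =0) :
    ∃ a Λ δ, UF W Wa L r α β κ K ya ta a Λ δ := by
  have Ka := h.Ka
  obtain ⟨a, ai, aj, ar, cx, ds⟩ := h.dich az al hne (ε :=1 / (4 * K)) POS
  have ha : a ∈ Icc α β := ⟨ai.le, by linarith [al.2]⟩
  have cH := fH_basecont (x := ya) h.La (h.cy ha) (fun y hy => (h.bd y hy a ha).1) aj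
  have cE := fH_basecont (x := ya) h.La (h.cj ha) (fun y hy => (h.bd y hy a ha).2.1) aj
  have Hc :0 < fH W L ya ta a := (Real.exp_pos _).trans cx
  have cN : ContinuousAt (fun p : Real × Real => fN W Wa L p.1 p.2 a) (ya, ta) :=
    ((by fun_prop : ContinuousAt (fun p : Real × Real => p.2 - a) (ya, ta)).mul cE).div cH Hc.ne'
  obtain ⟨Λ, lc, lf⟩ : ∃ Λ, fN W Wa L ya ta a < Λ ∧ (6 * Λ +5) * (ta - a) < κ := by
    have : Tendsto (fun Λ => (6 * Λ +5) * (ta - a)) (𝓝[>] (fN W Wa L ya ta a)) (𝓝 ((6 * (fN W Wa L ya ta a) +5) * (ta - a))) :=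
      (by fun_prop : Continuous fun Λ => (6 * Λ +5) * (ta - a)).continuousAt.tendsto.mono_left nhdsWithin_le_nhds
    obtain ⟨Λ, ho, aa⟩ := ((this.eventually (gt_mem_nhds ds)).and self_mem_nhdsWithin).exists
    exact ⟨Λ, aa, ho⟩
  have ew : ∀ᶠ p : Real × Real in 𝓝 (ya, ta), Real.exp (-κ / (p.2 - a)) < fH W L p.1 p.2 a := by
    refine ContinuousAt.eventually_lt ?_ cH cx
    exact Real.continuous_exp.continuousAt.comp (ContinuousAt.div FUN FUN (by simp; linarith))
  have ey : ∀ᶠ p : Real × Real in 𝓝 (ya, ta), fN W Wa L p.1 p.2 a < Λ := cN.eventually (gt_mem_nhds lc)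
  have ez : ∀ᶠ p : Real × Real in 𝓝 (ya, ta), (6 * Λ +5) * (p.2 - a) < κ :=
    (by fun_prop : Continuous fun p : Real × Real => (6 * Λ +5) * (p.2 - a)).continuousAt.eventually (gt_mem_nhds lf)
  obtain ⟨dg, fh, fj⟩ := Metric.eventually_nhds_iff.1 (ew.and (ey.and ez))
  have nc := fN_nonneg W Wa h.La ya aj
  have hyr := abs_lt.1 az
  obtain ⟨δ, da, dd⟩ : ∃ δ >0, δ ≤ dg ∧ δ < ta - a ∧ δ ≤ r /2 - |ya| ∧ δ ≤ β - ta ∧ δ ≤1 / (4 * K) := by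
    refine ⟨min (min dg ((ta - a) /2)) (min (r /2 - |ya|) (min (β - ta) (1 / (4 * K)))), ?_, ?_, ?_, ?_, ?_, ?_⟩
    · have := al.2
      simp only [gt_iff_lt, lt_min_iff]
      exact ⟨⟨fh, LIN⟩, LIN, LIN, POS⟩
    · exact (min_le_left _ _).trans (min_le_left _ _)
    · exact ((min_le_left _ _).trans (min_le_right _ _)).trans_lt LIN
    · exact (min_le_right _ _).trans (min_le_left _ _)
    · exact (min_le_right _ _).trans ((min_le_right _ _).trans (min_le_left _ _))
    · exact (min_le_right _ _).trans ((min_le_right _ _).trans (min_le_right _ _))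
  obtain ⟨db, dc, iy, iz, jd⟩ := dd
  have hkk : K * (ta + δ - a) ≤1 /2 := by
    have : K * (1 / (4 * K)) =1 /4 := by field_simp
    nlinarith
  have hx : ∀ x, |x - ya| < δ → |x| ≤ r /2 := fun x hx => by
    have := abs_sub_abs_le_abs_sub x ya; linarith
  have fk : ta + δ - a ≤1 := by nlinarith
  have key : ∀ x ts, |x - ya| < δ → |ts - ta| < δ → ∀ t ∈ Ico a ts, GS W L κ x ts t ∧ fN W Wa L x ts t ≤2 * Λ +1 := by
    intro x ts cm ay
    obtain ⟨gb, gd, gc⟩ := fj (y := (x, ts)) (by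
      rw [Prod.dist_eq, max_lt_iff, Real.dist_eq, Real.dist_eq]; exact ⟨LIN, LIN⟩)
    have := abs_lt.1 ay
    exact h.dbl ai LIN LIN LIN (by nlinarith) (hx x cm) gb LIN gd.le gc.le
  exact ⟨a, Λ, δ, da, ai, LIN, LIN, hx, LIN, fk, hkk,
    fun x ts p q t ht => (key x ts p q t ht).1, fun x ts p q t ht => (key x ts p q t ht).2⟩
theorem UF.low (h : FC W Wa Wb Wt L r α β M C B κ K) {ya ta a Λ δ : Real} (u : UF W Wa L r α β κ K ya ta a Λ δ)
    {x ts s t : Real} (hx : |x - ya| < δ) (hts : |ts - ta| < δ) (hs : a ≤ s) (hst : s ≤ t) (ht : t < ts) :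
    Real.log (fH W L x ts s) - (6 * Λ +5) * Real.log (ts - s) ≤
      Real.log (fH W L x ts t) - (6 * Λ +5) * Real.log (ts - t) := by
  have Ka := h.Ka
  have ho := abs_lt.1 hts
  have := u.hb
  refine h.lower (u.αa.trans_le hs) LIN ht hst (u.hx x hx)
    (fun v hv => u.gs x ts hx hts v ⟨hs.trans hv.1, hv.2.trans_lt ht⟩) fun v hv q hq => ?_
  refine h.qb (by linarith [hv.2]) ?_ hq (u.nb x ts hx hts v ⟨hs.trans hv.1, hv.2.trans_lt ht⟩)
  have := u.hk
  nlinarith [hv.1]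
theorem UF.ucl (h : FC W Wa Wb Wt L r α β M C B κ K) {ya ta a Λ δ : Real} (u : UF W Wa L r α β κ K ya ta a Λ δ)
    {p q : Real} (hpq : p < q) (hp : ya - δ < p) (hq : q < ya + δ) : ∃ y ∈ Ioo p q, W y ta ≠0 := by
  by_contra! hz
  have ka := h.ka
  have aδ := u.aδ
  have da := u.da
  have La := h.La
  have Ba := h.Ba
  set yc := (p + q) /2 with av
  set d := (q - p) /2 with hd
  have de :0 < d := by rw [hd]; linarith
  have hy1δ : |yc - ya| < δ := by rw [abs_lt, av]; constructor <;> linarith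
  have al : ta ∈ Icc α β := ⟨by linarith [u.αa], by linarith [u.hb]⟩
  set n :=6 * Λ +5 with hn
  have nc :0 ≤ n := by rw [hn]; linarith [u.Lb]
  have key : ∀ θ ∈ Ioo 0 δ, d ^2 /4 ≤ θ * (Real.log (2 * L * B ^2 +1) + κ / (ta - a)) - n * (θ * Real.log θ) := by
    intro θ hθ
    have hts : |ta + θ - ta| < δ := by rw [add_sub_cancel_left, abs_of_pos hθ.1]; exact hθ.2
    have g := u.gs yc (ta + θ) hy1δ hts
    have lo := UF.low h u hy1δ hts le_rfl (show a ≤ ta by linarith) (show ta < ta + θ by linarith [hθ.1])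
    have ga := g a ⟨le_rfl, by linarith [hθ.1]⟩
    have gt := g ta ⟨LIN, by linarith [hθ.1]⟩
    have lc : -κ / (ta + θ - a) < Real.log (fH W L yc (ta + θ) a) := by
      rw [Real.lt_log_iff_exp_lt ((Real.exp_pos _).trans ga)]; exact ga
    have lf : -κ / (ta - a) ≤ -κ / (ta + θ - a) := by
      rw [neg_div, neg_div, neg_le_neg_iff]; gcongr <;> linarith [hθ.1]
    have lg : Real.log (ta + θ - a) ≤0 := Real.log_nonpos (by linarith [hθ.1]) (by linarith [u.ho, hθ.2])
    have li := mul_nonpos_of_nonneg_of_nonpos nc lg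
    rw [show ta + θ - ta = θ by ring] at lo
    have up : fH W L yc (ta + θ) ta ≤ (2 * L * B ^2 +1) * Real.exp (-(d ^2 /4) / θ) := by
      have ia : IntervalIntegrable (fun y => W y ta ^2 * gk yc (ta + θ - ta) y) volume (-L) L := by
        apply ContinuousOn.intervalIntegrable
        rw [uIcc_of_le LIN]
        exact ((h.cy al).pow 2).mul (gk_cont _ _).continuousOn
      have := SL.imono La ia (q := fun _ => B ^2 * Real.exp (-(d ^2 /4) / θ)) SIM (fun y hy => ?_)
      · refine this.trans ?_
        simp only [intervalIntegral.integral_const, smul_eq_mul]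
        have := Real.exp_pos (-(d ^2 /4) / θ)
        nlinarith
      · by_cases hyy : y ∈ Ioo p q
        · rw [hz y hyy]; simp; positivity
        · have hb := (h.bd y hy ta al).1
          rw [← sq_abs]
          refine mul_le_mul (pow_le_pow_left₀ (abs_nonneg _) hb 2) ?_ (gk_pos _ _ _).le (sq_nonneg _)
          unfold gk
          rw [show ta + θ - ta = θ by ring, Real.exp_le_exp, div_le_div_iff₀ (by linarith [hθ.1]) hθ.1]
          have : d ^2 ≤ (y - yc) ^2 := by
            rw [← sq_abs (y - yc)]
            refine pow_le_pow_left₀ de.le ?_ 2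
            rw [mem_Ioo, not_and_or, not_lt, not_lt] at hyy
            rcases hyy with ah | ah
            · refine le_trans ?_ (neg_le_abs _); linarith
            · refine le_trans ?_ (le_abs_self _); linarith
          nlinarith [hθ.1]
    have ue := Real.log_le_log ((Real.exp_pos _).trans gt) up
    rw [Real.log_mul POS (Real.exp_pos _).ne', Real.log_exp] at ue
    have lh : d ^2 /4 / θ ≤ Real.log (2 * L * B ^2 +1) + κ / (ta - a) - n * Real.log θ := by
      have ec : -(d ^2 /4) / θ = -(d ^2 /4 / θ) := RIN
      have ed : -κ / (ta - a) = - (κ / (ta - a)) := RIN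
      linarith
    rw [div_le_iff₀ hθ.1] at lh
    linarith
  have lim : Tendsto (fun θ : Real => θ * (Real.log (2 * L * B ^2 +1) + κ / (ta - a)) - n * (θ * Real.log θ)) (𝓝[>] 0) (𝓝 0) := by
    have : Continuous (fun θ : Real => θ * (Real.log (2 * L * B ^2 +1) + κ / (ta - a)) - n * (θ * Real.log θ)) := by
      have := Real.continuous_mul_log
      fun_prop
    have := this.tendsto 0
    simp only [zero_mul, mul_zero, sub_zero] at this
    exact this.mono_left nhdsWithin_le_nhds
  have := ge_of_tendsto lim (by filter_upwards [Ioo_mem_nhdsGT da] with θ hθ using key θ hθ)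
  have :0 < d ^2 /4 := POS
  linarith
end FC
set_option autoImplicit false
theorem ivcs {f : RtR} {a b : Real} (hab : a ≤ b) (hf : ContinuousOn f (Icc a b)) :
    (∫ y in a..b, f y) ^2 ≤ (b - a) * ∫ y in a..b, f y ^2 := by
  rcases hab.eq_or_lt with rfl | hab'
  · simp
  have u : uIcc a b = Icc a b := uIcc_of_le hab
  have ia : IntervalIntegrable f volume a b := ContinuousOn.intervalIntegrable (by rwa [u])
  have ic : IntervalIntegrable (fun y => f y ^2) volume a b := ContinuousOn.intervalIntegrable (by rw [u]; exact hf.pow 2)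
  set I := ∫ y in a..b, f y with hI
  set m := I / (b - a) with hm
  have af :0 ≤ ∫ y in a..b, (f y - m) ^2 := intervalIntegral.integral_nonneg hab fun y _ => sq_nonneg _
  have e : ∫ y in a..b, (f y - m) ^2 = (∫ y in a..b, f y ^2) -2 * m * I + m ^2 * (b - a) := by
    have : ∀ y, (f y - m) ^2 = (1 * f y ^2 + (-(2 * m)) * f y) + m ^2 := fun y => by ring
    simp_rw [this]
    rw [intervalIntegral.integral_add ((ic.const_mul 1).add (ia.const_mul _)) SIM, la ic ia]
    simp; ring
  have ho : m * (b - a) = I := by rw [hm]; field_simp [(sub_pos.2 hab').ne']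
  have aa :0 < b - a := sub_pos.2 hab'
  rw [e] at af
  have ae :0 ≤ (b - a) * ((∫ y in a..b, f y ^2) -2 * m * I + m ^2 * (b - a)) := mul_nonneg aa.le af
  nlinarith
theorem ivmin {f : RtR} {a b : Real} (hab : a < b) (hf : ContinuousOn f (Icc a b)) :
    ∃ c ∈ Icc a b, (b - a) * f c ≤ ∫ y in a..b, f y := by
  obtain ⟨c, hc, h⟩ := isCompact_Icc.exists_isMinOn (nonempty_Icc.2 hab.le) hf
  refine ⟨c, hc, ?_⟩
  have : ∫ _ in a..b, f c = (b - a) * f c := SIM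
  rw [← this]
  refine intervalIntegral.integral_mono_on hab.le SIM ?_ fun y hy => h hy
  exact ContinuousOn.intervalIntegrable (by rwa [uIcc_of_le hab.le])
theorem grow1 {φ d g : RtR} {A Y p q : Real} (hA :0 ≤ A) (hp : -Y ≤ p) (hpq : p ≤ q) (hq : q ≤ Y)
    (hφ : ∀ y ∈ JJ Y, HasDerivAt φ (d y) y) (af : ∀ y ∈ JJ Y,0 ≤ φ y)
    (hg : ContinuousOn g (JJ Y)) (gg : ∀ y ∈ JJ Y,0 ≤ g y)
    (hd : ∀ y ∈ JJ Y, d y ≤ A * φ y + g y) :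
    φ q ≤ Real.exp (2 * A * Y) * (φ p + ∫ y in (-Y)..Y, g y) := by
  have hI : IntervalIntegrable g volume (-Y) Y := ContinuousOn.intervalIntegrable (by rwa [uIcc_of_le LIN])
  have key : ∀ x ∈ Icc p q, (Real.exp (-A * (x - p)) * φ x) ≤ φ p + ∫ y in p..x, g y := by
    intro x hx
    have sub : Icc p x ⊆ JJ Y := Icc_subset_Icc hp (hx.2.trans hq)
    have hder : ∀ y ∈ Icc p x, HasDerivAt (fun y => Real.exp (-A * (y - p)) * φ y) (Real.exp (-A * (y - p)) * (d y - A * φ y)) y := by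
      intro y hy
      have ho := (((hasDerivAt_id y).sub_const p).const_mul (-A)).exp
      exact (ho.mul (hφ y (sub hy))).congr_deriv (by simp; ring)
    have := image_le_of_deriv_right_le_deriv_boundary (f := fun y => Real.exp (-A * (y - p)) * φ y)
      (f' := fun y => Real.exp (-A * (y - p)) * (d y - A * φ y)) (a := p) (b := x)
      (B := fun y => φ p + ∫ z in p..y, g z) (B' := fun y => g y)
      (fun y hy => (hder y hy).continuousAt.continuousWithinAt)
      (fun y hy => (hder y (Ico_subset_Icc_self hy)).hasDerivWithinAt) SIM
      ?_ ?_ ?_ ⟨hx.1, le_rfl⟩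
    · exact this
    · refine continuousOn_const.add ?_
      have := intervalIntegral.continuousOn_primitive_interval (μ := volume) (f := g) (a := p) (b := x)
        (by rw [uIcc_of_le hx.1]; exact (hg.mono sub).integrableOn_Icc)
      rwa [uIcc_of_le hx.1] at this
    · intro y hy
      have hyY := sub (Ico_subset_Icc_self hy)
      have : HasDerivWithinAt (fun y => ∫ z in p..y, g z) (g y) (Ici y) y := by
        have hlt : y < Y := hy.2.trans_le (hx.2.trans hq)
        have hcw : ContinuousWithinAt g (Ioi y) y := by
          refine (hg y hyY).mono_of_mem_nhdsWithin ?_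
          exact mem_of_superset (Ioo_mem_nhdsGT hlt) fun z hz => ⟨hyY.1.trans hz.1.le, hz.2.le⟩
        refine intervalIntegral.integral_hasDerivWithinAt_right ?_ (t := Ioi y) ?_ hcw
        · exact ContinuousOn.intervalIntegrable (by rw [uIcc_of_le hy.1]; exact hg.mono (Icc_subset_Icc hp hyY.2))
        · refine ⟨Ioo y Y, Ioo_mem_nhdsGT hlt, ?_⟩
          exact (hg.mono fun z hz => ⟨hyY.1.trans hz.1.le, hz.2.le⟩).aestronglyMeasurable measurableSet_Ioo
      exact this.const_add _
    · intro y hy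
      have hyY := sub (Ico_subset_Icc_self hy)
      have ho := hd y hyY
      have aa : Real.exp (-A * (y - p)) ≤1 := by
        rw [Real.exp_le_one_iff]; nlinarith [hy.1]
      have ae := Real.exp_pos (-A * (y - p))
      have := gg y hyY
      show Real.exp (-A * (y - p)) * (d y - A * φ y) ≤ g y
      nlinarith
  have k := key q ⟨hpq, le_rfl⟩
  have ia : ∫ y in p..q, g y ≤ ∫ y in (-Y)..Y, g y := by
    refine intervalIntegral.integral_mono_interval hp hpq hq ?_ hI
    rw [Filter.EventuallyLE, ae_restrict_iff' measurableSet_Ioc]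
    exact .of_forall fun y hy => gg y (Ioc_subset_Icc_self hy)
  have ij :0 ≤ ∫ y in (-Y)..Y, g y := intervalIntegral.integral_nonneg LIN gg
  have ec : φ q = Real.exp (A * (q - p)) * (Real.exp (-A * (q - p)) * φ q) := by
    rw [← mul_assoc, ← Real.exp_add]; simp
  rw [ec]
  have := af p ⟨hp, LIN⟩
  refine mul_le_mul (Real.exp_le_exp.2 (by nlinarith)) (k.trans LIN) ?_ (Real.exp_pos _).le
  exact mul_nonneg (Real.exp_pos _).le (af q ⟨LIN, hq⟩)
theorem grow {φ d g : RtR} {A Y p q : Real} (hA :0 ≤ A) (hp : p ∈ JJ Y) (hq : q ∈ JJ Y)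
    (hφ : ∀ y ∈ JJ Y, HasDerivAt φ (d y) y) (af : ∀ y ∈ JJ Y,0 ≤ φ y)
    (hg : ContinuousOn g (JJ Y)) (gg : ∀ y ∈ JJ Y,0 ≤ g y)
    (hd : ∀ y ∈ JJ Y, |d y| ≤ A * φ y + g y) :
    φ q ≤ Real.exp (2 * A * Y) * (φ p + ∫ y in (-Y)..Y, g y) := by
  rcases le_total p q with hpq | hpq
  · exact grow1 hA hp.1 hpq hq.2 hφ af hg gg fun y hy => (le_abs_self _).trans (hd y hy)
  · have nm : ∀ y ∈ JJ Y, -y ∈ JJ Y := fun y hy => ⟨by linarith [hy.2], by linarith [hy.1]⟩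
    have := grow1 (φ := fun y => φ (-y)) (d := fun y => -d (-y)) (g := fun y => g (-y)) (p := -p) (q := -q) hA
      (nm p hp).1 LIN (nm q hq).2 (fun y hy => ?_) (fun y hy => af _ (nm y hy))
      (hg.comp continuous_neg.continuousOn nm) (fun y hy => gg _ (nm y hy)) fun y hy => (neg_le_abs _).trans (hd _ (nm y hy))
    · simp only [neg_neg, intervalIntegral.integral_comp_neg] at this
      exact this
    · have := (hφ (-y) (nm y hy)).comp y (hasDerivAt_neg y)
      exact this.congr_deriv SIM
def OdeP (Y N C eb : Real) : Prop := ∀ (v vd ve : RtR) (n h s z : Real),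
    0 ≤ n → n ≤ N →0 < h →0 < s → s ≤ eb → -Y ≤ z - s → z + s ≤ Y →
    (∀ y ∈ JJ Y, HasDerivAt v (vd y) y) → (∀ y ∈ JJ Y, HasDerivAt vd (ve y) y) →
    ContinuousOn ve (JJ Y) → (∃ y ∈ JJ Y, h / (4 * Y) ≤ v y ^2) →
    (∫ y in (-Y)..Y, (ve y - y /2 * vd y + n * v y) ^2) ≤ eb * h → (∫ y in (-Y)..Y, vd y ^2) ≤ C * h →
    (∫ y in (z - s)..(z + s), v y ^2) ≤ C * s ^4 * h → False
theorem ode_lem (Y N C : Real) (hY :1 ≤ Y) (hN :0 ≤ N) (hC :0 ≤ C) : ∃ eb >0, eb ≤1 ∧ OdeP Y N C eb := by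
  set Q := Real.exp (2 * (2 + N + Y) * Y) with hQ
  have Qb :0 < Q := Real.exp_pos _
  have Yb :0 < Y := LIN
  refine ⟨min 1 (1 / (8 * Y * Q * (16 * C +1))), POS, min_le_left _ _, ?_⟩
  intro v vd ve n h s z nc nN af sf se za zb db dc ch ⟨ys, hys, hv⟩ hR hE hB
  have ec : min 1 (1 / (8 * Y * Q * (16 * C +1))) ≤1 := min_le_left _ _
  have ed : min 1 (1 / (8 * Y * Q * (16 * C +1))) ≤1 / (8 * Y * Q * (16 * C +1)) := min_le_right _ _
  set eb := min 1 (1 / (8 * Y * Q * (16 * C +1)))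
  have sd : s ≤1 := se.trans ec
  have cv : ContinuousOn v (JJ Y) := fun y hy => (db y hy).continuousAt.continuousWithinAt
  have di : ContinuousOn vd (JJ Y) := fun y hy => (dc y hy).continuousAt.continuousWithinAt
  have iv : IntervalIntegrable (fun y => v y ^2) volume (z - s) (z + s) :=
    ContinuousOn.intervalIntegrable (by rw [uIcc_of_le LIN]; exact (cv.pow 2).mono (Icc_subset_Icc za zb))
  have sm : ∀ p q, z - s ≤ p → p < q → q ≤ z + s → s /2 ≤ q - p → ∃ c ∈ Icc p q, v c ^2 ≤2 * C * s ^3 * h := by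
    intro p q ho aa ae ag
    obtain ⟨c, hc, ah⟩ := ivmin (f := fun y => v y ^2) aa ((cv.pow 2).mono (Icc_subset_Icc (za.trans ho) (ae.trans zb)))
    refine ⟨c, hc, ?_⟩
    have ak := intervalIntegral.integral_mono_interval ho aa.le ae (.of_forall fun y => sq_nonneg (v y)) iv
    have ap : s /2 * v c ^2 ≤ C * s ^4 * h := by
      refine le_trans ?_ (ah.trans (ak.trans hB))
      gcongr
    have aw : s /2 * v c ^2 ≤ s /2 * (2 * C * s ^3 * h) := ap.trans_eq RIN
    exact le_of_mul_le_mul_left aw POS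
  obtain ⟨a, ha, va⟩ := sm (z - s) (z - s /2) le_rfl LIN LIN LIN
  obtain ⟨b, hb, vb⟩ := sm (z + s /2) (z + s) LIN LIN le_rfl LIN
  have hab : a < b := by linarith [ha.2, hb.1]
  have sub : Icc a b ⊆ JJ Y := Icc_subset_Icc (by linarith [ha.1]) (by linarith [hb.2])
  obtain ⟨c, hc, hsl⟩ := exists_hasDerivAt_eq_slope v vd hab (cv.mono sub) fun y hy => db y (sub (Ioo_subset_Icc_self hy))
  have hcY := sub (Ioo_subset_Icc_self hc)
  have ba : s ≤ b - a := by linarith [ha.2, hb.1]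
  have wa : vd c ^2 ≤8 * C * s * h := by
    have ho : vd c * (b - a) = v b - v a := by rw [hsl]; field_simp [(sub_pos.2 hab).ne']
    have aa : vd c ^2 * s ^2 ≤ (8 * C * s * h) * s ^2 := by
      calc vd c ^2 * s ^2 ≤ vd c ^2 * (b - a) ^2 := GCO
        _ = (v b - v a) ^2 := by rw [← ho]; ring
        _ ≤2 * v b ^2 +2 * v a ^2 := by nlinarith [sq_nonneg (v b + v a)]
        _ ≤ _ := LIN
    exact le_of_mul_le_mul_right aa POS
  have wc : v c ^2 ≤8 * C * s * h := by
    have e : ∫ y in a..c, vd y = v c - v a := by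
      refine intervalIntegral.integral_eq_sub_of_hasDerivAt (fun y hy => db y ?_) (ContinuousOn.intervalIntegrable (di.mono ?_))
      · rw [uIcc_of_le hc.1.le] at hy; exact sub ⟨hy.1, hy.2.trans hc.2.le⟩
      · rw [uIcc_of_le hc.1.le]; exact fun y hy => sub ⟨hy.1, hy.2.trans hc.2.le⟩
    have k := ivcs hc.1.le (di.mono fun y hy => sub ⟨hy.1, hy.2.trans hc.2.le⟩)
    rw [e] at k
    have kc : ∫ y in a..c, vd y ^2 ≤ C * h := by
      refine le_trans (intervalIntegral.integral_mono_interval (by linarith [ha.1]) hc.1.le hcY.2 (.of_forall fun y => sq_nonneg (vd y))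
        (ContinuousOn.intervalIntegrable (by rw [uIcc_of_le LIN]; exact di.pow 2))) hE
    have ke : (v c - v a) ^2 ≤ (2 * s) * (C * h) := by
      refine k.trans (mul_le_mul (by linarith [ha.1, hc.2, hb.2]) kc ?_ LIN)
      exact intervalIntegral.integral_nonneg hc.1.le fun y _ => sq_nonneg _
    have kd : s ^3 ≤ s := by nlinarith [mul_pos sf sf]
    have kf :2 * C * s ^3 * h ≤2 * C * s * h := GCO
    nlinarith [sq_nonneg (v c -2 * v a)]
  have ha' := grow (φ := fun y => v y ^2 + vd y ^2) (d := fun y =>2 * v y * vd y +2 * vd y * ve y)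
    (g := fun y => (ve y - y /2 * vd y + n * v y) ^2) (A :=2 + N + Y) POS hcY hys
    (fun y hy => (((db y hy).pow 2).add ((dc y hy).pow 2)).congr_deriv SIM) (fun y _ => by positivity)
    FUN (fun y _ => sq_nonneg _) (fun y hy => ?_)
  · change v ys ^2 + vd ys ^2 ≤ Q * (v c ^2 + vd c ^2 + _) at ha'
    have fa : h / (4 * Y) ≤ Q * ((16 * C +1) * (eb * h)) := by
      have :0 ≤ vd ys ^2 := sq_nonneg _
      refine (hv.trans LIN).trans (ha'.trans ?_)
      gcongr
      have : C * s * h ≤ C * eb * h := GCO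
      linarith
    have fd : Q * ((16 * C +1) * (eb * h)) ≤ Q * ((16 * C +1) * (1 / (8 * Y * Q * (16 * C +1)) * h)) := GCO
    have ff : Q * ((16 * C +1) * (1 / (8 * Y * Q * (16 * C +1)) * h)) = h / (8 * Y) := by field_simp
    have fn : h / (8 * Y) < h / (4 * Y) := by gcongr; linarith
    linarith
  · set ρ := ve y - y /2 * vd y + n * v y with hρ
    have : ve y = ρ + y /2 * vd y - n * v y := by rw [hρ]; ring
    have hyy : |y| ≤ Y := abs_le.2 hy
    show |2 * v y * vd y +2 * vd y * ve y| ≤ (2 + N + Y) * (v y ^2 + vd y ^2) + ρ ^2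
    rw [this]
    have av := hy.1
    have je := hy.2
    have pa :0 ≤ (N - n) * (v y ^2 + vd y ^2) := mul_nonneg LIN POS
    have pb :0 ≤ n * (v y + vd y) ^2 := POS
    have pd :0 ≤ n * (v y - vd y) ^2 := POS
    have pe :0 ≤ (Y - y) * vd y ^2 := mul_nonneg LIN (sq_nonneg _)
    have pf :0 ≤ (Y + y) * vd y ^2 := mul_nonneg LIN (sq_nonneg _)
    have pg :0 ≤ Y * v y ^2 := POS
    rw [abs_le]
    have ph := sq_nonneg (vd y + ρ)
    have pj := sq_nonneg (vd y - ρ)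
    have pk := sq_nonneg (v y + vd y)
    have pl := sq_nonneg (v y - vd y)
    have pm := sq_nonneg (v y)
    constructor <;> linarith
set_option autoImplicit false
theorem SL.tail {L x τ : Real} {w wa wb f : RtR} (h : SL L x τ w wa wb f) :
    ∫ y in (-L)..L, (y - x) ^2 * w y ^2 * gk x τ y ≤
      4 * τ * ((∫ y in (-L)..L, w y ^2 * gk x τ y) +4 * τ * ∫ y in (-L)..L, wa y ^2 * gk x τ y) := by
  have c := h.c
  have ce := h.ce
  have tc := h.tc
  have cg : ContinuousOn (gk x τ) (JJ L) := (gk_cont x τ).continuousOn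
  have e := SL.ibp (x := x) (p := fun y => w y ^2) (pa := fun y =>2 * w y * wa y) (qd := fun y => y - x) (qe := fun _ =>1) h.La h.tc
    (fun y hy => ((h.db y hy).pow 2).congr_deriv SIM) (fun y hy => (hasDerivAt_id y).sub_const x)
    FUN FUN (by simp [h.bc]) (by simp [h.be])
  have ij := h.ii (k := fun y => w y ^2 * gk x τ y) FUN
  have ia := h.ii (k := fun y => wa y ^2 * gk x τ y) FUN
  have ic := h.ii (k := fun y => (y - x) ^2 * w y ^2 * gk x τ y) FUN
  have ie := h.ii (k := fun y =>2 * w y * wa y * (y - x) * gk x τ y) FUN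
  have ed : ∫ y in (-L)..L, w y ^2 * (1 - (y - x) / (2 * τ) * (y - x)) * gk x τ y =
      1 * (∫ y in (-L)..L, w y ^2 * gk x τ y) + (-(1 / (2 * τ))) * ∫ y in (-L)..L, (y - x) ^2 * w y ^2 * gk x τ y := by
    rw [← la ij ic]; congr 1; ext y; field_simp; ring
  rw [ed] at e
  have eg : ∫ y in (-L)..L,2 * w y * wa y * (y - x) * gk x τ y ≤
     (1 / (4 * τ)) * (∫ y in (-L)..L, (y - x) ^2 * w y ^2 * gk x τ y) + (4 * τ) * ∫ y in (-L)..L, wa y ^2 * gk x τ y := by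
    rw [← la ic ia]
    refine SL.imono h.La ie ((ic.const_mul _).add (ia.const_mul _)) fun y hy => ?_
    have g := gk_pos x τ y
    have :0 ≤ (1 / (4 * τ)) * ((y - x) * w y -4 * τ * wa y) ^2 * gk x τ y := POS
    have em : (1 / (4 * τ)) * ((y - x) * w y -4 * τ * wa y) ^2 * gk x τ y =
      1 / (4 * τ) * ((y - x) ^2 * w y ^2 * gk x τ y) +4 * τ * (wa y ^2 * gk x τ y) -2 * w y * wa y * (y - x) * gk x τ y := by
      field_simp; ring
    linarith
  set S := ∫ y in (-L)..L, (y - x) ^2 * w y ^2 * gk x τ y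
  set H := ∫ y in (-L)..L, w y ^2 * gk x τ y
  set E := ∫ y in (-L)..L, wa y ^2 * gk x τ y
  have ej : S / (4 * τ) ≤ H +4 * τ * E := by
    have : S / (4 * τ) =1 / (2 * τ) * S -1 / (4 * τ) * S := by field_simp; ring
    linarith
  rw [div_le_iff₀ POS] at ej
  linarith
theorem SL.mass {L x τ Y N : Real} {w wa wb f : RtR} (h : SL L x τ w wa wb f) (hY :0 < Y) (hYN :8 * (1 +4 * N) ≤ Y ^2)
    (hN : τ * (∫ y in (-L)..L, wa y ^2 * gk x τ y) ≤ N * ∫ y in (-L)..L, w y ^2 * gk x τ y)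
    (ho : -L ≤ x - √τ * Y) (aa : x + √τ * Y ≤ L) :
    ∃ y ∈ Icc (x - √τ * Y) (x + √τ * Y), (∫ y in (-L)..L, w y ^2 * gk x τ y) ≤4 * Y * √τ * w y ^2 := by
  have c := h.c
  have tc := h.tc
  have ma :0 < √τ := POS
  have mY :0 < √τ * Y := POS
  have mb : √τ ^2 = τ := Real.sq_sqrt tc.le
  have cg : ContinuousOn (gk x τ) (JJ L) := (gk_cont x τ).continuousOn
  have ij := h.ii (k := fun y => w y ^2 * gk x τ y) FUN
  have ic := h.ii (k := fun y => (y - x) ^2 * w y ^2 * gk x τ y) FUN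
  set F := fun y =>1 * (w y ^2 * gk x τ y) + (-(1 / (Y ^2 * τ))) * ((y - x) ^2 * w y ^2 * gk x τ y) with hF
  have cF : ContinuousOn F (JJ L) := by rw [hF]; fun_prop
  have e := la (p :=1) (q := -(1 / (Y ^2 * τ))) ij ic
  have t := h.tail
  set S := ∫ y in (-L)..L, (y - x) ^2 * w y ^2 * gk x τ y
  set H := ∫ y in (-L)..L, w y ^2 * gk x τ y
  have Hc :0 ≤ H := intervalIntegral.integral_nonneg (by linarith [h.La]) fun y _ => mul_nonneg (sq_nonneg _) (gk_pos _ _ _).le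
  set E := ∫ y in (-L)..L, wa y ^2 * gk x τ y
  have sd :1 / (Y ^2 * τ) * S ≤ H /2 := by
    rw [one_div_mul_eq_div, div_le_iff₀ POS]
    have : S ≤4 * τ * (H +4 * (N * H)) := t.trans (by gcongr ?_ * (H + ?_); linarith)
    nlinarith [mul_nonneg (sub_nonneg.2 hYN) (mul_nonneg tc.le Hc)]
  have sc : H /2 ≤ ∫ y in (-L)..L, F y := by rw [hF, e]; linarith
  set p := x - √τ * Y
  set q := x + √τ * Y
  have fac : ∀ y, F y = w y ^2 * gk x τ y * (1 - (y - x) ^2 / (Y ^2 * τ)) := fun y => by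
    simp only [hF]; field_simp; ring
  have neg : ∀ y, Y ^2 * τ ≤ (y - x) ^2 → F y ≤0 := fun y hy => by
    rw [fac]
    refine mul_nonpos_of_nonneg_of_nonpos (mul_nonneg (sq_nonneg _) (gk_pos _ _ _).le) ?_
    have :1 ≤ (y - x) ^2 / (Y ^2 * τ) := by rwa [le_div_iff₀ POS, one_mul]
    linarith
  have sq : (√τ * Y) ^2 = Y ^2 * τ := by rw [mul_pow, mb]; ring
  have iF : ∀ a b, -L ≤ a → a ≤ b → b ≤ L → IntervalIntegrable F volume a b := fun a b ha hab hb =>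
    ContinuousOn.intervalIntegrable (by rw [uIcc_of_le hab]; exact cF.mono (Icc_subset_Icc ha hb))
  have pq : p < q := by simp only [p, q]; linarith
  have ja : ∫ y in (-L)..p, F y ≤0 := by
    have := intervalIntegral.integral_mono_on ho (iF _ _ le_rfl ho LIN) (g := fun _ => (0:Real)) SIM (fun y hy => neg y (by
      rw [← sq]; have : y ≤ x - √τ * Y := hy.2; nlinarith))
    simpa using this
  have jb : ∫ y in q..L, F y ≤0 := by
    have := intervalIntegral.integral_mono_on aa (iF _ _ LIN aa le_rfl) (g := fun _ => (0:Real)) SIM (fun y hy => neg y (by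
      rw [← sq]; have : x + √τ * Y ≤ y := hy.1; nlinarith))
    simpa using this
  have j := intervalIntegral.integral_add_adjacent_intervals (iF _ _ le_rfl ho LIN) (iF _ _ ho pq.le aa)
  have j' := intervalIntegral.integral_add_adjacent_intervals (iF (-L) q le_rfl LIN aa) (iF q L LIN aa le_rfl)
  have sub : Icc p q ⊆ JJ L := Icc_subset_Icc ho aa
  obtain ⟨y, hy, hm⟩ := ivmin (f := fun y => -w y ^2) pq (((c.pow 2).neg).mono sub)
  refine ⟨y, hy, ?_⟩
  rw [intervalIntegral.integral_neg] at hm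
  have jf : ∫ y in p..q, F y ≤ ∫ y in p..q, w y ^2 := by
    refine intervalIntegral.integral_mono_on pq.le (iF _ _ ho pq.le aa) (ContinuousOn.intervalIntegrable (by rw [uIcc_of_le pq.le]; exact (c.pow 2).mono sub)) fun y hy => ?_
    rw [fac, mul_assoc]
    refine mul_le_of_le_one_right (sq_nonneg _) (mul_le_one₀ (gk_le _ _ tc.le) ?_ ?_)
    · rw [sub_nonneg, div_le_one POS, ← sq]
      exact sq_le_sq' (by linarith [hy.1]) (by linarith [hy.2])
    · have :0 ≤ (y - x) ^2 / (Y ^2 * τ) := POS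
      linarith
  have : q - p =2 * (√τ * Y) := by simp only [p, q]; ring
  rw [this] at hm
  linarith
namespace FC
variable {W Wa Wb Wt : RRR} {L r α β M C B κ K : Real}
theorem Hup (h : FC W Wa Wb Wt L r α β M C B κ K) {yc tb t : Real} (hy : yc ∈ JJ L) (am : tb ∈ Icc α β) (hα : α ≤ t)
    (ht : t < tb) (z : W yc tb =0) (za : Wa yc tb =0) :
    fH W L yc tb t ≤ (260 * B ^2 +1) * √(8 * Real.pi) * ((tb - t) ^2 * √(tb - t)) := by
  have La := h.La
  have Ba := h.Ba
  have htt : t ∈ Icc α β := ⟨hα, by linarith [am.2]⟩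
  set τ := tb - t with hτ
  have tc :0 < τ := by rw [hτ]; linarith
  have bc : ∀ y ∈ JJ L, |Wa y tb| ≤ B * |y - yc| := fun y hy' => by
    have := (convex_Icc (-L) L).norm_image_sub_le_of_norm_hasDerivWithin_le (f := fun y => Wa y tb)
      (fun v hv => (h.dc v hv tb am).hasDerivWithinAt) (fun v hv => (h.bd v hv tb am).2.2.1) hy hy'
    simpa [za] using this
  have be : ∀ y ∈ JJ L, |W y tb| ≤ B * (y - yc) ^2 := fun y hy' => by
    have hs : uIcc yc y ⊆ JJ L := uIcc_subset_Icc hy hy'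
    have := (convex_uIcc yc y).norm_image_sub_le_of_norm_hasDerivWithin_le (f := fun y => W y tb) (C := B * |y - yc|)
      (fun v hv => (h.db v (hs hv) tb am).hasDerivWithinAt) (fun v hv => (bc v (hs hv)).trans
        (mul_le_mul_of_nonneg_left (abs_sub_left_of_mem_uIcc hv) Ba)) left_mem_uIcc right_mem_uIcc
    rw [z, sub_zero, Real.norm_eq_abs, Real.norm_eq_abs, mul_assoc, ← sq, sq_abs] at this
    exact this
  have pt : ∀ y ∈ JJ L, W y t ^2 * gk yc τ y ≤ (260 * B ^2 +1) * τ ^2 * Real.exp (-(1 / (8 * τ)) * (y - yc) ^2) := by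
    intro y hy'
    have ai : |W y t| ≤ B * (τ + (y - yc) ^2) := by
      have := h.lipt hy' htt am
      rw [show |t - tb| = τ by rw [abs_sub_comm, abs_of_pos tc]] at this
      have := abs_sub_abs_le_abs_sub (W y t) (W y tb)
      have := be y hy'
      linarith
    have aj : W y t ^2 ≤2 * B ^2 * (τ ^2 + (y - yc) ^4) := by
      have := pow_le_pow_left₀ (abs_nonneg _) ai 2
      rw [sq_abs] at this
      refine this.trans ?_
      nlinarith [mul_nonneg (sq_nonneg B) (sq_nonneg (τ - (y - yc) ^2))]
    set u :=1 / (8 * τ) * (y - yc) ^2 with hu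
    have ua :0 ≤ u := POS
    have g : gk yc τ y = Real.exp (-u) * Real.exp (-u) := by
      unfold gk; rw [← Real.exp_add, hu]; congr 1; field_simp; ring
    have uu : (y - yc) ^4 =64 * τ ^2 * u ^2 := by rw [hu]; field_simp; ring
    have jg : u ^2 * Real.exp (-u) ≤2 := by
      have ho := Real.quadratic_le_exp_of_nonneg ua
      have aa : Real.exp u * Real.exp (-u) =1 := by rw [← Real.exp_add]; simp
      have ae := Real.exp_pos (-u)
      nlinarith
    have ec : Real.exp (-u) ≤1 := by rw [Real.exp_le_one_iff]; linarith
    have ae := Real.exp_pos (-u)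
    rw [neg_mul, ← hu, g, ← mul_assoc]
    refine mul_le_mul_of_nonneg_right ?_ ae.le
    calc W y t ^2 * Real.exp (-u) ≤2 * B ^2 * (τ ^2 + (y - yc) ^4) * Real.exp (-u) := GCO
      _ =2 * B ^2 * τ ^2 * (Real.exp (-u) +64 * (u ^2 * Real.exp (-u))) := by rw [uu]; ring
      _ ≤2 * B ^2 * τ ^2 * (1 +64 *2) := GCO
      _ ≤ _ := by nlinarith [mul_nonneg (sq_nonneg B) (sq_nonneg τ), sq_nonneg τ]
  set D := (260 * B ^2 +1) * τ ^2
  have Da :0 ≤ D := POS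
  have ig : Integrable (fun y : Real => Real.exp (-(1 / (8 * τ)) * (y - yc) ^2)) :=
    (integrable_exp_neg_mul_sq (b :=1 / (8 * τ)) POS).comp_sub_right yc
  have ij : IntervalIntegrable (fun y => W y t ^2 * gk yc τ y) volume (-L) L := by
    apply ContinuousOn.intervalIntegrable
    rw [uIcc_of_le LIN]
    exact ((h.cy htt).pow 2).mul (gk_cont _ _).continuousOn
  have sd := SL.imono La ij (ig.const_mul D).intervalIntegrable pt
  rw [intervalIntegral.integral_const_mul] at sd
  have sc := setIntegral_le_integral (s := Ioc (-L) L) ig (.of_forall fun y => (Real.exp_pos _).le)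
  have sg : ∫ y : Real, Real.exp (-(1 / (8 * τ)) * (y - yc) ^2) = √(8 * Real.pi) * √τ := by
    rw [integral_sub_right_eq_self (fun y : Real => Real.exp (-(1 / (8 * τ)) * y ^2)) yc, integral_gaussian,
      ← Real.sqrt_mul POS]
    congr 1; field_simp
  rw [sg, ← intervalIntegral.integral_of_le LIN] at sc
  unfold fH
  refine sd.trans ((mul_le_mul_of_nonneg_left sc Da).trans (le_of_eq ?_))
  simp only [D]; ring
theorem Na (h : FC W Wa Wb Wt L r α β M C B κ K) {yc tb a t : Real} (hy : |yc| ≤ r /2) (am : tb < β) (ha : α < a)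
    (hat : a ≤ t) (ht : t < tb) (z : W yc tb =0) (za : Wa yc tb =0) (hs : K * (tb - t) ≤1 /800)
    (gs : ∀ t ∈ Ico a tb, GS W L κ yc tb t) :13 /16 ≤ fN W Wa L yc tb t := by
  by_contra! hc
  have Ka := h.Ka
  have th : tb - t ≤1 /800 := by nlinarith
  have rb := h.rb
  have rL := h.rL
  have hyL : yc ∈ JJ L := by have := abs_le.1 hy; constructor <;> linarith
  have nn : ∀ v ∈ Ico t tb, fN W Wa L yc tb v ≤7 /8 := by
    intro v hv
    have := h.Nmono (x := yc) (ts := tb) LIN (by linarith [hv.2]) hv.2 hv.1 LIN hy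
      fun u hu => gs u ⟨by linarith [hu.1], hu.2.trans_lt hv.2⟩
    have e : Real.exp (K * (v - t)) ≤1 +1 /100 := by
      have ho : K * (v - t) ≤1 /800 := by nlinarith [hv.2]
      have af :0 ≤ K * (v - t) := by nlinarith [hv.1]
      have := Real.abs_exp_sub_one_le (x := K * (v - t)) (by rw [abs_of_nonneg af]; linarith)
      rw [abs_of_nonneg af] at this
      linarith [le_abs_self (Real.exp (K * (v - t)) -1)]
    have := fN_nonneg W Wa h.La yc ht
    nlinarith
  have main : ∀ v ∈ Ico t tb, Real.log (fH W L yc tb t) -19 /8 * Real.log (tb - t) -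
      Real.log ((260 * B ^2 +1) * √(8 * Real.pi)) ≤1 /8 * Real.log (tb - v) := by
    intro v hv
    have tc :0 < tb - v := by linarith [hv.2]
    have l := h.lower (x := yc) (ts := tb) (n :=19 /8) LIN (by linarith [hv.2]) hv.2 hv.1 hy
      (fun u hu => gs u ⟨by linarith [hu.1], hu.2.trans_lt hv.2⟩) fun u hu q hq => by
        have nd := nn u ⟨hu.1, hu.2.trans_lt hv.2⟩
        have qd := hq (20 * K) LIN
        have qe : K * ((tb - u) + fN W Wa L yc tb u) / (20 * K) = ((tb - u) + fN W Wa L yc tb u) /20 := by field_simp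
        have qf := (abs_le.1 qd).1
        have qh : K * (tb - u) ≤1 /800 := by nlinarith [hu.1]
        have qj := hu.1
        rw [qe] at qf
        linarith
    have g := gs v ⟨by linarith [hv.1], hv.2⟩
    have u := Real.log_le_log ((Real.exp_pos _).trans g) (h.Hup hyL ⟨LIN, am.le⟩ (by linarith [hv.1]) hv.2 z za)
    rw [Real.log_mul (y := _ * √(tb - v)) POS POS, Real.log_mul (y := √(tb - v)) POS POS, Real.log_sqrt tc.le, Real.log_pow] at u
    push_cast at u
    linarith
  have lim : Tendsto (fun τ =>1 /8 * Real.log τ) (𝓝[>] 0) atBot :=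
    Real.tendsto_log_nhdsGT_zero.const_mul_atBot (by norm_num)
  obtain ⟨τ, ho, aa⟩ := ((lim.eventually_lt_atBot (Real.log (fH W L yc tb t) -19 /8 * Real.log (tb - t) -
      Real.log ((260 * B ^2 +1) * √(8 * Real.pi)))).and (Ioo_mem_nhdsGT (show 0 < tb - t by linarith))).exists
  have := main (tb - τ) ⟨by linarith [aa.2], by linarith [aa.1]⟩
  rw [sub_sub_cancel] at this
  linarith
theorem Hcmp (h : FC W Wa Wb Wt L r α β M C B κ K) {ya yc l t : Real} (hl :0 < l) (hy : (yc - ya) ^2 ≤ l) (ht : t ∈ Icc α β) :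
    fH W L yc (t + l) t ≤ Real.exp (1 /4) * fH W L ya (t +2 * l) t := by
  have La := h.La
  have c := h.cy ht
  have ii : ∀ x τ, IntervalIntegrable (fun y => W y t ^2 * gk x τ y) volume (-L) L := fun x τ => by
    apply ContinuousOn.intervalIntegrable
    rw [uIcc_of_le LIN]
    exact (c.pow 2).mul (gk_cont _ _).continuousOn
  unfold fH
  rw [← intervalIntegral.integral_const_mul]
  refine SL.imono La (ii _ _) ((ii _ _).const_mul _) fun y _ => ?_
  rw [← mul_assoc, mul_comm (Real.exp _), mul_assoc]
  refine mul_le_mul_of_nonneg_left ?_ (sq_nonneg _)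
  unfold gk
  rw [← Real.exp_add, Real.exp_le_exp, add_sub_cancel_left, add_sub_cancel_left]
  have :1 /4 + -(y - ya) ^2 / (4 * (2 * l)) - -(y - yc) ^2 / (4 * l) = (2 * l - (y - ya) ^2 +2 * (y - yc) ^2) / (8 * l) := by
    field_simp; ring
  have :0 ≤ (2 * l - (y - ya) ^2 +2 * (y - yc) ^2) / (8 * l) := by
    apply div_nonneg _ POS
    nlinarith [sq_nonneg (y - yc - (yc - ya))]
  linarith
end FC
set_option autoImplicit false
theorem gloc {g : RtR} {L x τ Y : Real} (cg : ContinuousOn g (JJ L)) (hτ :0 < τ) (hY :0 ≤ Y)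
    (ho : -L ≤ x - √τ * Y) (aa : x + √τ * Y ≤ L) :
    ∫ y in (x - √τ * Y)..(x + √τ * Y), g y ^2 ≤ Real.exp (Y ^2 /4) * ∫ y in (-L)..L, g y ^2 * gk x τ y := by
  have ma :0 ≤ √τ * Y := POS
  have mb : √τ ^2 = τ := Real.sq_sqrt hτ.le
  have cc : ContinuousOn (fun y => g y ^2 * gk x τ y) (JJ L) := (cg.pow 2).mul (gk_cont _ _).continuousOn
  have sub : Icc (x - √τ * Y) (x + √τ * Y) ⊆ JJ L := Icc_subset_Icc ho aa
  have ia := intervalIntegral.integral_mono_interval ho LIN aa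
    (.of_forall fun y => mul_nonneg (sq_nonneg (g y)) (gk_pos x τ y).le)
    (ContinuousOn.intervalIntegrable (by rw [uIcc_of_le LIN]; exact cc) : IntervalIntegrable _ volume _ _)
  refine le_trans ?_ (mul_le_mul_of_nonneg_left ia (Real.exp_pos _).le)
  rw [← intervalIntegral.integral_const_mul]
  have hu : uIcc (x - √τ * Y) (x + √τ * Y) = Icc (x - √τ * Y) (x + √τ * Y) := uIcc_of_le LIN
  refine intervalIntegral.integral_mono_on LIN (ContinuousOn.intervalIntegrable (by rw [hu]; exact (cg.pow 2).mono sub))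
    (ContinuousOn.intervalIntegrable (by rw [hu]; exact continuousOn_const.mul (cc.mono sub))) fun y hy => ?_
  have :1 ≤ Real.exp (Y ^2 /4) * gk x τ y := by
    unfold gk
    rw [← Real.exp_add, Real.one_le_exp_iff]
    have : (y - x) ^2 ≤ Y ^2 * τ := by
      have : (y - x) ^2 ≤ (√τ * Y) ^2 := sq_le_sq' (by linarith [hy.1]) (by linarith [hy.2])
      rwa [mul_pow, mb, mul_comm] at this
    have e : Y ^2 /4 + -(y - x) ^2 / (4 * τ) = (Y ^2 * τ - (y - x) ^2) / (4 * τ) := by field_simp; ring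
    rw [e]; exact div_nonneg LIN POS
  nlinarith [sq_nonneg (g y)]
namespace FC
variable {W Wa Wb Wt : RRR} {L r α β M C B κ K : Real}
theorem scaled (h : FC W Wa Wb Wt L r α β M C B κ K) {Y N Cc D eb x ts t yc tb : Real} (P : OdeP Y N Cc eb) (he : eb ≤1)
    (ht : t ∈ Ioo α β) (am : t < tb) (hts : tb < ts) (Hc :0 < fH W L x ts t) (hN : fN W Wa L x ts t ≤ N)
    (jh :2 ≤ Y) (hY :8 * (1 +4 * N) ≤ Y ^2) (bc : -L ≤ x - √(ts - t) * Y) (be : x + √(ts - t) * Y ≤ L)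
    (av : (yc - x) ^2 ≤ ts - tb) (hσ : tb - t ≤ ts - tb) (hs : tb - t ≤ eb ^2 * (ts - tb)) (eh :0 < eb)
    (hR : (ts - t) ^2 * fR W Wa Wb L x ts t ≤ eb * Real.exp (-(Y ^2 /4)) * fH W L x ts t)
    (ji : Real.exp (Y ^2 /4) * N ≤ Cc) (hD : fH W L yc tb t ≤ D * ((tb - t) / (ts - tb)) ^2 * fH W L x ts t)
    (Da :0 ≤ D) (jj :4 * Real.exp (1 /4) * D ≤ Cc) : False := by
  have hsl := h.sl (x := x) ht (am.trans hts)
  have htI := Ioo_subset_Icc_self ht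
  have cw := h.cy htI
  have fo := h.cj htI
  have fp := h.ck htI
  set τ := ts - t with hτ
  set σ := tb - t with hσd
  set l := ts - tb with hl
  have sa :0 < σ := by rw [hσd]; linarith
  have lb :0 < l := by rw [hl]; linarith
  have τl : τ = l + σ := by rw [hτ, hl, hσd]; ring
  have tc :0 < τ := LIN
  set m := √τ with hm
  have ma :0 < m := Real.sqrt_pos.2 tc
  have mb : m ^2 = τ := Real.sq_sqrt tc.le
  set s := √σ / m with hs'
  have sσ : √σ ^2 = σ := Real.sq_sqrt sa.le
  have sf :0 < s := div_pos (Real.sqrt_pos.2 sa) ma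
  have sc : s ^2 * τ = σ := by rw [hs', div_pow, sσ, mb]; field_simp
  have sle : s ≤ eb := by
    rw [← sq_le_sq₀ sf.le eh.le]
    have : s ^2 * τ ≤ eb ^2 * τ := by rw [sc, τl]; nlinarith [mul_pos (pow_pos eh 2) sa]
    exact le_of_mul_le_mul_right this tc
  set z := (yc - x) / m with hz
  have zm : x + m * z = yc := by rw [hz]; field_simp; ring
  have sm : m * s = √σ := by rw [hs']; field_simp
  have za : |z| ≤1 := by
    rw [← sq_le_one_iff_abs_le_one, hz, div_pow, mb, div_le_one tc]; linarith
  have zg := abs_le.1 za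
  set Hh := fH W L x ts t with hH
  have hE : τ * fH Wa L x ts t = fN W Wa L x ts t * Hh := by unfold fN; rw [← hH]; field_simp; rw [← hτ]; ring
  have nc :0 ≤ fN W Wa L x ts t := fN_nonneg W Wa h.La x (am.trans hts)
  have img : ∀ y ∈ JJ Y, x + m * y ∈ JJ L := fun y hy => by
    have ec := mul_le_mul_of_nonneg_left hy.1 ma.le
    have ed := mul_le_mul_of_nonneg_left hy.2 ma.le
    rw [mul_neg] at ec
    constructor <;> linarith
  have cvar : ContinuousOn (fun y => x + m * y) (JJ Y) := FUN
  have dvar : ∀ y, HasDerivAt (fun y => x + m * y) m y := fun y => (((hasDerivAt_id y).const_mul m).const_add x).congr_deriv SIM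
  have sub : ∀ (f : RtR) (p q : Real), ∫ y in p..q, f (x + m * y) = (∫ y in (x + m * p)..(x + m * q), f y) / m := fun f p q => by
    rw [intervalIntegral.integral_comp_add_mul f ma.ne' x, smul_eq_mul, inv_mul_eq_div]
  have eY : x + m * -Y = x - m * Y := RIN
  refine P (fun y => W (x + m * y) t) (fun y => m * Wa (x + m * y) t) (fun y => τ * Wb (x + m * y) t) (fN W Wa L x ts t) (Hh / m) s z
    nc hN POS sf sle LIN LIN ?_ ?_ ?_ ?_ ?_ ?_ ?_
  · intro y hy
    have := HasDerivAt.comp (h₂ := fun v => W v t) y (h.db _ (img y hy) t htI) (dvar y)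
    exact HasDerivAt.congr_deriv this (mul_comm _ _)
  · intro y hy
    have := (HasDerivAt.comp (h₂ := fun v => Wa v t) y (h.dc _ (img y hy) t htI) (dvar y)).const_mul m
    refine HasDerivAt.congr_deriv this ?_
    beta_reduce; rw [← mb]; ring
  · exact continuousOn_const.mul (fp.comp cvar img)
  · obtain ⟨y, hy, hy'⟩ := hsl.mass (Y := Y) (N := N) LIN hY (by
      change τ * fH Wa L x ts t ≤ N * Hh
      rw [hE]; gcongr) bc be
    refine ⟨(y - x) / m, ⟨?_, ?_⟩, ?_⟩
    · rw [le_div_iff₀ ma]; linarith [hy.1]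
    · rw [div_le_iff₀ ma]; linarith [hy.2]
    · rw [show x + m * ((y - x) / m) = y by field_simp; ring, div_div, div_le_iff₀ POS]
      change Hh ≤ _ at hy'
      linarith
  · have e : ∀ y, (τ * Wb (x + m * y) t - y /2 * (m * Wa (x + m * y) t) + fN W Wa L x ts t * W (x + m * y) t) ^2 =
      (fun y => τ ^2 * (Wb y t - (y - x) / (2 * τ) * Wa y t + fH Wa L x ts t / Hh * W y t) ^2) (x + m * y) := fun y => by
        have : fN W Wa L x ts t = τ * (fH Wa L x ts t / Hh) := by unfold fN; rw [← hH]; ring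
        rw [this]
        simp only
        have : x + m * y - x = m * y := RIN
        rw [this, ← mb]; field_simp
    simp_rw [e]
    rw [sub (fun y => τ ^2 * (Wb y t - (y - x) / (2 * τ) * Wa y t + fH Wa L x ts t / Hh * W y t) ^2), intervalIntegral.integral_const_mul, eY]
    have := gloc (g := fun y => Wb y t - (y - x) / (2 * τ) * Wa y t + fH Wa L x ts t / Hh * W y t) (Y := Y) FUN tc LIN bc be
    change _ ≤ _ * fR W Wa Wb L x ts t at this
    rw [mul_div_assoc', div_le_div_iff_of_pos_right ma]
    have em : Real.exp (Y ^2 /4) * Real.exp (-(Y ^2 /4)) =1 := by rw [← Real.exp_add]; simp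
    calc _ ≤ τ ^2 * (Real.exp (Y ^2 /4) * fR W Wa Wb L x ts t) := GCO
      _ = Real.exp (Y ^2 /4) * (τ ^2 * fR W Wa Wb L x ts t) := RIN
      _ ≤ Real.exp (Y ^2 /4) * (eb * Real.exp (-(Y ^2 /4)) * Hh) := GCO
      _ = (Real.exp (Y ^2 /4) * Real.exp (-(Y ^2 /4))) * (eb * Hh) := RIN
      _ = _ := by rw [em, one_mul]
  · have e : ∀ y, (m * Wa (x + m * y) t) ^2 = (fun y => τ * Wa y t ^2) (x + m * y) := fun y => by
      rw [mul_pow, mb]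
    simp_rw [e]
    rw [sub (fun y => τ * Wa y t ^2), intervalIntegral.integral_const_mul, eY, mul_div_assoc', div_le_div_iff_of_pos_right ma]
    have := gloc (g := fun y => Wa y t) (Y := Y) fo tc LIN bc be
    change _ ≤ _ * fH Wa L x ts t at this
    calc _ ≤ τ * (Real.exp (Y ^2 /4) * fH Wa L x ts t) := GCO
      _ = Real.exp (Y ^2 /4) * (τ * fH Wa L x ts t) := RIN
      _ = Real.exp (Y ^2 /4) * fN W Wa L x ts t * Hh := by rw [hE]; ring
      _ ≤ Real.exp (Y ^2 /4) * N * Hh := GCO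
      _ ≤ _ := GCO
  · rw [sub (fun y => W y t ^2), show x + m * (z - s) = yc - √σ *1 by rw [mul_sub, sm, ← zm]; ring,
      show x + m * (z + s) = yc + √σ *1 by rw [mul_add, sm, ← zm]; ring, mul_div_assoc', div_le_div_iff_of_pos_right ma]
    have ia := img (z - s) ⟨LIN, LIN⟩
    have ic := img (z + s) ⟨LIN, LIN⟩
    have := gloc (g := fun y => W y t) (Y :=1) (x := yc) cw sa LIN
      (by have := ia.1; rw [mul_sub, sm] at this; linarith) (by have := ic.2; rw [mul_add, sm] at this; linarith)
    change _ ≤ _ * fH W L yc tb t at this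
    have q : (σ / l) ^2 ≤4 * s ^4 := by
      have : σ / l ≤2 * s ^2 := by
        rw [div_le_iff₀ lb]
        have := pow_pos sf 2
        nlinarith
      calc _ ≤ (2 * s ^2) ^2 := GCO
        _ = _ := RIN
    refine this.trans ?_
    rw [one_pow]
    calc _ ≤ Real.exp (1 /4) * (D * (σ / l) ^2 * Hh) := GCO
      _ ≤ Real.exp (1 /4) * (D * (4 * s ^4) * Hh) := GCO
      _ =4 * Real.exp (1 /4) * D * s ^4 * Hh := RIN
      _ ≤ _ := GCO
end FC
set_option autoImplicit false
theorem drop {f : RtR} {a b m η : Real} (hab : a < b) (hf : ∀ s t, a ≤ s → s ≤ t → t < b → f t ≤ f s)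
    (hm : ∀ t ∈ Ico a b, m ≤ f t) (hη :0 < η) :
    ∃ a' ∈ Ico a b, ∀ s t, a' ≤ s → s ≤ t → t < b → f s - f t < η := by
  have ne : (f '' Ico a b).Nonempty := ⟨_, a, ⟨le_rfl, hab⟩, rfl⟩
  have bd : BddBelow (f '' Ico a b) := ⟨m, by rintro _ ⟨t, ht, rfl⟩; exact hm t ht⟩
  obtain ⟨_, ⟨a', ha', rfl⟩, ho⟩ := exists_lt_of_csInf_lt ne (lt_add_of_pos_right (sInf (f '' Ico a b)) hη)
  refine ⟨a', ha', fun s t hs hst ht => ?_⟩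
  have := hf a' s ha'.1 hs (hst.trans_lt ht)
  have := csInf_le bd ⟨t, ⟨ha'.1.trans (hs.trans hst), ht⟩, rfl⟩
  linarith
namespace FC
variable {W Wa Wb Wt : RRR} {L r α β M C B κ K : Real}
theorem UF.dropN (h : FC W Wa Wb Wt L r α β M C B κ K) {ya ta a Λ δ : Real} (u : UF W Wa L r α β κ K ya ta a Λ δ)
    {ε σ : Real} (hε :0 < ε) (hσ :0 < σ) (dz : σ ≤1 /2) : ∃ a' ∈ Ico a ta, ∀ l >0, a' ≤ ta -2 * l →
      ∃ t ∈ Icc (ta - l -2 * σ * l) (ta - l - σ * l),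
        (ta - t) ^2 * fR W Wa Wb L ya ta t ≤ ε * fH W L ya ta t := by
  have Ka := h.Ka
  have da := u.da
  have aδ := u.aδ
  have hb := u.hb
  have ho := u.ho
  have Lb := u.Lb
  have hy : |ya - ya| < δ := by simpa
  have al : |ta - ta| < δ := by simpa
  have gs := u.gs ya ta hy al
  have nb := u.nb ya ta hy al
  set K' := K * (1 + (2 * Λ +1)) with hK'
  have K'0 :0 < K' := POS
  set f := fun t => fN W Wa L ya ta t - K' * t with hf
  have df : ∀ t ∈ Ico a ta, ∃ d, HasDerivAt f d t ∧ d ≤ -((ta - t) / fH W L ya ta t * fR W Wa Wb L ya ta t) := fun t ht => by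
    obtain ⟨d, hd, hle⟩ := h.dN ⟨u.αa.trans_le ht.1, by linarith [ht.2]⟩ ht.2 (u.hx ya hy) h.kr (gs t ht) h.hK
    refine ⟨_, hd.sub ((hasDerivAt_id t).const_mul K'), ?_⟩
    have : K * ((ta - t) + fN W Wa L ya ta t) ≤ K' := by
      rw [hK']; refine mul_le_mul_of_nonneg_left (add_le_add (by linarith [ht.1]) (nb t ht)) LIN
    linarith
  have Ra : ∀ t,0 ≤ fR W Wa Wb L ya ta t := fun t =>
    intervalIntegral.integral_nonneg (by linarith [h.La]) fun y _ => mul_nonneg (sq_nonneg _) (gk_pos _ _ _).le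
  have Hc : ∀ t ∈ Ico a ta,0 < fH W L ya ta t := fun t ht => (Real.exp_pos _).trans (gs t ht)
  obtain ⟨a', ha', hd⟩ := drop (f := f) (a := a) (b := ta) (m := -(K' * ta)) (η := ε * σ /2) LIN (fun s t hs hst ht => by
      refine neg_le_neg_iff.1 (mono_hd (f := fun t => -f t) hst fun v hv => ?_)
      have hv' : v ∈ Ico a ta := ⟨hs.trans hv.1, hv.2.trans_lt ht⟩
      obtain ⟨d, hd, hle⟩ := df v hv'
      refine ⟨_, hd.neg, ?_⟩
      have :0 ≤ (ta - v) / fH W L ya ta v * fR W Wa Wb L ya ta v :=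
        mul_nonneg (div_nonneg (by linarith [hv'.2]) (Hc v hv').le) (Ra v)
      linarith) (fun t ht => by
      have := fN_nonneg W Wa h.La ya ht.2
      have := mul_le_mul_of_nonneg_left ht.2.le K'0.le
      simp only [hf]; linarith) POS
  refine ⟨a', ha', fun l hl dj => ?_⟩
  by_contra! hcon
  have ec : σ * l ≤ l /2 := by nlinarith
  have eb :0 < σ * l := POS
  have hI : ∀ v ∈ Icc (ta - l -2 * σ * l) (ta - l - σ * l), v ∈ Ico a' ta := fun v hv =>
    ⟨by nlinarith [hv.1], by linarith [hv.2]⟩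
  have aa := mono_hd (f := fun t => -f t - ε / (2 * l) * t) (a := ta - l -2 * σ * l) (b := ta - l - σ * l) LIN fun v hv => by
    have hv' : v ∈ Ico a ta := ⟨ha'.1.trans (hI v hv).1, (hI v hv).2⟩
    obtain ⟨d, hd, hle⟩ := df v hv'
    refine ⟨_, hd.neg.sub ((hasDerivAt_id v).const_mul (ε / (2 * l))), ?_⟩
    have tc :0 < ta - v := by linarith [hv'.2]
    have τl : ta - v ≤2 * l := by nlinarith [hv.1]
    have : ε / (2 * l) ≤ (ta - v) / fH W L ya ta v * fR W Wa Wb L ya ta v := by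
      have := hcon v hv
      have af := Hc v hv'
      calc ε / (2 * l) ≤ ε / (ta - v) := GCO
        _ ≤ _ := by rw [div_mul_eq_mul_div, div_le_div_iff₀ tc af]; nlinarith
    simp only [id, mul_one]; linarith
  have ae := hd (ta - l -2 * σ * l) (ta - l - σ * l) (hI _ ⟨le_rfl, LIN⟩).1 LIN LIN
  have ag : ε / (2 * l) * (ta - l - σ * l) - ε / (2 * l) * (ta - l -2 * σ * l) = ε * σ /2 := by field_simp; ring
  linarith
theorem claim (h : FC W Wa Wb Wt L r α β M C B κ K) {ya ta a Λ δ : Real} (u : UF W Wa L r α β κ K ya ta a Λ δ) :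
    ∃ δ' >0, ∀ yc tb, ta - δ' < tb → tb < ta → W yc tb =0 → Wa yc tb =0 → ta - tb < (yc - ya) ^2 := by
  have Ka := h.Ka
  have da := u.da
  have aδ := u.aδ
  have hb := u.hb
  have ho := u.ho
  have Lb := u.Lb
  have La := h.La
  have hy : |ya - ya| < δ := by simpa
  have al : |ta - ta| < δ := by simpa
  have az := abs_le.1 (u.hx ya hy)
  set N :=2 * Λ +1 with hN
  set n :=6 * Λ +5 with hn
  set Y := √(8 * (1 +4 * N)) with hY
  have Ya : Y ^2 =8 * (1 +4 * N) := Real.sq_sqrt LIN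
  have Yge :2 ≤ Y := Real.le_sqrt_of_sq_le LIN
  set D := Real.exp (1 /4) * Real.exp (n * Real.log 2) with hD
  set Cc := Real.exp (Y ^2 /4) * N +4 * Real.exp (1 /4) * D with hCc
  have Da :0 ≤ D := POS
  have ce :0 ≤ Real.exp (Y ^2 /4) * N := POS
  have ch :0 ≤4 * Real.exp (1 /4) * D := POS
  obtain ⟨eb, eh, ek, P⟩ := ode_lem Y N Cc LIN LIN LIN
  obtain ⟨a', ha', hdr⟩ := u.dropN h (ε := eb * Real.exp (-(Y ^2 /4))) (σ := eb ^2 /2) POS POS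
    (by have := pow_le_one₀ (n :=2) eh.le ek; linarith)
  have jk := ha'.2
  refine ⟨min (min δ (δ ^2)) (min (min ((ta - a') /2) (1 / (800 * K))) (L ^2 / (8 * Y ^2))), by
    refine lt_min (lt_min da POS) (lt_min (lt_min LIN POS) POS), ?_⟩
  intro yc tb jl am zd za
  by_contra! hcon
  set l := ta - tb with hl
  have lb :0 < l := by rw [hl]; linarith
  have dj : l < min (min δ (δ ^2)) (min (min ((ta - a') /2) (1 / (800 * K))) (L ^2 / (8 * Y ^2))) := LIN
  simp only [lt_min_iff] at dj
  obtain ⟨⟨lc, lf⟩, ⟨lg, li⟩, lh⟩ := dj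
  obtain ⟨t, ht, hR⟩ := hdr l lb LIN
  rw [lt_div_iff₀ POS] at li lh
  have av : |yc - ya| < δ := abs_lt_of_sq_lt_sq LIN da.le
  have fq : |tb - ta| < δ := abs_lt.2 ⟨LIN, LIN⟩
  have el :0 < eb ^2 * l := POS
  have jm : eb ^2 * l ≤ l := mul_le_of_le_one_left lb.le (pow_le_one₀ eh.le ek)
  have tf : tb = ta - l := by rw [hl]; ring
  have htu : t ≤ tb - eb ^2 * l /2 := by have := ht.2; linarith only [this, tf]
  have htl : tb - eb ^2 * l ≤ t := by have := ht.1; linarith only [this, tf]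
  have td : t < tb := LIN
  have at' : a ≤ ta -2 * l := ha'.1.trans LIN
  have ltt : ta -2 * l ≤ t := LIN
  have gy := u.gs ya ta hy al
  have gm := u.gs yc tb av fq
  have tI : t ∈ Ico a ta := ⟨LIN, LIN⟩
  have pc : ∀ v ∈ Ico a ta,0 < fH W L ya ta v := fun v hv => (Real.exp_pos _).trans (gy v hv)
  have pa : ∀ v ∈ Ico a tb,0 < fH W L yc tb v := fun v hv => (Real.exp_pos _).trans (gm v hv)
  have Na : ∀ v ∈ Icc (ta -2 * l) t,13 /16 ≤ fN W Wa L yc tb v := fun v hv =>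
    h.Na (u.hx yc av) LIN u.αa (at'.trans hv.1) (by linarith [hv.2]) zd za
      (by have : tb - v ≤ l := by linarith [hv.1]
          have := mul_le_mul_of_nonneg_left this (by linarith : (0:Real) ≤ K)
          linarith) gm
  have sc := h.upper (x := yc) (ts := tb) (a := ta -2 * l) (b := t) (n :=2) (by linarith [u.αa]) LIN td ltt
    (u.hx yc av) (fun v hv => gm v ⟨at'.trans hv.1, by linarith [hv.2]⟩) fun v hv q hq => by
      have jn := Na v hv
      have := hq (20 * K) LIN
      have e : K * (tb - v + fN W Wa L yc tb v) / (20 * K) = (tb - v + fN W Wa L yc tb v) /20 := by field_simp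
      rw [e] at this
      have τl : tb - v ≤ l := by linarith [hv.1]
      have := mul_le_mul_of_nonneg_left τl (by linarith : (0:Real) ≤ K)
      have := mul_le_mul_of_nonneg_right Ka (by linarith [hv.2] : (0:Real) ≤ tb - v)
      linarith [le_abs_self q]
  have sg := h.Hcmp (yc := yc) (ya := ya) (l := l) (t := ta -2 * l) lb hcon ⟨by linarith [u.αa], LIN⟩
  rw [show ta -2 * l + l = tb by rw [hl]; ring, show ta -2 * l +2 * l = ta by ring] at sg
  have sk := u.low h hy al at' ltt tI.2
  have ql := pc (ta -2 * l) ⟨at', LIN⟩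
  have qd := pa (ta -2 * l) ⟨at', LIN⟩
  have qm := pc t tI
  have qn := pa t ⟨tI.1, td⟩
  have sn := Real.log_le_log qd sg
  rw [Real.log_mul (Real.exp_pos _).ne' ql.ne', Real.log_exp] at sn
  rw [show ta - (ta -2 * l) =2 * l by ring, Real.log_mul two_ne_zero lb.ne'] at sk
  rw [show tb - (ta -2 * l) = l by rw [hl]; ring] at sc
  have sr : n * Real.log l ≤ n * Real.log (ta - t) := mul_le_mul_of_nonneg_left (Real.log_le_log lb LIN) LIN
  have hDf : fH W L yc tb t ≤ D * ((tb - t) / (ta - tb)) ^2 * fH W L ya ta t := by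
    rw [← hl]
    have sa :0 < tb - t := LIN
    rw [← Real.log_le_log_iff qn POS, Real.log_mul POS qm.ne', Real.log_mul POS POS,
      Real.log_pow, Real.log_div sa.ne' lb.ne', hD, Real.log_mul POS POS, Real.log_exp, Real.log_exp]
    push_cast
    linarith
  have sq : √(ta - t) * Y ≤ L /2 := by
    have aa : (√(ta - t) * Y) ^2 ≤ (L /2) ^2 := by
      rw [mul_pow, Real.sq_sqrt LIN]
      have : (ta - t) * Y ^2 ≤2 * l * Y ^2 := mul_le_mul_of_nonneg_right LIN (sq_nonneg _)
      linarith
    exact le_of_sq_le_sq aa LIN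
  have rL := h.rL
  exact h.scaled P ek ⟨by linarith [u.αa], LIN⟩ td am qm (u.nb ya ta hy al t tI) Yge Ya.ge LIN LIN
    hcon LIN LIN eh hR LIN hDf Da LIN
end FC
set_option autoImplicit false
theorem sard1 {A : Set Real} {y : RtR} {R : Real} (hR :0 < R) (hy : ∀ t ∈ A, |y t| ≤ R)
    (h : ∀ s ∈ A, ∀ t ∈ A, s < t → t - s < (y s - y t) ^2) : volume A =0 := by
  have key : ∀ m : ℕ, volume A ≤ ENNReal.ofReal ((2 * R) ^2 * (((m : Real) +2) / ((m : Real) +1) ^2)) := fun m => by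
    set w :=2 * R / ((m : Real) +1) with hw
    have wc :0 < w := POS
    have cov : A ⊆ ⋃ i ∈ Finset.range (m +2), {t ∈ A | ⌊(y t + R) / w⌋₊ = i} := fun t ht => by
      simp only [mem_iUnion, Finset.mem_range]
      refine ⟨_, ?_, ht, rfl⟩
      have := abs_le.1 (hy t ht)
      rw [Nat.floor_lt (div_nonneg LIN wc.le), div_lt_iff₀ wc, hw]
      push_cast
      have : ((m : Real) +2) * (2 * R / ((m : Real) +1)) =2 * R +2 * R / ((m : Real) +1) := by field_simp; ring
      rw [this]; linarith
    have each : ∀ i, volume {t ∈ A | ⌊(y t + R) / w⌋₊ = i} ≤ ENNReal.ofReal (w ^2) := fun i => by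
      refine (Real.volume_le_diam _).trans (Metric.ediam_le fun s hs t ht => ?_)
      rw [edist_dist]
      refine ENNReal.ofReal_le_ofReal ?_
      have fl : ∀ v ∈ {t ∈ A | ⌊(y t + R) / w⌋₊ = i}, i * w ≤ y v + R ∧ y v + R < (i +1) * w := fun v hv => by
        have := abs_le.1 (hy v hv.1)
        obtain ⟨ho, aa⟩ := (Nat.floor_eq_iff (div_nonneg LIN wc.le)).1 hv.2
        rw [le_div_iff₀ wc] at ho; rw [div_lt_iff₀ wc] at aa; exact ⟨ho, aa⟩
      have sq : (y s - y t) ^2 ≤ w ^2 := by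
        have := fl s hs; have := fl t ht
        apply sq_le_sq' <;> linarith
      rw [Real.dist_eq, abs_le]
      rcases lt_trichotomy s t with ho | ho | ho
      · have := h s hs.1 t ht.1 ho; constructor <;> linarith
      · subst ho; simp [sq_nonneg]
      · have := h t ht.1 s hs.1 ho
        constructor <;> nlinarith
    calc volume A ≤ _ := measure_mono cov
      _ ≤ ∑ i ∈ Finset.range (m +2), ENNReal.ofReal (w ^2) := (measure_biUnion_finset_le _ _).trans (Finset.sum_le_sum fun i _ => each i)
      _ = _ := by
        rw [Finset.sum_const, Finset.card_range, nsmul_eq_mul, ← ENNReal.ofReal_natCast, ← ENNReal.ofReal_mul POS]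
        congr 1; rw [hw]; push_cast; field_simp
  have lim : Tendsto (fun m : ℕ => ENNReal.ofReal ((2 * R) ^2 * (((m : Real) +2) / ((m : Real) +1) ^2))) atTop (𝓝 0) := by
    rw [← ENNReal.ofReal_zero]
    refine ENNReal.tendsto_ofReal ?_
    have ho := tendsto_one_div_add_atTop_nhds_zero_nat (𝕜 := Real)
    have := ((ho.add (ho.mul ho)).const_mul ((2 * R) ^2))
    simp only [mul_zero, add_zero] at this
    refine this.congr fun m => ?_
    field_simp; ring
  exact le_antisymm (ge_of_tendsto' lim key) zero_le
theorem sard {A : Set Real} {y : RtR} {R : Real} (hR :0 < R) (hy : ∀ t ∈ A, |y t| ≤ R)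
    (h : ∀ t ∈ A, ∃ δ >0, ∀ s ∈ A, t - δ < s → s < t → t - s < (y s - y t) ^2) : volume A =0 := by
  have cov : A ⊆ ⋃ k : ℕ, ⋃ j : ℤ, {t ∈ A | (∀ s ∈ A, t -1 / ((k : Real) +1) < s → s < t → t - s < (y s - y t) ^2) ∧
      ⌊t * ((k : Real) +1)⌋ = j} := fun t ht => by
    obtain ⟨δ, da, hδ⟩ := h t ht
    obtain ⟨k, hk⟩ := exists_nat_one_div_lt da
    simp only [mem_iUnion]
    exact ⟨k, _, ht, fun s hs ho aa => hδ s hs LIN aa, rfl⟩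
  refine measure_mono_null cov (measure_iUnion_null fun k => measure_iUnion_null fun j => ?_)
  refine sard1 (y := y) hR (fun t ht => hy t ht.1) fun s hs t ht hst => ht.2.1 s hs.1 ?_ hst
  have ka : (0 : Real) < (k : Real) +1 := POS
  have ho := Int.floor_le (s * ((k : Real) +1))
  have aa := Int.lt_floor_add_one (t * ((k : Real) +1))
  rw [hs.2.2] at ho; rw [ht.2.2] at aa
  have : t - s <1 / ((k : Real) +1) := by rw [lt_div_iff₀ ka]; linarith
  linarith
theorem bump (R : Real) (hR :0 < R) : ∃ (φ qg qi : RtR) (P : Real),0 ≤ P ∧ Continuous φ ∧ Continuous qg ∧ Continuous qi ∧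
    (∀ y, HasDerivAt φ (qg y) y) ∧ (∀ y, HasDerivAt qg (qi y) y) ∧
    (∀ y ∈ JJ R, |φ y| ≤ P ∧ |qg y| ≤ P ∧ |qi y| ≤ P) ∧ (∀ y, |y| < R /2 → φ y =1 ∧ qg y =0 ∧ qi y =0) ∧
    (∀ y, R ≤ |y| → φ y =0 ∧ qg y =0) := by
  let f : ContDiffBump (0 : Real) := ⟨R /2,3 * R /4, LIN, LIN⟩
  have cf : ContDiff Real 2 f := f.contDiff
  have ho : ContDiff Real 1 (deriv f) := (contDiff_succ_iff_deriv.1 (cf : ContDiff Real (1 +1) f)).2.2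
  have ch : Continuous (deriv (deriv f)) := ho.continuous_deriv le_rfl
  have db : ∀ y, HasDerivAt f (deriv f y) y := fun y => (cf.differentiable (by norm_num) y).hasDerivAt
  have dc : ∀ y, HasDerivAt (deriv f) (deriv (deriv f) y) y := fun y => (ho.differentiable (by norm_num) y).hasDerivAt
  obtain ⟨Pa, af⟩ := isCompact_Icc.exists_bound_of_continuousOn (s := JJ R) cf.continuous.continuousOn
  obtain ⟨Pb, fr⟩ := isCompact_Icc.exists_bound_of_continuousOn (s := JJ R) ho.continuous.continuousOn
  obtain ⟨Pc, bp⟩ := isCompact_Icc.exists_bound_of_continuousOn (s := JJ R) ch.continuousOn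
  refine ⟨f, deriv f, deriv (deriv f), max (max Pa Pb) (max Pc 0), SIM, cf.continuous, ho.continuous, ch, db, dc,
    fun y hy => ⟨(af y hy).trans SIM, (fr y hy).trans SIM, (bp y hy).trans SIM⟩, fun y hy => ?_, fun y hy => ?_⟩
  · have e : (f : RtR) =ᶠ[𝓝 y] fun _ =>1 := f.eventuallyEq_one_of_mem_ball (by simpa [f] using hy)
    have ec : deriv f =ᶠ[𝓝 y] fun _ =>0 := by simpa using e.deriv
    refine ⟨e.self_of_nhds, ec.self_of_nhds, ?_⟩
    rw [ec.deriv_eq]; simp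
  · have e : (f : RtR) =ᶠ[𝓝 y] fun _ =>0 := by
      filter_upwards [(isOpen_lt continuous_const continuous_abs).mem_nhds (show 3 * R /4 < |y| by linarith)] with z hz
      exact f.zero_of_le_dist (by simpa [f] using hz.le)
    exact ⟨e.self_of_nhds, by rw [e.deriv_eq]; simp⟩
structure BX (V Va Vb Vt : RRR) (R α β M B : Real) : Prop where
  Ra :0 < R
  Ma :0 ≤ M
  Ba :0 ≤ B
  db : ∀ y ∈ JJ R, ∀ t ∈ Icc α β, HasDerivAt (fun y => V y t) (Va y t) y
  dc : ∀ y ∈ JJ R, ∀ t ∈ Icc α β, HasDerivAt (fun y => Va y t) (Vb y t) y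
  dt : ∀ y ∈ JJ R, ∀ t ∈ Icc α β, HasDerivAt (fun t => V y t) (Vt y t) t
  ci : ContinuousOn (UC V) (JJ R ×ˢ Icc α β)
  ce : ContinuousOn (UC Va) (JJ R ×ˢ Icc α β)
  ch : ContinuousOn (UC Vb) (JJ R ×ˢ Icc α β)
  bd : ∀ y ∈ JJ R, ∀ t ∈ Icc α β, |V y t| ≤ B ∧ |Va y t| ≤ B ∧ |Vb y t| ≤ B ∧ |Vt y t| ≤ B
  iq : ∀ y ∈ JJ R, ∀ t ∈ Icc α β, |Vt y t - Vb y t| ≤ M * (|V y t| + |Va y t|)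
namespace BX
variable {V Va Vb Vt : RRR} {R α β M B : Real}
theorem fc (h : BX V Va Vb Vt R α β M B) : ∃ W Wa Wb Wt C B' κ K, FC W Wa Wb Wt R (R /2) α β M C B' κ K ∧
    ∀ y t, |y| < R /2 → W y t = V y t ∧ Wa y t = Va y t := by
  obtain ⟨φ, qg, qi, P, Pa, ci, ce, ch, db, dc, bd, one, zer⟩ := bump R h.Ra
  have Ra := h.Ra
  have Ma := h.Ma
  have Ba := h.Ba
  have aR : |R| = R := abs_of_pos Ra
  have za := zer R (by rw [aR])
  have zb := zer (-R) (by rw [abs_neg, aR])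
  have md : ∀ {x y X Y : Real}, |x| ≤ X → |y| ≤ Y → |x * y| ≤ X * Y := fun hx hy => by
    rw [abs_mul]; exact mul_le_mul hx hy (abs_nonneg _) ((abs_nonneg _).trans hx)
  refine ⟨fun y t => φ y * V y t, fun y t => qg y * V y t + φ y * Va y t, fun y t => qi y * V y t +2 * (qg y * Va y t) + φ y * Vb y t,
    fun y t => φ y * Vt y t,6 * (P * B),4 * (P * B), (R /2) ^2 /16, max 1 (3 * M ^2 +6 * (6 * (P * B)) ^2 * R),
    { rb := by linarith, rL := by linarith, Ma := Ma, Cb := by positivity, Ba := by positivity, ka := by positivity, kr := le_rfl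
      Ka := le_max_left _ _, hK := le_max_right _ _, db := ?_, dc := ?_, dt := ?_, ce := ?_, ch := ?_, bd := ?_, z := ?_, iq := ?_ }, ?_⟩
  · intro y hy t ht; exact (db y).mul (h.db y hy t ht)
  · intro y hy t ht
    exact (((dc y).mul (h.db y hy t ht)).add ((db y).mul (h.dc y hy t ht))).congr_deriv RIN
  · intro y hy t ht; exact (h.dt y hy t ht).const_mul _
  · exact ((ce.comp continuous_fst).continuousOn.mul h.ci).add ((ci.comp continuous_fst).continuousOn.mul h.ce)
  · exact (((ch.comp continuous_fst).continuousOn.mul h.ci).add (((ce.comp continuous_fst).continuousOn.mul h.ce).const_smul (2:Real))).add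
      ((ci.comp continuous_fst).continuousOn.mul h.ch)
  · intro y hy t ht
    obtain ⟨pc, pa, pb⟩ := bd y hy
    obtain ⟨bk, bc, be, bt⟩ := h.bd y hy t ht
    have PB :0 ≤ P * B := POS
    have ql := md pc bk; have qd := md pa bk; have qe := md pc bc; have qf := md pb bk
    have qh := md pa bc; have qj := md pc be; have qk := md pc bt
    rw [abs_le] at ql qd qe qf qh qj qk
    refine ⟨?_, ?_, ?_, ?_⟩ <;> rw [abs_le] <;> constructor <;> linarith
  · intro t ht; simp [za, zb]
  · intro y hy t ht
    by_cases hr : R /2 ≤ |y|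
    · rw [if_pos hr]
      obtain ⟨pc, pa, pb⟩ := bd y hy
      obtain ⟨bk, bc, be, bt⟩ := h.bd y hy t ht
      have PB :0 ≤ P * B := POS
      have qf := md pb bk
      have qh := md pa bc; have qj := md pc be; have qk := md pc bt
      have : |φ y * Vt y t - (qi y * V y t +2 * (qg y * Va y t) + φ y * Vb y t)| ≤6 * (P * B) := by
        rw [abs_le] at qf qh qj qk ⊢
        constructor <;> linarith
      have :0 ≤ M * (|φ y * V y t| + |qg y * V y t + φ y * Va y t|) := POS
      linarith
    · obtain ⟨eb, ec, ed⟩ := one y (not_le.1 hr)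
      rw [if_neg hr]
      simpa [eb, ec, ed] using h.iq y hy t ht
  · intro y t hy
    obtain ⟨eb, ec, ed⟩ := one y hy
    simp [eb, ec]
theorem ucv (h : BX V Va Vb Vt R α β M B) {ya ta : Real} (hy : |ya| < R /4) (ht : ta ∈ Ioo α β)
    (hne : ¬ ∃ ρ >0, ∀ y, |y - ya| < ρ → V y ta =0) :
    ∃ δ >0, ∀ p q, p < q → ya - δ < p → q < ya + δ → ∃ y ∈ Ioo p q, V y ta ≠0 := by
  obtain ⟨W, Wa, Wb, Wt, C, B', κ, K, hf, he⟩ := h.fc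
  have near : ∀ y, |y - ya| < R /4 → |y| < R /2 := fun y hy' => by
    have := abs_add_le (y - ya) ya
    rw [sub_add_cancel] at this; linarith
  have Ra := h.Ra
  obtain ⟨a, Λ, δ, u⟩ := hf.unif (ya := ya) (ta := ta) LIN ht (by
    rintro ⟨ρ, ra, hz⟩
    refine hne ⟨min ρ (R /4), POS, fun y hy => ?_⟩
    rw [lt_min_iff] at hy
    rw [← (he y ta (near y hy.2)).1]; exact hz y hy.1)
  refine ⟨min δ (R /4), lt_min u.da POS, fun p q hpq hp hq => ?_⟩
  have mc := min_le_left δ (R /4)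
  have mb := min_le_right δ (R /4)
  obtain ⟨y, hy, hz⟩ := u.ucl hf hpq LIN LIN
  refine ⟨y, hy, ?_⟩
  rwa [← (he y ta (near y (abs_lt.2 ⟨by linarith [hy.1], by linarith [hy.2]⟩))).1]
theorem genv (h : BX V Va Vb Vt R α β M B)
    (hne : ∀ ya ta, |ya| < R /4 → ta ∈ Ioo α β → ¬ ∃ ρ >0, ∀ y, |y - ya| < ρ → V y ta =0) :
    volume {t | t ∈ Ioo α β ∧ ∃ y, |y| < R /4 ∧ V y t =0 ∧ Va y t =0} =0 := by
  obtain ⟨W, Wa, Wb, Wt, C, B', κ, K, hf, he⟩ := h.fc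
  have Ra := h.Ra
  have : ∀ t, ∃ y, t ∈ {t | t ∈ Ioo α β ∧ ∃ y, |y| < R /4 ∧ V y t =0 ∧ Va y t =0} → |y| < R /4 ∧ V y t =0 ∧ Va y t =0 :=
    fun t => by
      by_cases ht : t ∈ {t | t ∈ Ioo α β ∧ ∃ y, |y| < R /4 ∧ V y t =0 ∧ Va y t =0}
      · obtain ⟨y, hy⟩ := ht.2; exact ⟨y, fun _ => hy⟩
      · exact ⟨0, fun h => absurd h ht⟩
  choose y hy using this
  refine sard (y := y) h.Ra (fun t ht => by have := (hy t ht).1; linarith) fun t ht => ?_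
  obtain ⟨ho, aa, ae⟩ := hy t ht
  have near : ∀ z, |z - y t| < R /4 → |z| < R /2 := fun z hz => by
    have := abs_add_le (z - y t) (y t)
    rw [sub_add_cancel] at this; linarith
  obtain ⟨a, Λ, δ, u⟩ := hf.unif (ya := y t) (ta := t) LIN ht.1 (by
    rintro ⟨ρ, ra, hz⟩
    refine hne _ _ ho ht.1 ⟨min ρ (R /4), POS, fun z hz' => ?_⟩
    rw [lt_min_iff] at hz'
    rw [← (he z t (near z hz'.2)).1]; exact hz z hz'.1)
  obtain ⟨δ', da, hc⟩ := hf.claim u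
  refine ⟨δ', da, fun s hs ag ah => ?_⟩
  obtain ⟨gb, gd, gc⟩ := hy s hs
  have e := he (y s) s LIN
  exact hc (y s) s ag ah (by rw [e.1, gd]) (by rw [e.2, gc])
end BX
set_option autoImplicit false
theorem chainA {f fx : RRR} {X : RtR} {ta : Real} (ho : ∀ᶠ p : Real × Real in 𝓝 (X ta, ta), HasDerivAt (fun x => f x p.2) (fx p.1 p.2) p.1)
    (hc : ContinuousAt (UC fx) (X ta, ta)) (hX : ContinuousAt X ta) :
    (fun t => f (X t) t - f (X ta) t - fx (X ta) ta * (X t - X ta)) =o[𝓝 ta] fun t => X t - X ta := by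
  rw [Asymptotics.isLittleO_iff]
  intro c dr
  have aa : ∀ᶠ p : Real × Real in 𝓝 (X ta, ta), |fx p.1 p.2 - fx (X ta) ta| < c := by
    have := Metric.continuousAt_iff'.1 hc c dr
    simpa [Real.dist_eq] using this
  obtain ⟨ε, ef, hε⟩ := Metric.eventually_nhds_iff.1 (ho.and aa)
  have ae : ∀ᶠ t in 𝓝 ta, |X t - X ta| < ε := by
    have := Metric.continuousAt_iff'.1 hX ε ef
    simpa [Real.dist_eq] using this
  have ag : ∀ᶠ t in 𝓝 ta, |t - ta| < ε := by
    have := Metric.ball_mem_nhds ta ef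
    filter_upwards [this] with t ht; simpa [Real.dist_eq] using ht
  filter_upwards [ae, ag] with t ae ag
  have inb : ∀ x, |x - X ta| < ε → HasDerivAt (fun x => f x t) (fx x t) x ∧ |fx x t - fx (X ta) ta| < c := fun x hx =>
    hε (y := (x, t)) (by rw [Prod.dist_eq]; simp [Real.dist_eq, hx, ag])
  have := Convex.norm_image_sub_le_of_norm_hasDerivWithin_le (s := Metric.ball (X ta) ε) (C := c)
    (f := fun x => f x t - fx (X ta) ta * x) (f' := fun x => fx x t - fx (X ta) ta) (x := X ta) (y := X t)
    (fun x hx => ((inb x (by simpa [Real.dist_eq] using hx)).1.sub ((hasDerivAt_id x).const_mul _ |>.congr_deriv (mul_one _))).hasDerivWithinAt)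
    (fun x hx => (inb x (by simpa [Real.dist_eq] using hx)).2.le) (convex_ball _ _) (Metric.mem_ball_self ef)
    (by simpa [Real.dist_eq] using ae)
  have e : f (X t) t - f (X ta) t - fx (X ta) ta * (X t - X ta) = (f (X t) t - fx (X ta) ta * X t) - (f (X ta) t - fx (X ta) ta * X ta) := RIN
  rw [e]; exact this
theorem chainB {f fx : RRR} {X : RtR} {ta ft D C : Real} (ho : ∀ᶠ p : Real × Real in 𝓝 (X ta, ta), HasDerivAt (fun x => f x p.2) (fx p.1 p.2) p.1)
    (hc : ContinuousAt (UC fx) (X ta, ta)) (hX : ∀ t, |X t - X ta| ≤ C * |t - ta|) (ht : HasDerivAt (fun t => f (X ta) t) ft ta)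
    (hD : fx (X ta) ta =0 ∨ HasDerivAt X D ta) : HasDerivAt (fun t => f (X t) t) (ft + fx (X ta) ta * D) ta := by
  have O : (fun t => X t - X ta) =O[𝓝 ta] fun t => t - ta := Asymptotics.IsBigO.of_bound C (.of_forall hX)
  have cX : ContinuousAt X ta := by
    rw [ContinuousAt, tendsto_iff_norm_sub_tendsto_zero]
    refine squeeze_zero (fun _ => norm_nonneg _) hX ?_
    have : ContinuousAt (fun t => C * |t - ta|) ta := FUN
    simpa [ContinuousAt] using this
  have o := (chainA ho hc cX).trans_isBigO O
  rw [hasDerivAt_iff_isLittleO] at ht ⊢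
  have oa : (fun t => fx (X ta) ta * (X t - X ta - (t - ta) * D)) =o[𝓝 ta] fun t => t - ta := by
    rcases hD with af | hD
    · simp [af]
    · rw [hasDerivAt_iff_isLittleO] at hD
      exact hD.const_mul_left _
  refine ((o.add ht).add oa).congr_left fun t => ?_
  simp only [smul_eq_mul]; ring
structure SM (S : RRR) (m N Λ : Real) : Prop where
  ma :0 < m
  sb : ∀ x t, m ≤ S x t ∧ S x t ≤ N
  Lb :0 ≤ Λ
  sl : ∀ x t x' t', |S x t - S x' t'| ≤ Λ * (|x - x'| + |t - t'|)
namespace SM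
variable {S : RRR} {m N Λ : Real}
theorem cont (h : SM S m N Λ) : Continuous fun p : Real × Real => S p.1 p.2 := by
  rw [continuous_iff_continuousAt]
  rintro ⟨x, t⟩
  rw [ContinuousAt, tendsto_iff_norm_sub_tendsto_zero]
  refine squeeze_zero (fun _ => norm_nonneg _) (fun p => h.sl p.1 p.2 x t) ?_
  have : ContinuousAt (fun p : Real × Real => Λ * (|p.1 - x| + |p.2 - t|)) (x, t) := FUN
  simpa [ContinuousAt] using this
theorem map (h : SM S m N Λ) (xm xa ta : Real) : ∃ X : RRR, X 0 ta = xa ∧ (Continuous fun p : Real × Real => X p.1 p.2) ∧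
    (∀ y t, HasDerivAt (fun y => X y t) (S (X y t) t)⁻¹ y) ∧
    (∀ y t, ∀ s, |X y s - X y t| ≤ Λ * |X y t - xm| / m * |s - t|) ∧
    (∀ y t, (∀ z ∈ uIcc xm (X y t), DifferentiableAt Real (fun s => S z s) t) → DifferentiableAt Real (fun s => X y s) t) ∧
    (∀ t, StrictMono fun y => X y t) ∧ ∃ Y : RRR, (Continuous fun p : Real × Real => Y p.1 p.2) ∧ ∀ x t, X (Y x t) t = x := by
  have hc := h.cont
  have ma := h.ma
  have Lb := h.Lb
  have cS : ∀ t, Continuous fun z => S z t := fun t => hc.comp (by fun_prop : Continuous fun z : Real => (z, t))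
  have ii : ∀ t p q, IntervalIntegrable (fun z => S z t) volume p q := fun t p q => (cS t).intervalIntegrable _ _
  set c := ∫ z in xm..xa, S z ta with hcd
  set d : RRR := fun x t => (∫ z in xm..x, S z t) - c with hd
  have dx : ∀ x t, HasDerivAt (fun x => d x t) (S x t) x := fun x t =>
    (intervalIntegral.integral_hasDerivAt_right (ii t _ _) ((cS t).stronglyMeasurableAtFilter _ _) (cS t).continuousAt).sub_const c
  have mono : ∀ t x x', x ≤ x' → m * (x' - x) ≤ d x' t - d x t := fun t x x' hx => by
    have := mono_hd (f := fun x => d x t - m * x) hx fun z _ => ⟨_, (dx z t).sub ((hasDerivAt_id z).const_mul m), by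
      have := (h.sb z t).1; simp only [mul_one]; linarith⟩
    linarith
  have inj : ∀ t x x', m * |x - x'| ≤ |d x t - d x' t| := fun t x x' => by
    rcases le_total x' x with hx | hx
    · rw [abs_of_nonneg (by linarith :0 ≤ x - x')]
      exact (mono t x' x hx).trans (le_abs_self _)
    · rw [abs_sub_comm, abs_of_nonneg (by linarith :0 ≤ x' - x), abs_sub_comm]
      exact (mono t x x' hx).trans (le_abs_self _)
  have surj : ∀ t, Function.Surjective fun x => d x t := fun t => by
    refine Continuous.surjective (continuous_iff_continuousAt.2 fun x => (dx x t).continuousAt) ?_ ?_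
    · refine tendsto_atTop_mono' _ (f₁ := fun x => d 0 t + m * x) ?_ ?_
      · filter_upwards [eventually_ge_atTop 0] with x hx
        have := mono t 0 x hx; linarith
      · exact tendsto_atTop_add_const_left _ _ (tendsto_id.const_mul_atTop ma)
    · refine tendsto_atBot_mono' atBot (f₂ := fun x => d x t) (f₁ := fun x => d 0 t + m * x) ?_ ?_
      · filter_upwards [eventually_le_atBot 0] with x hx
        have := mono t x 0 hx; linarith
      · exact tendsto_atBot_add_const_left _ _ (tendsto_id.const_mul_atBot ma)
  have ex : ∀ y t, ∃ x, d x t = y := fun y t => surj t y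
  choose X hX using ex
  have dl : ∀ x t s, |d x t - d x s| ≤ Λ * |x - xm| * |t - s| := fun x t s => by
    have e : d x t - d x s = ∫ z in xm..x, (S z t - S z s) := by
      rw [intervalIntegral.integral_sub (ii _ _ _) (ii _ _ _)]; simp only [hd]; ring
    rw [e]
    have := intervalIntegral.norm_integral_le_of_norm_le_const (a := xm) (b := x) (f := fun z => S z t - S z s) (C := Λ * |t - s|)
      fun z _ => by simpa using h.sl z t z s
    rw [Real.norm_eq_abs] at this; linarith
  have Xl : ∀ y t y' t', m * |X y t - X y' t'| ≤ |y - y'| + Λ * |X y' t' - xm| * |t' - t| := fun y t y' t' => by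
    refine (inj t _ _).trans ?_
    have : d (X y t) t - d (X y' t') t = (y - y') + (d (X y' t') t' - d (X y' t') t) := by rw [hX, hX]; ring
    rw [this]
    exact (abs_add_le _ _).trans (by gcongr; exact dl _ _ _)
  have Xlt : ∀ y t, ∀ s, |X y s - X y t| ≤ Λ * |X y t - xm| / m * |s - t| := fun y t s => by
    have := Xl y s y t
    rw [sub_self, abs_zero, zero_add, abs_sub_comm t s] at this
    rw [div_mul_eq_mul_div, le_div_iff₀ ma]; linarith
  have cX : Continuous fun p : Real × Real => X p.1 p.2 := by
    rw [continuous_iff_continuousAt]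
    rintro ⟨y, t⟩
    rw [ContinuousAt, tendsto_iff_norm_sub_tendsto_zero]
    refine squeeze_zero (fun _ => norm_nonneg _) (g := fun p : Real × Real => (|p.1 - y| + Λ * |X y t - xm| * |t - p.2|) / m) (fun p => ?_) ?_
    · rw [le_div_iff₀ ma, mul_comm]; exact Xl p.1 p.2 y t
    · have : ContinuousAt (fun p : Real × Real => (|p.1 - y| + Λ * |X y t - xm| * |t - p.2|) / m) (y, t) := FUN
      simpa [ContinuousAt] using this
  have db : ∀ x t, X (d x t) t = x := fun x t => by
    have := inj t (X (d x t) t) x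
    rw [hX, sub_self, abs_zero] at this
    have aa : |X (d x t) t - x| ≤0 := by by_contra hh; push Not at hh; have := mul_pos ma hh; linarith
    have := abs_nonpos_iff.1 aa; linarith
  have cd : Continuous fun p : Real × Real => d p.1 p.2 := by
    rw [continuous_iff_continuousAt]
    rintro ⟨x, t⟩
    have ce : ContinuousAt (fun p : Real × Real => d p.1 t) (x, t) := ContinuousAt.comp (f := Prod.fst) (g := fun x => d x t) (dx x t).continuousAt continuousAt_fst
    have ch : Tendsto (fun p : Real × Real => d p.1 p.2 - d p.1 t) (𝓝 (x, t)) (𝓝 0) := by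
      refine squeeze_zero_norm (fun p => dl p.1 p.2 t) ?_
      have : ContinuousAt (fun p : Real × Real => Λ * |p.1 - xm| * |p.2 - t|) (x, t) := FUN
      simpa [ContinuousAt] using this
    have := ch.add ce
    simpa [ContinuousAt] using this
  refine ⟨X, ?_, cX, fun y t => ?_, Xlt, fun y t hz => ?_, fun t y y' hy => ?_, d, cd, db⟩
  · have := db xa ta
    rwa [show d xa ta =0 by simp [hd, hcd]] at this
  · exact HasDerivAt.of_local_left_inverse (cX.comp (by fun_prop : Continuous fun y : Real => (y, t))).continuousAt (dx (X y t) t)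
      (ma.trans_le (h.sb _ _).1).ne' (.of_forall fun z => hX z t)
  · have Sa : S (X y t) t ≠0 := (ma.trans_le (h.sb _ _).1).ne'
    have hdt := (intervalIntegral.hasDerivAt_integral_of_dominated_loc_of_lip (μ := volume) (a := xm) (b := X y t) (bound := fun _ => Λ)
      (F := fun s z => S z s) (F' := fun z => deriv (fun s => S z s) t) (x₀ := t) (s := univ) univ_mem
      (.of_forall fun s => (cS s).aestronglyMeasurable) (ii _ _ _)
      ((measurable_deriv_with_param (f := fun z s => S z s) hc).comp (by fun_prop : Measurable fun z : Real => (z, t))).aestronglyMeasurable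
      (.of_forall fun z _ => LipschitzOnWith.of_dist_le_mul fun p _ q _ => by
        simpa [Real.dist_eq, abs_of_nonneg Lb] using h.sl z p z q) SIM
      (.of_forall fun z hz' => (hz z (uIoc_subset_uIcc hz')).hasDerivAt)).2
    have du : HasDerivAt (fun s => d (X y t) s) _ t := hdt.sub_const c
    set Dt := ∫ z in xm..X y t, deriv (fun s => S z s) t
    have O : (fun s => X y s - X y t) =O[𝓝 t] fun s => s - t := Asymptotics.IsBigO.of_bound _ (.of_forall (Xlt y t))
    have ob := (chainA (f := d) (fx := S) (X := fun s => X y s) (ta := t) (.of_forall fun p => dx p.1 p.2) hc.continuousAt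
      (cX.comp (by fun_prop : Continuous fun s : Real => (y, s))).continuousAt).trans_isBigO O
    rw [hasDerivAt_iff_isLittleO] at du
    have : HasDerivAt (fun s => X y s) (-(Dt / S (X y t) t)) t := by
      rw [hasDerivAt_iff_isLittleO]
      refine ((ob.add du).const_mul_left (-(S (X y t) t)⁻¹)).congr_left fun s => ?_
      simp only [hX, smul_eq_mul]
      field_simp; ring
    exact this.differentiableAt
  · by_contra! hh
    have := mono t _ _ hh
    rw [hX, hX] at this
    have := mul_nonneg ma.le (sub_nonneg.2 hh); linarith
end SM
set_option autoImplicit false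
def QB (xa ta ρ τ : Real) : Set (Real × Real) := {p | |p.1 - xa| < ρ ∧ |p.2 - ta| < τ}
theorem QB_open (xa ta ρ τ : Real) : IsOpen (QB xa ta ρ τ) := by
  exact (isOpen_lt (by fun_prop : Continuous fun p : Real × Real => |p.1 - xa|) continuous_const).inter
    (isOpen_lt (by fun_prop : Continuous fun p : Real × Real => |p.2 - ta|) continuous_const)
structure QX (u ux uxx ut S Sx : RRR) (G : Set (Real × Real)) (xa ta xm ρ τ M m N Λ : Real) : Prop where
  sm : SM S m N Λ
  ra :0 < ρ
  tc :0 < τ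
  Ma :0 ≤ M
  xmb : |xm - xa| < ρ
  qd : ∀ x t, (x, t) ∈ QB xa ta ρ τ → HasDerivAt (fun x => u x t) (ux x t) x
  qe : ∀ x t, (x, t) ∈ QB xa ta ρ τ → HasDerivAt (fun x => ux x t) (uxx x t) x
  qt : ∀ x t, (x, t) ∈ QB xa ta ρ τ → HasDerivAt (fun t => u x t) (ut x t) t
  ci : ContinuousOn (UC u) (QB xa ta ρ τ)
  ce : ContinuousOn (UC ux) (QB xa ta ρ τ)
  ch : ContinuousOn (UC uxx) (QB xa ta ρ τ)
  GO : IsOpen G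
  off : ∀ x t, (x, t) ∈ QB xa ta ρ τ → (x, t) ∉ G → ux x t =0 ∧ uxx x t =0
  seg : ∀ x t, (x, t) ∈ QB xa ta ρ τ → (x, t) ∈ G → ∀ z ∈ uIcc xm x, (z, t) ∈ G
  sd : ∀ x t, (x, t) ∈ G → HasDerivAt (fun x => S x t) (Sx x t) x ∧ DifferentiableAt Real (fun t => S x t) t
  sc : ContinuousOn (UC Sx) G
  iq : ∀ x t, (x, t) ∈ QB xa ta ρ τ → |ut x t - uxx x t / S x t ^2| ≤ M * (|u x t| + |ux x t|)
namespace QX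
variable {u ux uxx ut S Sx : RRR} {G : Set (Real × Real)} {xa ta xm ρ τ M m N Λ : Real}
theorem bx (h : QX u ux uxx ut S Sx G xa ta xm ρ τ M m N Λ) : ∃ (X Y Vb Vt : RRR) (R η M' B : Real),0 < η ∧
    (X 0 ta = xa) ∧ (∀ y t, |y| ≤ R → |t - ta| ≤ η → (X y t, t) ∈ QB xa ta ρ τ) ∧
    (∀ t, StrictMono fun y => X y t) ∧ (Continuous fun p : Real × Real => X p.1 p.2) ∧ (Continuous fun p : Real × Real => Y p.1 p.2) ∧
    (∀ x t, X (Y x t) t = x) ∧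
    BX (fun y t => u (X y t) t) (fun y t => ux (X y t) t * (S (X y t) t)⁻¹) Vb Vt R (ta - η) (ta + η) M' B := by
  obtain ⟨X, Xa, cX, dX, lX, tX, mX, Y, cY, hY⟩ := h.sm.map xm xa ta
  obtain ⟨sm, ra, tc, Ma, hxm, qd, qe, qt, ci, ce, ch, GO, off, seg, sd, sc, iq⟩ := h
  have ma := sm.ma
  have Lb := sm.Lb
  have Sp : ∀ x t,0 < S x t := fun x t => ma.trans_le (sm.sb x t).1
  have Nd :0 < N := (Sp 0 0).trans_le (sm.sb 0 0).2
  obtain ⟨ε, ef, hε⟩ := Metric.eventually_nhds_iff.1 ((cX.tendsto (0, ta)).eventually (Metric.ball_mem_nhds _ ra))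
  simp only [Xa] at hε
  set R := ε /2 with hR
  set η := min (ε /2) (τ /2) with hη
  have jo : η ≤ ε /2 := min_le_left _ _
  have jp : η ≤ τ /2 := min_le_right _ _
  have na :0 < η := POS
  have inQ : ∀ y t, |y| ≤ R → |t - ta| ≤ η → (X y t, t) ∈ QB xa ta ρ τ := fun y t hy ht => by
    have := hε (y := (y, t)) (by rw [Prod.dist_eq, max_lt_iff]; simp only [Real.dist_eq, sub_zero]; constructor <;> linarith)
    rw [Real.dist_eq] at this
    exact ⟨this, by simp only; linarith⟩
  have inQ' : ∀ y ∈ JJ R, ∀ t ∈ Icc (ta - η) (ta + η), (X y t, t) ∈ QB xa ta ρ τ := fun y hy t ht =>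
    inQ y t (abs_le.2 hy) (abs_le.2 ⟨by linarith [ht.1], by linarith [ht.2]⟩)
  have Qn : ∀ x t, (x, t) ∈ QB xa ta ρ τ → QB xa ta ρ τ ∈ 𝓝 (x, t) := fun x t hp => (QB_open _ _ _ _).mem_nhds hp
  have Sxb : ∀ x t, (x, t) ∈ G → |Sx x t| ≤ Λ := fun x t hp => by
    have := (sd x t hp).1.le_of_lip' Lb (.of_forall fun z => by simpa using sm.sl z t x t)
    simpa using this
  have usb : ∀ x t, (x, t) ∈ QB xa ta ρ τ → |ux x t * Sx x t| ≤ Λ * |ux x t| := fun x t hp => by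
    by_cases hg : (x, t) ∈ G
    · rw [abs_mul, mul_comm]; gcongr; exact Sxb x t hg
    · simp [(off x t hp hg).1]
  have cus : ContinuousOn (fun p : Real × Real => ux p.1 p.2 * Sx p.1 p.2) (QB xa ta ρ τ) := by
    rintro ⟨x, t⟩ hp
    refine ContinuousAt.continuousWithinAt ?_
    have cu : ContinuousAt (UC ux) (x, t) := ce.continuousAt (Qn x t hp)
    by_cases hg : (x, t) ∈ G
    · exact cu.mul (sc.continuousAt (GO.mem_nhds hg))
    · have ua := (off x t hp hg).1
      have : Tendsto (fun p : Real × Real => Λ * |ux p.1 p.2|) (𝓝 (x, t)) (𝓝 0) := by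
        simpa [ua] using (cu.tendsto.abs.const_mul Λ)
      have aa := squeeze_zero_norm' (f := fun p : Real × Real => ux p.1 p.2 * Sx p.1 p.2)
        (by filter_upwards [Qn x t hp] with p hp' using usb p.1 p.2 hp') this
      simpa [ContinuousAt, ua] using aa
  have cφ : Continuous fun p : Real × Real => (X p.1 p.2, p.2) := cX.prodMk continuous_snd
  have mφ : MapsTo (fun p : Real × Real => (X p.1 p.2, p.2)) (JJ R ×ˢ Icc (ta - η) (ta + η)) (QB xa ta ρ τ) :=
    fun p hp => inQ' p.1 hp.1 p.2 hp.2
  have cSi : Continuous fun p : Real × Real => (S p.1 p.2)⁻¹ := sm.cont.inv₀ fun p => (Sp _ _).ne'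
  have Cb := ci.comp cφ.continuousOn mφ
  have Cd := (ce.mul cSi.continuousOn).comp cφ.continuousOn mφ
  have Ce := ((ch.mul (cSi.pow 2).continuousOn).sub (cus.mul (cSi.pow 3).continuousOn)).comp cφ.continuousOn mφ
  set V : RRR := fun y t => u (X y t) t with hV
  set Va : RRR := fun y t => ux (X y t) t * (S (X y t) t)⁻¹ with dv
  set Vb : RRR := fun y t => uxx (X y t) t * (S (X y t) t)⁻¹ ^2 - ux (X y t) t * Sx (X y t) t * (S (X y t) t)⁻¹ ^3 with dk
  set Vt : RRR := fun y t => ut (X y t) t + ux (X y t) t * deriv (fun s => X y s) t with hVt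
  have cK : IsCompact (JJ R ×ˢ Icc (ta - η) (ta + η)) := isCompact_Icc.prod isCompact_Icc
  obtain ⟨Ba, fs⟩ := cK.exists_bound_of_continuousOn Cb
  obtain ⟨Bb, fu⟩ := cK.exists_bound_of_continuousOn Cd
  obtain ⟨Bc, fv⟩ := cK.exists_bound_of_continuousOn Ce
  set D :=2 * Λ * ρ / m with hD
  set M' := M * (1 + N) + N * (D + Λ * m⁻¹ ^3) with hM'
  have Da :0 ≤ D := POS
  have M'0 :0 ≤ M' := POS
  have IQ : ∀ y ∈ JJ R, ∀ t ∈ Icc (ta - η) (ta + η), |Vt y t - Vb y t| ≤ M' * (|V y t| + |Va y t|) := fun y hy t ht => by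
    have hq := inQ' y hy t ht
    have ia := iq _ _ hq
    have ic := usb _ _ hq
    have sf := Sp (X y t) t
    have dl : |deriv (fun s => X y s) t| ≤ D := by
      have : |deriv (fun s => X y s) t| ≤ Λ * |X y t - xm| / m := by
        by_cases hd : DifferentiableAt Real (fun s => X y s) t
        · have := hd.hasDerivAt.le_of_lip' (C := Λ * |X y t - xm| / m) POS (.of_forall fun s => lX y t s)
          simpa using this
        · rw [deriv_zero_of_not_differentiableAt hd, abs_zero]; positivity
      refine this.trans ?_
      rw [hD]
      have : |X y t - xm| ≤2 * ρ := by
        have := abs_sub_le (X y t) xa xm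
        have ho : |X y t - xa| < ρ := hq.1
        rw [abs_sub_comm xa] at this; linarith
      rw [show 2 * Λ * ρ = Λ * (2 * ρ) by ring]
      gcongr
    have ec : |ux (X y t) t| ≤ N * |Va y t| := by
      have : ux (X y t) t = S (X y t) t * Va y t := by simp only [dv]; field_simp
      rw [this, abs_mul, abs_of_pos sf]
      gcongr; exact (sm.sb _ _).2
    have si : (S (X y t) t)⁻¹ ≤ m⁻¹ := inv_anti₀ ma (sm.sb _ _).1
    have ed : |ux (X y t) t * Sx (X y t) t * (S (X y t) t)⁻¹ ^3| ≤ Λ * |ux (X y t) t| * m⁻¹ ^3 := by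
      rw [abs_mul, abs_of_pos (by positivity :0 < (S (X y t) t)⁻¹ ^3)]
      gcongr
    have eg : |ux (X y t) t * deriv (fun s => X y s) t| ≤ |ux (X y t) t| * D := by
      rw [abs_mul]; gcongr
    have e : Vt y t - Vb y t = (ut (X y t) t - uxx (X y t) t / S (X y t) t ^2) + ux (X y t) t * deriv (fun s => X y s) t
        + ux (X y t) t * Sx (X y t) t * (S (X y t) t)⁻¹ ^3 := by simp only [hVt, dk, inv_pow, div_eq_mul_inv]; ring
    rw [e]
    have ai := abs_add_le ((ut (X y t) t - uxx (X y t) t / S (X y t) t ^2) + ux (X y t) t * deriv (fun s => X y s) t) (ux (X y t) t * Sx (X y t) t * (S (X y t) t)⁻¹ ^3)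
    have aj := abs_add_le (ut (X y t) t - uxx (X y t) t / S (X y t) t ^2) (ux (X y t) t * deriv (fun s => X y s) t)
    have kb : (M + D + Λ * m⁻¹ ^3) * |ux (X y t) t| ≤ (M + D + Λ * m⁻¹ ^3) * (N * |Va y t|) := mul_le_mul_of_nonneg_left ec POS
    have kc :0 ≤ (M * N + N * (D + Λ * m⁻¹ ^3)) * |V y t| := POS
    have ke :0 ≤ M * |Va y t| := POS
    have kd : |u (X y t) t| = |V y t| := rfl
    rw [kd] at ia
    rw [hM']
    linarith
  refine ⟨X, Y, Vb, Vt, R, η, M', |Ba| + |Bb| + |Bc| + M' * (|Ba| + |Bb|), na, Xa, inQ, mX, cX, cY, hY, ?_⟩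
  refine ⟨POS, M'0, POS, fun y hy t ht => ?_, fun y hy t ht => ?_, fun y hy t ht => ?_, Cb, Cd, Ce, fun y hy t ht => ?_, IQ⟩
  · exact HasDerivAt.comp (h₂ := fun x => u x t) y (qd _ _ (inQ' y hy t ht)) (dX y t)
  · have hq := inQ' y hy t ht
    have dU : HasDerivAt (fun y => ux (X y t) t) _ y := HasDerivAt.comp (h₂ := fun x => ux x t) y (qe _ _ hq) (dX y t)
    by_cases hg : (X y t, t) ∈ G
    · have dS : HasDerivAt (fun y => S (X y t) t) _ y := HasDerivAt.comp (h₂ := fun x => S x t) y (sd _ _ hg).1 (dX y t)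
      have sf := (Sp (X y t) t).ne'
      refine (dU.mul (dS.inv sf)).congr_deriv ?_
      simp only [dk, Pi.inv_apply]; field_simp; ring
    · obtain ⟨ob, oa⟩ := off _ _ hq hg
      have : Vb y t =0 := by simp [dk, ob, oa]
      rw [this]
      rw [oa, zero_mul] at dU
      rw [hasDerivAt_iff_isLittleO] at dU ⊢
      have cg : ContinuousAt (fun y => (S (X y t) t)⁻¹) y := (cSi.comp (cφ.comp (by fun_prop : Continuous fun y : Real => (y, t)))).continuousAt
      have := dU.mul_isBigO (cg.isBigO_one (F := Real))
      simpa [ob, dv] using this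
  · have hq := inQ' y hy t ht
    have ev := Qn _ _ hq
    refine chainB (f := u) (fx := ux) (X := fun s => X y s) (by filter_upwards [ev] with p hp using qd p.1 p.2 hp) (ce.continuousAt ev)
      (lX y t) (qt _ _ hq) ?_
    by_cases hg : (X y t, t) ∈ G
    · exact Or.inr (tX y t fun z hz => (sd z t (seg _ _ hq hg z hz)).2).hasDerivAt
    · exact Or.inl (off _ _ hq hg).1
  · have bk : |V y t| ≤ |Ba| := (fs (y, t) ⟨hy, ht⟩).trans (le_abs_self _)
    have bc : |Va y t| ≤ |Bb| := (fu (y, t) ⟨hy, ht⟩).trans (le_abs_self _)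
    have be : |Vb y t| ≤ |Bc| := (fv (y, t) ⟨hy, ht⟩).trans (le_abs_self _)
    have bf := IQ y hy t ht
    have bg : M' * (|V y t| + |Va y t|) ≤ M' * (|Ba| + |Bb|) := GCO
    have bl := abs_sub_abs_le_abs_sub (Vt y t) (Vb y t)
    have jq :0 ≤ M' * (|Ba| + |Bb|) := POS
    have := abs_nonneg Ba; have := abs_nonneg Bb; have := abs_nonneg Bc
    refine ⟨?_, ?_, ?_, ?_⟩ <;> linarith
theorem pull {X Y : RRR} {y t : Real} (mX : ∀ t, StrictMono fun y => X y t) (cY : Continuous fun p : Real × Real => Y p.1 p.2) (hY : ∀ x t, X (Y x t) t = x)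
    {ε : Real} (hε :0 < ε) : ∃ δ >0, ∀ x s, |x - X y t| < δ → |s - t| < δ → |Y x s - y| < ε := by
  have e : Y (X y t) t = y := (mX t).injective (hY _ _)
  obtain ⟨δ, da, hδ⟩ := Metric.continuous_iff.1 cY (X y t, t) ε hε
  refine ⟨δ, da, fun x s hx hs => ?_⟩
  have := hδ (x, s) (by rw [Prod.dist_eq, max_lt_iff]; exact ⟨hx, hs⟩)
  rw [Real.dist_eq] at this
  simpa [e] using this
theorem uc (h : QX u ux uxx ut S Sx G xa ta xm ρ τ M m N Λ) : (∃ ρ' >0, ∀ x, |x - xa| < ρ' → u x ta =0) ∨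
    ∃ δ >0, ∀ p q, p < q → xa - δ < p → q < xa + δ → ∃ x ∈ Ioo p q, u x ta ≠0 := by
  obtain ⟨X, Y, Vb, Vt, R, η, M', B, na, Xa, inQ, mX, cX, cY, hY, hb⟩ := h.bx
  have Ra := hb.Ra
  by_cases hl : ∃ ρ >0, ∀ y, |y -0| < ρ → u (X y ta) ta =0
  · left
    obtain ⟨r, rb, hr⟩ := hl
    obtain ⟨δ, da, hδ⟩ := pull (y :=0) (t := ta) mX cY hY rb
    refine ⟨δ, da, fun x hx => ?_⟩
    have := hr _ (hδ x ta (by rwa [Xa]) (by simpa using da))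
    rwa [hY] at this
  · right
    obtain ⟨d, de, hd⟩ := hb.ucv (ya :=0) (ta := ta) (by simpa using Ra) ⟨LIN, LIN⟩ hl
    obtain ⟨δ, da, hδ⟩ := pull (y :=0) (t := ta) mX cY hY de
    refine ⟨δ, da, fun p q hpq hp hq => ?_⟩
    have ho := abs_lt.1 (hδ p ta (by rw [Xa, abs_lt]; constructor <;> linarith) (by simpa using da))
    have aa := abs_lt.1 (hδ q ta (by rw [Xa, abs_lt]; constructor <;> linarith) (by simpa using da))
    have ae : Y p ta < Y q ta := (mX ta).lt_iff_lt.1 (by simp only [hY]; exact hpq)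
    obtain ⟨y, hy, hne⟩ := hd _ _ ae LIN LIN
    refine ⟨X y ta, ⟨?_, ?_⟩, hne⟩
    · have := mX ta hy.1; simp only [hY] at this; exact this
    · have := mX ta hy.2; simp only [hY] at this; exact this
theorem gen (h : QX u ux uxx ut S Sx G xa ta xm ρ τ M m N Λ)
    (hne : ∀ x t, (x, t) ∈ QB xa ta ρ τ → ¬ ∃ r >0, ∀ z, |z - x| < r → u z t =0) :
    ∃ δ >0, volume {t | |t - ta| < δ ∧ ∃ x, |x - xa| < δ ∧ u x t =0 ∧ ux x t =0} =0 := by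
  obtain ⟨X, Y, Vb, Vt, R, η, M', B, na, Xa, inQ, mX, cX, cY, hY, hb⟩ := h.bx
  have Ra := hb.Ra
  have g := hb.genv fun y t hy ht => by
    rintro ⟨r, rb, hr⟩
    have hq := inQ y t LIN (abs_le.2 ⟨by linarith [ht.1], by linarith [ht.2]⟩)
    obtain ⟨δ, da, hδ⟩ := pull (y := y) (t := t) mX cY hY rb
    refine hne _ _ hq ⟨δ, da, fun z hz => ?_⟩
    have := hr _ (hδ z t hz (by simpa using da))
    rwa [hY] at this
  obtain ⟨δ, da, hδ⟩ := pull (y :=0) (t := ta) mX cY hY (by positivity :0 < R /4)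
  refine ⟨min δ η, lt_min da na, measure_mono_null ?_ g⟩
  rintro t ⟨ht, x, hx, ua, uf⟩
  rw [lt_min_iff] at ht hx
  have := abs_lt.1 ht.2
  refine ⟨⟨LIN, LIN⟩, Y x t, ?_, by rwa [hY], by rw [hY, uf, zero_mul]⟩
  simpa using hδ x t (by rw [Xa]; exact hx.1) ht.1
end QX
set_option autoImplicit false
structure LD (u ux uxx ut a ax axx ad b c : RRR) (ξ : RtR) (xa ta ρ τ M L : Real) : Prop where
  ra :0 < ρ
  tc :0 < τ
  La :0 < L
  Mb :1 ≤ M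
  Lτ :2 * L * τ ≤ ρ
  ξl : ∀ t s, |t - ta| < τ → |s - ta| < τ → |ξ t - ξ s| ≤ L * |t - s|
  xc : ξ ta ≤ xa
  D : ∀ x t, |x - xa| <2 * ρ → |t - ta| < τ → ξ t ≤ x → (HasDerivAt (fun x => u x t) (ux x t) x ∧ HasDerivAt (fun x => ux x t) (uxx x t) x ∧
    HasDerivAt (fun t => u x t) (ut x t) t) ∧ (HasDerivAt (fun x => a x t) (ax x t) x ∧ HasDerivAt (fun x => ax x t) (axx x t) x ∧
    HasDerivAt (fun t => a x t) (ad x t) t) ∧ (M⁻¹ ≤ a x t ∧ a x t ≤ M ∧ |ax x t| ≤ M ∧ |axx x t| ≤ M ∧ |ad x t| ≤ M ∧ |b x t| ≤ M ∧ |c x t| ≤ M) ∧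
    ut x t = a x t * uxx x t + b x t * ux x t + c x t * u x t
  ci : ContinuousOn (UC u) {p | p ∈ QB xa ta (2 * ρ) τ ∧ ξ p.2 ≤ p.1}
  ce : ContinuousOn (UC ux) {p | p ∈ QB xa ta (2 * ρ) τ ∧ ξ p.2 ≤ p.1}
  ch : ContinuousOn (UC uxx) {p | p ∈ QB xa ta (2 * ρ) τ ∧ ξ p.2 ≤ p.1}
  ct : ContinuousOn (UC ut) {p | p ∈ QB xa ta (2 * ρ) τ ∧ ξ p.2 ≤ p.1}
  z : ∀ t, |ξ t - xa| <2 * ρ → |t - ta| < τ → u (ξ t) t =0 ∧ ux (ξ t) t =0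
theorem vlip {f f' : RtR} {p q K : Real} (h : ∀ z ∈ uIcc p q, HasDerivAt f (f' z) z ∧ |f' z| ≤ K) : |f p - f q| ≤ K * |p - q| := by
  have := Convex.norm_image_sub_le_of_norm_hasDerivWithin_le (s := uIcc p q) (C := K) (f := f) (f' := f') (x := q) (y := p)
    (fun z hz => (h z hz).1.hasDerivWithinAt) (fun z hz => (h z hz).2) (convex_uIcc _ _) right_mem_uIcc left_mem_uIcc
  exact this
theorem abs_uIcc {p q z c r : Real} (hp : |p - c| < r) (hq : |q - c| < r) (hz : z ∈ uIcc p q) : |z - c| < r := by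
  rw [abs_lt] at *
  rcases le_total p q with h | h
  · rw [uIcc_of_le h] at hz; constructor <;> linarith [hz.1, hz.2]
  · rw [uIcc_of_ge h] at hz; constructor <;> linarith [hz.1, hz.2]
noncomputable def zx (ξ : RtR) (f : RRR) (x t : Real) : Real := open Classical in if ξ t < x then f x t else 0
theorem zx_le (ξ : RtR) (f : RRR) (x t : Real) : |zx ξ f x t| ≤ |f x t| := by
  unfold zx; split_ifs <;> simp
theorem dw {f g : RtR} {z : Real} (hf : HasDerivAt f 0 z) (fe : f z =0) (h : ∀ x, |g x| ≤ |f x|) : HasDerivAt g 0 z := by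
  have gg : g z =0 := by have := h z; rw [fe, abs_zero] at this; exact abs_nonpos_iff.1 this
  rw [hasDerivAt_iff_isLittleO] at hf ⊢
  simp only [fe, gg, sub_zero, smul_zero] at hf ⊢
  exact (Asymptotics.isBigO_of_le _ h).trans_isLittleO hf
namespace LD
variable {u ux uxx ut a ax axx ad b c : RRR} {ξ : RtR} {xa ta ρ τ M L : Real}
theorem ξc (h : LD u ux uxx ut a ax axx ad b c ξ xa ta ρ τ M L) {t : Real} (ht : |t - ta| < τ) : ContinuousAt ξ t := by
  rw [ContinuousAt, tendsto_iff_norm_sub_tendsto_zero]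
  refine squeeze_zero' (g := fun s => L * |s - t|) (.of_forall fun _ => norm_nonneg _) ?_ ?_
  · have : ∀ᶠ s in 𝓝 t, |s - ta| < τ := (by fun_prop : Continuous fun s => |s - ta|).continuousAt.eventually_lt continuousAt_const ht
    filter_upwards [this] with s hs using h.ξl s t hs ht
  · have : ContinuousAt (fun s => L * |s - t|) t := FUN
    simpa [ContinuousAt] using this
theorem xd (h : LD u ux uxx ut a ax axx ad b c ξ xa ta ρ τ M L) {x t : Real} (ht : |t - ta| < τ) : ContinuousAt (fun p : Real × Real => ξ p.2) (x, t) :=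
  ContinuousAt.comp (f := Prod.snd) (g := ξ) (x := (x, t)) (h.ξc ht) continuousAt_snd
theorem near (h : LD u ux uxx ut a ax axx ad b c ξ xa ta ρ τ M L) {x t r : Real} (hx : |x - xa| < r) (ht : |t - ta| < τ) (hξ : ξ t < x) :
    ∀ᶠ p : Real × Real in 𝓝 (x, t), p ∈ QB xa ta r τ ∧ ξ p.2 < p.1 :=
  Filter.Eventually.and ((QB_open xa ta r τ).mem_nhds (⟨hx, ht⟩ : (x, t) ∈ QB xa ta r τ)) ((h.xd ht).eventually_lt continuousAt_fst hξ)
theorem zxc (h : LD u ux uxx ut a ax axx ad b c ξ xa ta ρ τ M L) {f : RRR}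
    (hf : ContinuousOn (UC f) {p | p ∈ QB xa ta (2 * ρ) τ ∧ ξ p.2 ≤ p.1})
    (fe : ∀ t, |ξ t - xa| <2 * ρ → |t - ta| < τ → f (ξ t) t =0) : ContinuousOn (fun p : Real × Real => zx ξ f p.1 p.2) (QB xa ta (2 * ρ) τ) := by
  rintro ⟨x, t⟩ hp
  refine ContinuousAt.continuousWithinAt ?_
  have hξ := h.xd (x := x) hp.2
  rcases lt_trichotomy (ξ t) x with hl | hl | hl
  · have ev := h.near hp.1 hp.2 hl
    have : ContinuousAt (UC f) (x, t) := hf.continuousAt (by filter_upwards [ev] with p hp using ⟨hp.1, hp.2.le⟩)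
    refine this.congr ?_
    filter_upwards [ev] with p hp
    simp [zx, hp.2]
  · subst hl
    have v : zx ξ f (ξ t) t =0 := by simp [zx]
    have hw := hf (ξ t, t) ⟨hp, le_rfl⟩
    rw [ContinuousWithinAt, fe t hp.1 hp.2, Metric.tendsto_nhds] at hw
    rw [ContinuousAt, v, Metric.tendsto_nhds]
    intro ε ef
    have aa := eventually_nhdsWithin_iff.1 (hw ε ef)
    filter_upwards [aa, (QB_open xa ta (2 * ρ) τ).mem_nhds hp] with p ae ag
    by_cases ah : ξ p.2 < p.1
    · simpa [zx, ah] using ae ⟨ag, ah.le⟩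
    · simpa [zx, ah] using ef
  · refine (continuousAt_const (y := (0:Real))).congr ?_
    have : ∀ᶠ p : Real × Real in 𝓝 (x, t), p.1 < ξ p.2 := continuousAt_fst.eventually_lt hξ hl
    filter_upwards [this] with p hp
    simp [zx, hp.le]
theorem ud (h : LD u ux uxx ut a ax axx ad b c ξ xa ta ρ τ M L) {t : Real} (hx : |ξ t - xa| <2 * ρ) (ht : |t - ta| < τ) :
    ut (ξ t) t =0 ∧ uxx (ξ t) t =0 := by
  have La := h.La
  have key : ut (ξ t) t =0 := by
    by_contra hne
    set ε := |ut (ξ t) t| with hε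
    have ef :0 < ε := abs_pos.2 hne
    have mem : (ξ t, t) ∈ {p : Real × Real | p ∈ QB xa ta (2 * ρ) τ ∧ ξ p.2 ≤ p.1} := ⟨⟨hx, ht⟩, le_rfl⟩
    have wa := h.ce _ mem
    have wb := h.ct _ mem
    rw [ContinuousWithinAt, Metric.tendsto_nhds] at wa wb
    have ec := eventually_nhdsWithin_iff.1 (wa (ε / (8 * L)) POS)
    have ed := eventually_nhdsWithin_iff.1 (wb (ε /2) POS)
    obtain ⟨d, de, hd⟩ := Metric.eventually_nhds_iff.1 (ec.and (ed.and ((QB_open xa ta (2 * ρ) τ).mem_nhds mem.1)))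
    simp only [Real.dist_eq, (h.z t hx ht).2, sub_zero] at hd
    have hd' : ∀ x s, |x - ξ t| < d → |s - t| < d → (x, s) ∈ QB xa ta (2 * ρ) τ ∧ (ξ s ≤ x → |ux x s| < ε / (8 * L) ∧ |ut x s - ut (ξ t) t| < ε /2) :=
      fun x s ho aa => by
        obtain ⟨ae, ag, ah⟩ := hd (y := (x, s)) (by rw [Prod.dist_eq, max_lt_iff]; exact ⟨ho, aa⟩)
        exact ⟨ah, fun ak => ⟨ae ⟨ah, ak⟩, ag ⟨ah, ak⟩⟩⟩
    set k := min (d /2) (d / (2 * L)) with hk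
    have ka :0 < k := POS
    have kb : k ≤ d /2 := min_le_left _ _
    have kc : L * k ≤ d /2 := by
      have := mul_le_mul_of_nonneg_left (min_le_right (d /2) (d / (2 * L))) La.le
      rw [show L * (d / (2 * L)) = d /2 by field_simp] at this; exact this
    set x := ξ t + L * k with hxd
    have Lk :0 < L * k := POS
    have tm : ∀ s ∈ Icc (t - k) (t + k), |s - t| ≤ k := fun s hs => abs_le.2 ⟨by linarith [hs.1], by linarith [hs.2]⟩
    have cv : ∀ s ∈ Icc (t - k) (t + k), |ξ s - ξ t| ≤ L * k := fun s hs => by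
      have ai := tm s hs
      have := (hd' (ξ t) s (by simpa using de) LIN).1.2
      exact (h.ξl s t this ht).trans GCO
    have rg : ∀ s ∈ Icc (t - k) (t + k), ξ s ≤ x := fun s hs => by have := (abs_le.1 (cv s hs)).2; linarith
    have ub : ∀ s ∈ Icc (t - k) (t + k), |u x s| ≤ ε / (8 * L) * (2 * (L * k)) := fun s hs => by
      have ce := abs_le.1 (cv s hs)
      have ai := tm s hs
      have hz := hd' (ξ s) s (by linarith [cv s hs]) LIN
      have := vlip (f := fun x => u x s) (f' := fun x => ux x s) (p := x) (q := ξ s) (K := ε / (8 * L)) fun z hz => by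
        rw [uIcc_of_ge (rg s hs)] at hz
        have := hd' z s (by rw [abs_lt]; constructor <;> linarith [hz.1, hz.2]) LIN
        exact ⟨(h.D z s this.1.1 this.1.2 hz.1).1.1, (this.2 hz.1).1.le⟩
      rw [(h.z s hz.1.1 hz.1.2).1, sub_zero] at this
      refine this.trans ?_
      gcongr
      rw [abs_of_nonneg (by linarith [rg s hs])]; linarith
    obtain ⟨θ, hθ, he⟩ := exists_hasDerivAt_eq_slope (fun s => u x s) (fun s => ut x s) (a := t - k) (b := t + k) LIN
      (fun s hs => by
        have ai := tm s hs
        have := hd' x s (by rw [abs_lt]; constructor <;> linarith) LIN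
        exact (h.D x s this.1.1 this.1.2 (rg s hs)).1.2.2.continuousAt.continuousWithinAt)
      (fun s hs => by
        have ai := tm s (Ioo_subset_Icc_self hs)
        have := hd' x s (by rw [abs_lt]; constructor <;> linarith) LIN
        exact (h.D x s this.1.1 this.1.2 (rg s (Ioo_subset_Icc_self hs))).1.2.2)
    have ai := tm θ (Ioo_subset_Icc_self hθ)
    have fa := ((hd' x θ (by rw [abs_lt]; constructor <;> linarith) LIN).2 (rg θ (Ioo_subset_Icc_self hθ))).2
    have fd := ub (t + k) ⟨LIN, le_rfl⟩
    have ff := ub (t - k) ⟨le_rfl, LIN⟩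
    have fn : |ut x θ| ≤ ε /4 := by
      rw [he, abs_div, abs_of_pos (by linarith :0 < t + k - (t - k)), div_le_iff₀ LIN]
      have := abs_sub (u x (t + k)) (u x (t - k))
      have e : ε / (8 * L) * (2 * (L * k)) = ε /4 * k := by field_simp; ring
      rw [e] at fd ff
      linarith
    have fw := abs_sub_abs_le_abs_sub (ut (ξ t) t) (ut x θ)
    rw [abs_sub_comm (ut (ξ t) t)] at fw
    linarith
  refine ⟨key, ?_⟩
  obtain ⟨-, -, ⟨ai, -⟩, e⟩ := h.D (ξ t) t hx ht le_rfl
  obtain ⟨za, zb⟩ := h.z t hx ht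
  rw [key, za, zb] at e
  have :0 < a (ξ t) t := lt_of_lt_of_le (inv_pos.2 (by linarith [h.Mb])) ai
  have aa : a (ξ t) t * uxx (ξ t) t =0 := LIN
  exact (mul_eq_zero.1 aa).resolve_left this.ne'
end LD
set_option autoImplicit false
theorem isq {w' M x : Real} {f : RtR} (hM :1 ≤ M) (ho : M⁻¹ ≤ f x) (aa : |w'| ≤ M) (hf : HasDerivAt f w' x) :
    HasDerivAt (fun x => (√(f x))⁻¹) (-(w' / (2 * √(f x))) / √(f x) ^2) x ∧ |-(w' / (2 * √(f x))) / √(f x) ^2| ≤ M ^4 := by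
  have Ma :0 < M := LIN
  have p :0 < f x := (inv_pos.2 Ma).trans_le ho
  have sp :0 < √(f x) := Real.sqrt_pos.2 p
  refine ⟨(hf.sqrt p.ne').fun_inv sp.ne', ?_⟩
  have sd : M⁻¹ ≤ √(f x) := by
    apply Real.le_sqrt_of_sq_le
    have : M⁻¹ ≤1 := inv_le_one_of_one_le₀ hM
    nlinarith [inv_pos.2 Ma]
  have sc : (√(f x))⁻¹ ≤ M := inv_le_of_inv_le₀ Ma sd
  have e : -(w' / (2 * √(f x))) / √(f x) ^2 = -(w' /2 * (√(f x))⁻¹ ^3) := by field_simp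
  rw [e, abs_neg, abs_mul, abs_of_pos (by positivity :0 < (√(f x))⁻¹ ^3)]
  have : |w' /2| ≤ M := by rw [abs_div, abs_two]; linarith [abs_nonneg w']
  calc _ ≤ M * M ^3 := GCO
    _ = M ^4 := RIN
namespace LD
variable {u ux uxx ut a ax axx ad b c : RRR} {ξ : RtR} {xa ta ρ τ M L : Real}
theorem glip (h : LD u ux uxx ut a ax axx ad b c ξ xa ta ρ τ M L) {g gx gt : RRR} {K : Real} (Kb :0 ≤ K)
    (hg : ∀ x t, |x - xa| <2 * ρ → |t - ta| < τ → ξ t ≤ x → (HasDerivAt (fun x => g x t) (gx x t) x ∧ |gx x t| ≤ K) ∧ HasDerivAt (fun t => g x t) (gt x t) t ∧ |gt x t| ≤ K)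
    {x t x' t' : Real} (hx : |x - xa| < ρ) (ht : |t - ta| < τ) (hx' : |x' - xa| < ρ) (ht' : |t' - ta| < τ) (hξ : ξ t ≤ x) (hξ' : ξ t' ≤ x') :
    |g x t - g x' t'| ≤ K * (2 * L +2) * (|x - x'| + |t - t'|) := by
  have La := h.La
  set y := max x x' + L * |t - t'| with hy
  have tt : |t - t'| <2 * τ := by
    have := abs_sub_le t ta t'
    rw [abs_sub_comm ta] at this; linarith
  have Lt : L * |t - t'| < ρ := (mul_lt_mul_of_pos_left tt La).trans_le (by linarith [h.Lτ])
  have Lc :0 ≤ L * |t - t'| := POS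
  have mc := le_max_left x x'
  have mb := le_max_right x x'
  have me : max x x' - x ≤ |x - x'| ∧ max x x' - x' ≤ |x - x'| := by
    rcases max_choice x x' with e | e <;> rw [e]
    · exact ⟨SIM, le_abs_self _⟩
    · exact ⟨by rw [abs_sub_comm]; exact le_abs_self _, SIM⟩
  have mf : max x x' < xa + ρ := max_lt (by linarith [(abs_lt.1 hx).2]) (by linarith [(abs_lt.1 hx').2])
  have ay := abs_lt.1 hx
  have jr := abs_lt.1 hx'
  have yb : |y - xa| <2 * ρ := by rw [abs_lt]; constructor <;> linarith
  have pa : |g x t - g y t| ≤ K * |x - y| := vlip (f := fun x => g x t) (f' := fun x => gx x t) fun z hz => by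
    rw [uIcc_of_le LIN] at hz
    exact (hg z t (by rw [abs_lt]; constructor <;> linarith [hz.1, hz.2, abs_lt.1 yb]) ht (by linarith [hz.1])).1
  have pb : |g y t - g y t'| ≤ K * |t - t'| := vlip (f := fun t => g y t) (f' := fun t => gt y t) fun z hz => by
    have hz' := abs_uIcc ht ht' hz
    refine (hg y z yb hz' ?_).2
    have := h.ξl z t hz' ht
    have ae : |z - t| ≤ |t - t'| := by
      rw [abs_sub_comm t t']; exact abs_sub_left_of_mem_uIcc hz
    have ag : L * |z - t| ≤ L * |t - t'| := GCO
    linarith [le_abs_self (ξ z - ξ t)]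
  have pd : |g y t' - g x' t'| ≤ K * |y - x'| := vlip (f := fun x => g x t') (f' := fun x => gx x t') fun z hz => by
    rw [uIcc_of_ge LIN] at hz
    exact (hg z t' (by rw [abs_lt]; constructor <;> linarith [hz.1, hz.2, abs_lt.1 yb]) ht' (by linarith [hz.1])).1
  have qd := abs_sub_le (g x t) (g y t) (g x' t')
  have qe := abs_sub_le (g y t) (g y t') (g x' t')
  have rd : |x - y| ≤ |x - x'| + L * |t - t'| := by rw [abs_sub_comm, abs_of_nonneg LIN]; linarith
  have rf : |y - x'| ≤ |x - x'| + L * |t - t'| := by rw [abs_of_nonneg LIN]; linarith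
  have rc : |x - y| + |t - t'| + |y - x'| ≤ (2 * L +2) * (|x - x'| + |t - t'|) := by
    have :0 ≤ L * |x - x'| := POS
    have := abs_nonneg (t - t'); linarith
  have := mul_le_mul_of_nonneg_left rc Kb
  linarith
theorem gcont (h : LD u ux uxx ut a ax axx ad b c ξ xa ta ρ τ M L) {g gx gt : RRR} {K : Real} (Kb :0 ≤ K)
    (hg : ∀ x t, |x - xa| <2 * ρ → |t - ta| < τ → ξ t ≤ x → (HasDerivAt (fun x => g x t) (gx x t) x ∧ |gx x t| ≤ K) ∧ HasDerivAt (fun t => g x t) (gt x t) t ∧ |gt x t| ≤ K)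
    {x t : Real} (hx : |x - xa| < ρ) (ht : |t - ta| < τ) (hξ : ξ t < x) : ContinuousAt (UC g) (x, t) := by
  rw [ContinuousAt, tendsto_iff_norm_sub_tendsto_zero]
  refine squeeze_zero' (g := fun p : Real × Real => K * (2 * L +2) * (|p.1 - x| + |p.2 - t|)) (.of_forall fun _ => norm_nonneg _) ?_ ?_
  · filter_upwards [h.near hx ht hξ] with p hp
    exact h.glip Kb hg hp.1.1 hp.1.2 hx ht hp.2.le hξ.le
  · have : ContinuousAt (fun p : Real × Real => K * (2 * L +2) * (|p.1 - x| + |p.2 - t|)) (x, t) := FUN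
    simpa [ContinuousAt] using this
theorem axc (h : LD u ux uxx ut a ax axx ad b c ξ xa ta ρ τ M L) {x t : Real} (hx : |x - xa| < ρ) (ht : |t - ta| < τ) (hξ : ξ t < x) :
    ContinuousAt (UC ax) (x, t) := by
  have Ma :0 < M := by linarith [h.Mb]
  have ac : ∀ {x t : Real}, |x - xa| < ρ → |t - ta| < τ → ξ t < x → ContinuousAt (UC a) (x, t) := fun ho aa ae =>
    h.gcont Ma.le (fun x t ho aa ae => by
      obtain ⟨-, ⟨ai, aj, ar⟩, ⟨bc, be, bf, bg, bl, -⟩, -⟩ := h.D x t ho aa ae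
      exact ⟨⟨ai, bf⟩, ar, bl⟩) ho aa ae
  refine continuousAt_of_locally_uniform_approx_of_continuousAt fun v hv => ?_
  obtain ⟨ε, ef, hε⟩ := Metric.mem_uniformity_dist.1 hv
  obtain ⟨d, de, hd⟩ := Metric.eventually_nhds_iff.1 (h.near hx ht hξ)
  set k := min (d /4) (ε / (2 * M)) with hk
  have ka :0 < k := POS
  have kb : k ≤ d /4 := min_le_left _ _
  have kc : M * k < ε := by
    have := mul_le_mul_of_nonneg_left (min_le_right (d /4) (ε / (2 * M))) Ma.le
    rw [show M * (ε / (2 * M)) = ε /2 by field_simp] at this; linarith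
  have hd' : ∀ z s, |z - x| < d → |s - t| < d → |z - xa| < ρ ∧ |s - ta| < τ ∧ ξ s < z := fun z s ho aa => by
    have := hd (y := (z, s)) (by rw [Prod.dist_eq, max_lt_iff]; exact ⟨ho, aa⟩)
    exact ⟨this.1.1, this.1.2, this.2⟩
  have xk := hd' (x + k) t (by rw [add_sub_cancel_left, abs_of_pos ka]; linarith) (by simpa using de)
  have ra := h.ra
  refine ⟨Metric.ball (x, t) (d /4), Metric.ball_mem_nhds _ POS, fun p => (a (p.1 + k) p.2 - a p.1 p.2) / k, ?_, ?_⟩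
  · refine ContinuousAt.div_const (ContinuousAt.sub ?_ (ac hx ht hξ)) _
    exact ContinuousAt.comp (f := fun p : Real × Real => (p.1 + k, p.2)) (g := fun p : Real × Real => a p.1 p.2) (x := (x, t)) (ac xk.1 xk.2.1 xk.2.2) FUN
  · rintro ⟨y, s⟩ hp
    rw [Metric.mem_ball, Prod.dist_eq, max_lt_iff] at hp
    obtain ⟨hy, hs⟩ := hp
    simp only [Real.dist_eq] at hy hs
    have ib : ∀ z ∈ Icc y (y + k), |z - xa| <2 * ρ ∧ |s - ta| < τ ∧ ξ s ≤ z := fun z hz => by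
      have := abs_lt.1 hy
      obtain ⟨ia, ic, ie⟩ := hd' z s (by rw [abs_lt]; constructor <;> linarith [hz.1, hz.2]) LIN
      exact ⟨LIN, ic, ie.le⟩
    obtain ⟨θ, hθ, he⟩ := exists_hasDerivAt_eq_slope (fun z => a z s) (fun z => ax z s) (a := y) (b := y + k) LIN
      (fun z hz => (h.D z s (ib z hz).1 (ib z hz).2.1 (ib z hz).2.2).2.1.1.continuousAt.continuousWithinAt)
      (fun z hz => by have hz := Ioo_subset_Icc_self hz; exact (h.D z s (ib z hz).1 (ib z hz).2.1 (ib z hz).2.2).2.1.1)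
    rw [add_sub_cancel_left] at he
    refine hε ?_
    simp only [← he, Real.dist_eq]
    have := vlip (f := fun z => ax z s) (f' := fun z => axx z s) (p := y) (q := θ) (K := M) fun z hz => by
      rw [uIcc_of_le hθ.1.le] at hz
      have hz : z ∈ Icc y (y + k) := ⟨hz.1, hz.2.trans hθ.2.le⟩
      obtain ⟨-, ⟨-, aj, -⟩, ⟨-, -, -, bg, -⟩, -⟩ := h.D z s (ib z hz).1 (ib z hz).2.1 (ib z hz).2.2
      exact ⟨aj, bg⟩
    have aa : |y - θ| ≤ k := by rw [abs_sub_comm, abs_of_pos (by linarith [hθ.1])]; linarith [hθ.2]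
    have ae : M * |y - θ| ≤ M * k := GCO
    linarith
theorem qx (h : LD u ux uxx ut a ax axx ad b c ξ xa ta ρ τ M L) : ∃ (S Sx : RRR) (G : Set (Real × Real)) (xm m N Λ : Real),
    QX (zx ξ u) (zx ξ ux) (zx ξ uxx) (zx ξ ut) S Sx G xa ta xm ρ τ M m N Λ := by
  have Mb := h.Mb
  have Ma :0 < M := LIN
  have La := h.La
  have ra := h.ra
  have tc := h.tc
  set Sa : RRR := fun x t => (√(a x t))⁻¹ with fy
  set Sx : RRR := fun x t => -(ax x t / (2 * √(a x t))) / √(a x t) ^2 with hSx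
  have sD : ∀ x t, |x - xa| <2 * ρ → |t - ta| < τ → ξ t ≤ x → (HasDerivAt (fun x => Sa x t) (Sx x t) x ∧ |Sx x t| ≤ M ^4) ∧
      HasDerivAt (fun t => Sa x t) (-(ad x t / (2 * √(a x t))) / √(a x t) ^2) t ∧ |-(ad x t / (2 * √(a x t))) / √(a x t) ^2| ≤ M ^4 := fun x t ho aa ae => by
    obtain ⟨-, ⟨ai, aj, ar⟩, ⟨bc, be, bf, bg, bl, -⟩, -⟩ := h.D x t ho aa ae
    exact ⟨isq (f := fun x => a x t) Mb bc bf ai, isq (f := fun t => a x t) Mb bc bl ar⟩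
  have sB : ∀ x t, |x - xa| <2 * ρ → |t - ta| < τ → ξ t ≤ x → M⁻¹ ≤ Sa x t ∧ Sa x t ≤ M ∧ (Sa x t ^2)⁻¹ = a x t ∧ 0 < a x t := fun x t ho aa ae => by
    obtain ⟨-, -, ⟨bc, be, -⟩, -⟩ := h.D x t ho aa ae
    have p :0 < a x t := (inv_pos.2 Ma).trans_le bc
    have sp :0 < √(a x t) := Real.sqrt_pos.2 p
    have ia : M⁻¹ ≤1 := inv_le_one_of_one_le₀ Mb
    refine ⟨inv_anti₀ sp (Real.sqrt_le_iff.2 ⟨Ma.le, by nlinarith⟩), inv_le_of_inv_le₀ Ma (Real.le_sqrt_of_sq_le (by nlinarith [inv_pos.2 Ma])), ?_, p⟩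
    simp only [fy, inv_pow, inv_inv]; exact Real.sq_sqrt p.le
  set G : Set (Real × Real) := {p | p ∈ QB xa ta ρ τ ∧ ξ p.2 < p.1} with hG
  set Λ : Real := M ^4 * (2 * L +2) *2 with hΛ
  have Lb :0 ≤ Λ := POS
  have GO : IsOpen G := isOpen_iff_mem_nhds.2 fun p hp => h.near hp.1.1 hp.1.2 hp.2
  have sl : LipschitzOnWith Λ.toNNReal (UC Sa) G := LipschitzOnWith.of_dist_le_mul fun p hp q hq => by
    rw [Real.coe_toNNReal _ Lb, Real.dist_eq]
    refine (h.glip POS sD hp.1.1 hp.1.2 hq.1.1 hq.1.2 hp.2.le hq.2.le).trans ?_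
    rw [hΛ, mul_assoc _ (2:Real)]
    gcongr
    have := le_max_left (dist p.1 q.1) (dist p.2 q.2)
    have := le_max_right (dist p.1 q.1) (dist p.2 q.2)
    rw [Prod.dist_eq, ← Real.dist_eq, ← Real.dist_eq]; linarith
  obtain ⟨g, gl, ge⟩ := sl.extend_real
  set S : RRR := fun x t => max M⁻¹ (min M (g (x, t))) with hS
  have SG : ∀ x t, (x, t) ∈ G → S x t = Sa x t := fun x t hp => by
    obtain ⟨sd, sc, -⟩ := sB x t (by have := hp.1.1; simp only at this; linarith) hp.1.2 hp.2.le
    have e : Sa x t = g (x, t) := ge hp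
    simp only [hS]; rw [← e, min_eq_right sc, max_eq_right sd]
  have sm : SM S M⁻¹ M Λ := by
    refine ⟨inv_pos.2 Ma, fun x t => ⟨le_max_left _ _, max_le ((inv_le_one_of_one_le₀ Mb).trans Mb) (min_le_left _ _)⟩, Lb, fun x t x' t' => ?_⟩
    have ho := gl.dist_le_mul (x, t) (x', t')
    rw [Real.coe_toNNReal _ Lb, Real.dist_eq] at ho
    have aa : |S x t - S x' t'| ≤ |g (x, t) - g (x', t')| := by
      simp only [hS, max_comm M⁻¹]
      refine (abs_max_sub_max_le_abs _ _ _).trans ?_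
      rw [min_comm M, min_comm M]
      have := abs_max_sub_max_le_abs (-g (x, t)) (-g (x', t')) (-M)
      rw [max_neg_neg, max_neg_neg] at this
      rwa [← neg_sub', abs_neg, ← neg_sub', abs_neg] at this
    refine aa.trans (ho.trans ?_)
    gcongr
    rw [Prod.dist_eq, Real.dist_eq, Real.dist_eq]
    exact max_le (by linarith [abs_nonneg (t - t')]) (by linarith [abs_nonneg (x - x')])
  have Qa : ∀ {x t}, (x, t) ∈ QB xa ta ρ τ → (x, t) ∈ QB xa ta (2 * ρ) τ := fun hp => ⟨lt_of_lt_of_le hp.1 LIN, hp.2⟩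
  have sub : QB xa ta ρ τ ⊆ QB xa ta (2 * ρ) τ := fun p hp => Qa hp
  have xr : ∀ {x t} (f f' : RRR), (x, t) ∈ QB xa ta ρ τ → (ξ t ≤ x → HasDerivAt (fun x => f x t) (f' x t) x) → (f (ξ t) t =0 ∨ x ≠ ξ t) → (f' (ξ t) t =0 ∨ x ≠ ξ t) →
      HasDerivAt (fun x => zx ξ f x t) (zx ξ f' x t) x := fun {x t} f f' hp hd fe fg => by
    rcases lt_trichotomy (ξ t) x with hl | hl | hl
    · have : zx ξ f' x t = f' x t := by simp [zx, hl]
      rw [this]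
      refine (hd hl.le).congr_of_eventuallyEq ?_
      filter_upwards [lt_mem_nhds hl] with z hz
      simp [zx, hz]
    · have v : zx ξ f' x t =0 := by simp [zx, hl]
      have fe := fe.resolve_right (by simp [hl])
      have fg := fg.resolve_right (by simp [hl])
      rw [v]; rw [hl] at fe fg
      have := hd hl.le
      rw [fg] at this
      exact dw this fe fun z => zx_le ξ f z t
    · have v : zx ξ f' x t =0 := by simp [zx, hl.le]
      rw [v]
      refine (hasDerivAt_const x (0:Real)).congr_of_eventuallyEq ?_
      filter_upwards [gt_mem_nhds hl] with z hz
      simp [zx, hz.le]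
  have zc : ∀ {x t} (f : RRR), (x, t) ∈ QB xa ta ρ τ → (|ξ t - xa| <2 * ρ → |t - ta| < τ → f (ξ t) t =0) → (f (ξ t) t =0 ∨ x ≠ ξ t) := fun {x t} f hp hf => by
    by_cases e : x = ξ t
    · rw [e] at hp; exact Or.inl (hf (Qa hp).1 hp.2)
    · exact Or.inr e
  refine ⟨S, Sx, G, xa + ρ /2, M⁻¹, M, Λ, sm, ra, tc, Ma.le, by rw [add_sub_cancel_left, abs_of_pos LIN]; linarith, ?_, ?_, ?_,
    (h.zxc h.ci fun t ho aa => (h.z t ho aa).1).mono sub, (h.zxc h.ce fun t ho aa => (h.z t ho aa).2).mono sub,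
    (h.zxc h.ch fun t ho aa => (h.ud ho aa).2).mono sub, GO, ?_, ?_, ?_, ?_, ?_⟩
  · exact fun x t hp => xr u ux hp (fun hl => (h.D x t (Qa hp).1 hp.2 hl).1.1) (zc u hp fun ho aa => (h.z t ho aa).1) (zc ux hp fun ho aa => (h.z t ho aa).2)
  · exact fun x t hp => xr ux uxx hp (fun hl => (h.D x t (Qa hp).1 hp.2 hl).1.2.1) (zc ux hp fun ho aa => (h.z t ho aa).2) (zc uxx hp fun ho aa => (h.ud ho aa).2)
  · intro x t hp
    have hξ := h.ξc hp.2
    rcases lt_trichotomy (ξ t) x with hl | hl | hl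
    · have : zx ξ ut x t = ut x t := by simp [zx, hl]
      rw [this]
      refine (h.D x t (Qa hp).1 hp.2 hl.le).1.2.2.congr_of_eventuallyEq ?_
      filter_upwards [hξ.eventually_lt continuousAt_const hl] with z hz
      simp [zx, hz]
    · have v : zx ξ ut x t =0 := by simp [zx, hl]
      rw [v]
      have := (h.D x t (Qa hp).1 hp.2 hl.le).1.2.2
      subst hl
      rw [(h.ud (Qa hp).1 hp.2).1] at this
      exact dw this (h.z t (Qa hp).1 hp.2).1 fun z => zx_le ξ u _ z
    · have v : zx ξ ut x t =0 := by simp [zx, hl.le]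
      rw [v]
      refine (hasDerivAt_const t (0:Real)).congr_of_eventuallyEq ?_
      filter_upwards [continuousAt_const.eventually_lt hξ hl] with z hz
      simp [zx, hz.le]
  · intro x t hp hg
    have : ¬ ξ t < x := fun hl => hg ⟨hp, hl⟩
    simp [zx, this]
  · intro x t hp hg z hz
    have ξm : ξ t < xa + ρ /2 := by
      have ht : |t - ta| < τ := hp.2
      have := h.ξl t ta ht (by simpa using tc)
      have aa : L * |t - ta| < L * τ := GCO
      linarith [h.Lτ, h.xc, le_abs_self (ξ t - ξ ta)]
    refine ⟨⟨abs_uIcc (by rw [add_sub_cancel_left, abs_of_pos LIN]; linarith) hp.1 hz, hp.2⟩, ?_⟩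
    have := hg.2
    simp only at this ⊢
    exact lt_of_lt_of_le (lt_min ξm this) hz.1
  · intro x t hp
    have ev : ∀ᶠ p : Real × Real in 𝓝 (x, t), S p.1 p.2 = Sa p.1 p.2 := by
      filter_upwards [GO.mem_nhds hp] with p hp using SG p.1 p.2 hp
    obtain ⟨⟨db, -⟩, dc, -⟩ := sD x t (Qa hp.1).1 hp.1.2 hp.2.le
    exact ⟨db.congr_of_eventuallyEq (((by fun_prop : Continuous fun z : Real => (z, t)).tendsto x).eventually ev),
      (dc.congr_of_eventuallyEq (((by fun_prop : Continuous fun s : Real => (x, s)).tendsto t).eventually ev)).differentiableAt⟩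
  · rintro ⟨x, t⟩ hp
    have hh := Qa hp.1
    have p := (sB x t hh.1 hh.2 hp.2.le).2.2.2
    have sp :0 < √(a x t) := Real.sqrt_pos.2 p
    have ca : ContinuousAt (fun p : Real × Real => √(a p.1 p.2)) (x, t) := Real.continuous_sqrt.continuousAt.comp (h.gcont Ma.le (fun x t ho aa ae => by
      obtain ⟨-, ⟨ai, aj, ar⟩, ⟨bc, be, bf, bg, bl, -⟩, -⟩ := h.D x t ho aa ae
      exact ⟨⟨ai, bf⟩, ar, bl⟩) hp.1.1 hp.1.2 hp.2)
    exact ((((h.axc hp.1.1 hp.1.2 hp.2).div (ca.const_mul 2) (mul_pos two_pos sp).ne').neg).div (ca.pow 2) (pow_pos sp 2).ne').continuousWithinAt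
  · intro x t hp
    by_cases hl : ξ t < x
    · obtain ⟨-, -, ⟨-, -, -, -, -, hb, hc⟩, he⟩ := h.D x t (Qa hp).1 hp.2 hl.le
      simp only [zx, hl, if_true]
      rw [div_eq_mul_inv, SG x t ⟨hp, hl⟩, (sB x t (Qa hp).1 hp.2 hl.le).2.2.1, he]
      have e : a x t * uxx x t + b x t * ux x t + c x t * u x t - uxx x t * a x t = b x t * ux x t + c x t * u x t := RIN
      rw [e]
      refine (abs_add_le _ _).trans ?_
      rw [abs_mul, abs_mul]
      have := mul_le_mul_of_nonneg_right hb (abs_nonneg (ux x t))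
      have := mul_le_mul_of_nonneg_right hc (abs_nonneg (u x t))
      linarith
    · simp [zx, hl]
end LD
set_option autoImplicit false
structure CtxW (T M : Real) (l r : RtR) (a b c u : RRR) : Prop extends Ctx T M l r a b c u where
  rg : ∀ p ∈ domLat l r T, DifferentiableAt Real (fun y => a y p.2) p.1 ∧ DifferentiableAt Real (fun y => pdx a y p.2) p.1 ∧
    DifferentiableAt Real (fun s => a p.1 s) p.2 ∧ |pdx a p.1 p.2| ≤ M ∧ |pdxx a p.1 p.2| ≤ M ∧ |pdt a p.1 p.2| ≤ M
  nz : ∀ t ∈ Icc (0:Real) T, ∃ x ∈ Icc (l t) (r t), u x t ≠0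
  Hi : H1cond (bdryTrace u l) l T
  Hj : H1cond (bdryTrace u r) r T
def Zl (u : RRR) (t x : Real) : Prop := ∃ ρ >0, ∀ z, |z - x| < ρ → u z t =0
def Nl (u : RRR) (t x : Real) : Prop := ∃ δ >0, ∀ p q, p < q → x - δ < p → q < x + δ → ∃ z ∈ Ioo p q, u z t ≠0
theorem Zl.not {u : RRR} {t x : Real} (h : Zl u t x) (h' : Nl u t x) : False := by
  obtain ⟨ρ, ra, h⟩ := h
  obtain ⟨δ, da, h'⟩ := h'
  have ma :0 < min ρ δ := lt_min ra da
  have mc := min_le_left ρ δ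
  have mb := min_le_right ρ δ
  obtain ⟨z, hz, hne⟩ := h' (x - min ρ δ /2) (x + min ρ δ /2) LIN LIN LIN
  exact hne (h z (by rw [abs_lt]; constructor <;> linarith [hz.1, hz.2]))
theorem Zl.op (u : RRR) (t : Real) : IsOpen {x | Zl u t x} := by
  rw [Metric.isOpen_iff]
  rintro x ⟨ρ, ra, h⟩
  refine ⟨ρ /2, POS, fun y hy => ⟨ρ /2, POS, fun z hz => h z ?_⟩⟩
  rw [Metric.mem_ball, Real.dist_eq] at hy
  have := abs_sub_le z y x; linarith
theorem Nl.op (u : RRR) (t : Real) : IsOpen {x | Nl u t x} := by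
  rw [Metric.isOpen_iff]
  rintro x ⟨ρ, ra, h⟩
  refine ⟨ρ /2, POS, fun y hy => ⟨ρ /2, POS, fun p q hpq hp hq => h p q hpq ?_ ?_⟩⟩ <;>
  · rw [Metric.mem_ball, Real.dist_eq, abs_lt] at hy; linarith
namespace CtxW
variable {T M : Real} {l r : RtR} {a b c u : RRR}
theorem ld (C : CtxW T M l r a b c u) {e : Real} (he : SG e) {ξ : RtR} {xa ta ρ τ L : Real} (ra :0 < ρ) (tc :0 < τ) (La :0 < L) (Lτ :2 * L * τ ≤ ρ)
    (ξl : ∀ t s, |t - ta| < τ → |s - ta| < τ → |ξ t - ξ s| ≤ L * |t - s|) (xc : ξ ta ≤ xa)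
    (hin : ∀ x t, |x - xa| <2 * ρ → |t - ta| < τ → ξ t ≤ x → (e * x, t) ∈ domLat l r T)
    (z : ∀ t, |ξ t - xa| <2 * ρ → |t - ta| < τ → u (e * ξ t) t =0 ∧ pdx u (e * ξ t) t =0) :
    LD (fun x t => u (e * x) t) (fun x t => e * pdx u (e * x) t) (fun x t => pdxx u (e * x) t) (fun x t => pdt u (e * x) t)
      (fun x t => a (e * x) t) (fun x t => e * pdx a (e * x) t) (fun x t => pdxx a (e * x) t) (fun x t => pdt a (e * x) t)
      (fun x t => e * b (e * x) t) (fun x t => c (e * x) t) ξ xa ta ρ τ M L := by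
  have ee : e * e =1 := by rcases he with h | h <;> rw [h] <;> norm_num
  have ea : |e| =1 := by rcases he with h | h <;> rw [h] <;> norm_num
  have cp : ∀ {f : RtR} {f' x : Real}, HasDerivAt f f' (e * x) → HasDerivAt (fun x => f (e * x)) (e * f') x := fun {f f' x} hf => by
    have := HasDerivAt.comp (h₂ := f) x hf ((hasDerivAt_id x).const_mul e)
    exact this.congr_deriv RIN
  have mp : MapsTo (fun p : Real × Real => (e * p.1, p.2)) {p | p ∈ QB xa ta (2 * ρ) τ ∧ ξ p.2 ≤ p.1} (domLat l r T) := fun p hp => hin p.1 p.2 hp.1.1 hp.1.2 hp.2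
  have cc : Continuous fun p : Real × Real => (e * p.1, p.2) := FUN
  have dl : domLat l r T ⊆ domCl l r T := fun p hp => ⟨⟨hp.1.1.le, hp.1.2⟩, hp.2⟩
  refine ⟨ra, tc, La, C.Mb, Lτ, ξl, xc, fun x t ho aa ae => ?_, (C.sol.cont.mono dl).comp cc.continuousOn mp, ?_, C.sol.cont_xx.comp cc.continuousOn mp,
    C.sol.cont_t.comp cc.continuousOn mp, fun t ho aa => ?_⟩
  · have hp := hin x t ho aa ae
    obtain ⟨rd, rf, rc, rh, ri, rj⟩ := C.rg _ hp
    obtain ⟨ai, aj⟩ := C.ab _ _ hp.1.1 hp.1.2 hp.2.1 hp.2.2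
    have ec := C.sol.eqn _ hp
    refine ⟨⟨cp (C.sol.diff_x _ hp).hasDerivAt, ?_, (C.sol.diff_t _ hp).hasDerivAt⟩, ⟨cp rd.hasDerivAt, ?_, rc.hasDerivAt⟩, ⟨ai, aj, ?_, ri, rj, ?_, C.cb _ _ hp.1.1 hp.1.2 hp.2.1 hp.2.2⟩, ?_⟩
    · exact ((cp (C.sol.diff_xx _ hp).hasDerivAt).const_mul e).congr_deriv (by rw [← mul_assoc, ee, one_mul]; rfl)
    · exact ((cp rf.hasDerivAt).const_mul e).congr_deriv (by rw [← mul_assoc, ee, one_mul]; rfl)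
    · rw [abs_mul, ea, one_mul]; exact rh
    · rw [abs_mul, ea, one_mul]; exact C.bb _ _ hp.1.1 hp.1.2 hp.2.1 hp.2.2
    · simp only at ec ⊢
      rw [ec]; linear_combination (-(b (e * x) t * pdx u (e * x) t)) * ee
  · exact continuousOn_const.mul (C.sol.cont_x.comp cc.continuousOn mp)
  · have := z t ho aa
    simp [this.1, this.2]
theorem int (C : CtxW T M l r a b c u) {xa ta : Real} (ht : ta ∈ Ioo 0 T) (hx : xa ∈ Ioo (l ta) (r ta)) :
    ∃ (ξ : RtR) (ρ τ d : Real) (uxx ut S Sx : RRR) (G : Set (Real × Real)) (xm m N Λ : Real),0 < d ∧ d ≤ ρ ∧ d ≤ τ ∧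
      (∀ x t, (x, t) ∈ QB xa ta ρ τ → t ∈ Ioo 0 T ∧ x ∈ Ioo (l t) (r t) ∧ ξ t < x) ∧
      QX (zx ξ fun x t => u (1 * x) t) (zx ξ fun x t =>1 * pdx u (1 * x) t) uxx ut S Sx G xa ta xm ρ τ M m N Λ := by
  have ev : ∀ᶠ p : Real × Real in 𝓝 (xa, ta), p.2 ∈ Ioo 0 T ∧ p.1 ∈ Ioo (l p.2) (r p.2) := by
    have ce := C.cl; have ch := C.cr
    have kb : ContinuousAt (fun p : Real × Real => p.2) (xa, ta) := continuousAt_snd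
    filter_upwards [kb.eventually (Ioo_mem_nhds ht.1 ht.2),
      ContinuousAt.eventually_lt (f := fun p : Real × Real => l p.2) (g := fun p => p.1) (x₀ := (xa, ta)) FUN FUN hx.1,
      ContinuousAt.eventually_lt (f := fun p : Real × Real => p.1) (g := fun p => r p.2) (x₀ := (xa, ta)) FUN FUN hx.2] with p ho aa ae
    exact ⟨ho, aa, ae⟩
  obtain ⟨d, de, hd⟩ := Metric.eventually_nhds_iff.1 ev
  have hd' : ∀ x t, |x - xa| < d → |t - ta| < d → t ∈ Ioo 0 T ∧ x ∈ Ioo (l t) (r t) := fun x t ho aa =>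
    hd (y := (x, t)) (by rw [Prod.dist_eq, max_lt_iff]; exact ⟨ho, aa⟩)
  obtain ⟨S, Sx, G, xm, m, N, Λ, hq⟩ := (C.ld (e :=1) (Or.inl rfl) (ξ := fun _ => xa - d -1) (xa := xa) (ta := ta) (ρ := d /2) (τ := d /4) (L :=1)
    POS POS one_pos LIN SIM LIN
    (fun x t ho aa _ => by
      obtain ⟨ai, aj⟩ := hd' x t LIN LIN
      rw [one_mul]
      exact ⟨⟨ai.1, ai.2.le⟩, aj.1.le, aj.2.le⟩)
    (fun t ho _ => by have := (abs_lt.1 ho).1; linarith)).qx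
  refine ⟨_, _, _, d /4, _, _, S, Sx, G, xm, m, N, Λ, POS, LIN, le_rfl, fun x t hp => ?_, hq⟩
  have ho : |x - xa| < d /2 := hp.1
  have aa : |t - ta| < d /4 := hp.2
  obtain ⟨ai, aj⟩ := hd' x t LIN LIN
  exact ⟨ai, aj, by linarith [(abs_lt.1 ho).1]⟩
theorem uc (C : CtxW T M l r a b c u) : ∀ t ∈ Ioo 0 T, ∀ p q, l t ≤ p → p < q → q ≤ r t → ∃ x ∈ Ioo p q, u x t ≠0 := by
  intro t ht
  have tI : t ∈ Icc 0 T := Ioo_subset_Icc_self ht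
  have dich : ∀ x ∈ Ioo (l t) (r t), Zl u t x ∨ Nl u t x := fun x hx => by
    obtain ⟨ξ, ρ, τ, d, uxx, ut, S, Sx, G, xm, m, N, Λ, de, dρ, dτ, hin, hq⟩ := C.int ht hx
    have e : ∀ z, |z - x| < d → zx ξ (fun x t => u (1 * x) t) z t = u z t := fun z hz => by
      have := (hin z t ⟨hz.trans_le dρ, by simpa using de.trans_le dτ⟩).2.2
      simp [zx, this]
    rcases hq.uc with ⟨ρ', ra, h⟩ | ⟨δ, da, h⟩
    · left
      refine ⟨min ρ' d, lt_min ra de, fun z hz => ?_⟩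
      rw [lt_min_iff] at hz
      rw [← e z hz.2]; exact h z hz.1
    · right
      have mc := min_le_left δ d
      have mb := min_le_right δ d
      refine ⟨min δ d, lt_min da de, fun p q hpq hp hq => ?_⟩
      obtain ⟨z, hz, hne⟩ := h p q hpq LIN LIN
      refine ⟨z, hz, ?_⟩
      rwa [e z (by rw [abs_lt]; constructor <;> linarith [hz.1, hz.2])] at hne
  have hN : ∀ x ∈ Ioo (l t) (r t), Nl u t x := by
    by_contra! hh
    obtain ⟨x, hx, hn⟩ := hh
    have hz := (dich x hx).resolve_right hn
    have := isPreconnected_Ioo.subset_left_of_subset_union (Zl.op u t) (Nl.op u t)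
      (Set.disjoint_left.2 fun x ho aa => Zl.not ho aa) dich ⟨x, hx, hz⟩
    obtain ⟨y, hy, hne⟩ := C.nz t tI
    have cu : ContinuousOn (fun y => u y t) (Icc (l t) (r t)) := C.sol.cont.comp (f := fun y => (y, t)) FUN fun y hy => ⟨tI, hy⟩
    have zd : ∀ y ∈ Ioo (l t) (r t), u y t =0 := fun y hy => by
      obtain ⟨ρ, ra, h⟩ := this hy
      exact h y (by simpa using ra)
    rw [← closure_Ioo (C.lt t tI).ne] at cu hy
    exact hne (Set.EqOn.of_subset_closure (f := fun y => u y t) (g := fun _ =>0) zd cu continuousOn_const subset_closure subset_rfl hy)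
  intro p q hp hpq hq
  obtain ⟨δ, da, h⟩ := hN ((p + q) /2) ⟨LIN, LIN⟩
  set m := min (δ /2) ((q - p) /2)
  have ma :0 < m := lt_min POS LIN
  have mc : m ≤ δ /2 := min_le_left _ _
  have mb : m ≤ (q - p) /2 := min_le_right _ _
  obtain ⟨x, hx, hne⟩ := h ((p + q) /2 - m) ((p + q) /2 + m) LIN LIN LIN
  exact ⟨x, ⟨by linarith [hx.1], by linarith [hx.2]⟩, hne⟩
theorem gen (C : CtxW T M l r a b c u) : volume {t | t ∈ Ioo 0 T ∧ ∃ x ∈ Ioo (l t) (r t), u x t =0 ∧ pdx u x t =0} =0 := by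
  have loc : ∀ p : Real × Real, ∃ δ >0, (p.2 ∈ Ioo 0 T ∧ p.1 ∈ Ioo (l p.2) (r p.2)) → volume {t | |t - p.2| < δ ∧ ∃ x, |x - p.1| < δ ∧ u x t =0 ∧ pdx u x t =0} =0 := by
    rintro ⟨xa, ta⟩
    by_cases hp : ta ∈ Ioo 0 T ∧ xa ∈ Ioo (l ta) (r ta)
    · obtain ⟨ξ, ρ, τ, d, uxx, ut, S, Sx, G, xm, m, N, Λ, de, dρ, dτ, hin, hq⟩ := C.int hp.1 hp.2
      obtain ⟨δ, da, h⟩ := hq.gen fun x t hx => by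
        rintro ⟨s, sf, hs⟩
        obtain ⟨ia, ic, ie⟩ := hin x t hx
        have ma :0 < min s (r t - x) := lt_min sf (by linarith [ic.2])
        have mc := min_le_left s (r t - x)
        have mb := min_le_right s (r t - x)
        obtain ⟨z, hz, hne⟩ := C.uc t ia x (x + min s (r t - x)) ic.1.le LIN LIN
        have := hs z (by rw [abs_lt]; constructor <;> linarith [hz.1, hz.2])
        simp only [zx, ie.trans hz.1, if_true, one_mul] at this
        exact hne this
      refine ⟨min δ d, lt_min da de, fun _ => measure_mono_null ?_ h⟩
      rintro t ⟨ho, x, aa, ae, ag⟩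
      simp only [lt_min_iff] at ho aa
      have := (hin x t ⟨aa.2.trans_le dρ, ho.2.trans_le dτ⟩).2.2
      exact ⟨ho.1, x, aa.1, by simp [zx, this, ae], by simp [zx, this, ag]⟩
    · exact ⟨1, one_pos, fun h => absurd h hp⟩
  choose δ da hδ using loc
  obtain ⟨K, hK, cK, cov⟩ := TopologicalSpace.countable_cover_nhdsWithin (s := {p : Real × Real | p.2 ∈ Ioo 0 T ∧ p.1 ∈ Ioo (l p.2) (r p.2)})
    (f := fun p => QB p.1 p.2 (δ p) (δ p)) fun p _ => mem_nhdsWithin_of_mem_nhds ((QB_open _ _ _ _).mem_nhds ⟨by simpa using da p, by simpa using da p⟩)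
  refine measure_mono_null ?_ ((measure_biUnion_null_iff cK).2 fun p hp => hδ p (hK hp))
  rintro t ⟨ht, x, hx, ho, aa⟩
  obtain ⟨p, hp, hq⟩ := mem_iUnion₂.1 (cov (show (x, t) ∈ {p : Real × Real | p.2 ∈ Ioo 0 T ∧ p.1 ∈ Ioo (l p.2) (r p.2)} from ⟨ht, hx⟩))
  exact mem_iUnion₂.2 ⟨p, hp, hq.2, x, hq.1, ho, aa⟩
theorem bnd (C : CtxW T M l r a b c u) {e : Real} (he : SG e) {ξ ζ : RtR} (cξ : Continuous ξ) (cζ : Continuous ζ) (hlt : ∀ t ∈ Icc 0 T, ξ t < ζ t)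
    (hin : ∀ x t, t ∈ Ioc 0 T → ξ t ≤ x → x ≤ ζ t → (e * x, t) ∈ domLat l r T)
    (huc : ∀ t ∈ Ioo 0 T, ∀ p q, ξ t ≤ p → p < q → q ≤ ζ t → ∃ x ∈ Ioo p q, u (e * x) t ≠0)
    (H1 : ∀ p q : Real,0 ≤ p → p < q → q ≤ T → (∀ t ∈ Icc p q, u (e * ξ t) t =0) → ContDiffOn Real 1 ξ (Icc p q))
    {p q : Real} (hp :0 ≤ p) (hpq : p < q) (hq : q ≤ T) : ∃ t ∈ Ioo p q, ¬ (u (e * ξ t) t =0 ∧ pdx u (e * ξ t) t =0) := by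
  by_contra! hz
  set k := (q - p) /4 with hk
  set ta := (p + q) /2 with al
  have sub : Icc (ta - k) (ta + k) ⊆ Ioo p q := fun t ht => ⟨by linarith [ht.1], by linarith [ht.2]⟩
  obtain ⟨K, hK⟩ := (H1 (ta - k) (ta + k) LIN LIN LIN fun t ht => (hz t (sub ht)).1).exists_lipschitzOnWith one_ne_zero
    (convex_Icc _ _) isCompact_Icc
  have tI : ta ∈ Ioo 0 T := ⟨LIN, LIN⟩
  obtain ⟨d, de, hd⟩ := Metric.eventually_nhds_iff.1 (ContinuousAt.eventually_lt (f := fun p : Real × Real => p.1) (g := fun p => ζ p.2) (x₀ := (ξ ta, ta)) FUN FUN (hlt ta (Ioo_subset_Icc_self tI)))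
  set L : Real := K +1 with hL
  have La :0 < L := POS
  set τ := min (min k d) (d / (4 * L)) with hτ
  have tc :0 < τ := lt_min (lt_min LIN de) POS
  have th : τ ≤ k := (min_le_left _ _).trans (min_le_left _ _)
  have ti : τ ≤ d := (min_le_left _ _).trans (min_le_right _ _)
  have tj :2 * L * τ ≤ d /2 := by
    have :2 * L * τ ≤2 * L * (d / (4 * L)) := by gcongr; exact min_le_right _ _
    rw [show 2 * L * (d / (4 * L)) = d /2 by field_simp; ring] at this; exact this
  have tm : ∀ t, |t - ta| < τ → t ∈ Icc (ta - k) (ta + k) := fun t ht => by rw [abs_lt] at ht; constructor <;> linarith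
  obtain ⟨S, Sx, G, xm, m, N, Λ, hq⟩ := (C.ld he (ξ := ξ) (xa := ξ ta) (ta := ta) (ρ := d /2) (τ := τ) (L := L) POS tc La tj
    (fun t s ht hs => by
      have := hK.dist_le_mul t (tm t ht) s (tm s hs)
      rw [Real.dist_eq, Real.dist_eq] at this
      rw [hL]; linarith [abs_nonneg (t - s)]) le_rfl
    (fun x t ho aa ae => by
      have := sub (tm t aa)
      exact hin x t ⟨by linarith [this.1], by linarith [this.2]⟩ ae
        (hd (y := (x, t)) (by rw [Prod.dist_eq, max_lt_iff]; exact ⟨lt_of_lt_of_le ho LIN, aa.trans_le ti⟩)).le)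
    (fun t _ aa => hz t (sub (tm t aa)))).qx
  rcases hq.uc with ⟨ρ', ra, h⟩ | ⟨δ, da, h⟩
  · have hl := hlt ta (Ioo_subset_Icc_self tI)
    have ma :0 < min ρ' (ζ ta - ξ ta) := lt_min ra LIN
    have mc := min_le_left ρ' (ζ ta - ξ ta)
    have mb := min_le_right ρ' (ζ ta - ξ ta)
    obtain ⟨z, hz, hne⟩ := huc ta tI (ξ ta) (ξ ta + min ρ' (ζ ta - ξ ta)) le_rfl LIN LIN
    have := h z (by rw [abs_lt]; constructor <;> linarith [hz.1, hz.2])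
    simp only [zx, hz.1, if_true] at this
    exact hne this
  · obtain ⟨z, hz, hne⟩ := h (ξ ta - δ /2) (ξ ta - δ /4) LIN LIN LIN
    have : ¬ ξ ta < z := by linarith [hz.2]
    simp [zx, this] at hne
theorem good (C : CtxW T M l r a b c u) {t : Real} (ht : t ∈ Ioo 0 T) : ∃ s ∈ Ioo 0 t, ∀ x ∈ Icc (l s) (r s), ¬ (u x s =0 ∧ pdx u x s =0) := by
  have cl := C.cl; have cr := C.cr
  have huc := C.uc
  have op : ∀ ξ : RtR, Continuous ξ → (∀ s ∈ Ioc 0 T, (ξ s, s) ∈ domLat l r T) → ∀ s ∈ Ioo 0 T, ¬ (u (ξ s) s =0 ∧ pdx u (ξ s) s =0) →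
      ∀ᶠ s' in 𝓝 s, ¬ (u (ξ s') s' =0 ∧ pdx u (ξ s') s' =0) := fun ξ cξ hin s hs hn => by
    have N : Ioc 0 T ∈ 𝓝 s := Ioc_mem_nhds hs.1 hs.2
    have ce : ContinuousAt (fun s => u (ξ s) s) s := (C.sol.cont.comp (f := fun s => (ξ s, s)) (s := Ioc 0 T) FUN
      fun s hs => ⟨⟨hs.1.le, hs.2⟩, (hin s hs).2⟩).continuousAt N
    have ch : ContinuousAt (fun s => pdx u (ξ s) s) s := (C.sol.cont_x.comp (f := fun s => (ξ s, s)) (s := Ioc 0 T) FUN hin).continuousAt N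
    rw [not_and_or] at hn
    rcases hn with hn | hn
    · filter_upwards [ce.eventually_ne hn] with s' ho aa using ho aa.1
    · filter_upwards [ch.eventually_ne hn] with s' ho aa using ho aa.2
  have lT : ∀ s ∈ Ioc 0 T, l s < r s := fun s hs => C.lt s ⟨hs.1.le, hs.2⟩
  obtain ⟨sd, ho, nd⟩ := C.bnd (e :=1) (Or.inl rfl) cl cr C.lt (fun x t ht ho aa => by rw [one_mul]; exact ⟨ht, ho, aa⟩)
    (by simpa using huc) (fun p q ho aa ae ag => C.Hi p q ho aa ae (by simpa [bdryTrace] using ag)) le_rfl ht.1 ht.2.le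
  rw [one_mul] at nd
  have ob := op l cl (fun s hs => ⟨hs, le_rfl, (lT s hs).le⟩) sd ⟨ho.1, ho.2.trans ht.2⟩ nd
  obtain ⟨p, q, bj, hpq⟩ := mem_nhds_iff_exists_Ioo_subset.1 (ob.and (Ioo_mem_nhds ho.1 ho.2))
  have hpq' : Ioo p q ⊆ Ioo 0 t := fun s hs => (hpq hs).2
  have lj : p < q := bj.1.trans bj.2
  have pq := (Ioo_subset_Ioo_iff lj).1 hpq'
  obtain ⟨sc, aa, nf⟩ := C.bnd (e := -1) (Or.inr rfl) cr.neg cl.neg (fun t ht => neg_lt_neg (C.lt t ht))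
    (fun x t ht ho aa => ⟨ht, by simp only [Pi.neg_apply] at aa ⊢; linarith, by simp only [Pi.neg_apply] at ho ⊢; linarith⟩)
    (fun t ht p q ho aa ae => by
      simp only [Pi.neg_apply] at ho ae
      obtain ⟨x, hx, hne⟩ := huc t ht (-q) (-p) LIN LIN LIN
      exact ⟨-x, ⟨by linarith [hx.2], by linarith [hx.1]⟩, by simpa using hne⟩)
    (fun p q ho aa ae ag => (C.Hj p q ho aa ae (by simpa [bdryTrace] using ag)).neg) pq.1 lj (pq.2.trans ht.2.le)
  have ng : ¬ (u (r sc) sc =0 ∧ pdx u (r sc) sc =0) := by simpa using nf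
  have bq := hpq' aa
  have oa := op r cr (fun s hs => ⟨hs, (lT s hs).le, le_rfl⟩) sc ⟨bq.1, bq.2.trans ht.2⟩ ng
  obtain ⟨p', q', bu, fz⟩ := mem_nhds_iff_exists_Ioo_subset.1 (oa.and (Ioo_mem_nhds aa.1 aa.2))
  have ex : ∃ s ∈ Ioo p' q', s ∉ {t | t ∈ Ioo 0 T ∧ ∃ x ∈ Ioo (l t) (r t), u x t =0 ∧ pdx u x t =0} := by
    by_contra! hh
    have := measure_mono_null hh C.gen
    rw [Real.volume_Ioo, ENNReal.ofReal_eq_zero] at this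
    linarith [bu.1, bu.2]
  obtain ⟨s, hs, hn⟩ := ex
  have be := fz hs
  have bc := hpq be.2
  refine ⟨s, bc.2, fun x hx hd => ?_⟩
  have sT : s ∈ Ioo 0 T := ⟨bc.2.1, bc.2.2.trans ht.2⟩
  rcases hx.1.eq_or_lt with e | ec
  · subst e; exact bc.1 hd
  rcases hx.2.eq_or_lt with e | ed
  · subst e; exact be.1 hd
  exact hn ⟨sT, x, ⟨ec, ed⟩, hd⟩
theorem start (C : CtxW T M l r a b c u) {t : Real} (ht : t ∈ Ioo 0 T) : ∃ s ∈ Ioo 0 t, ∃ n, NoAlt u l r s n := by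
  obtain ⟨s, hs, hg⟩ := C.good ht
  refine ⟨s, hs, ?_⟩
  have sm : ∀ x ∈ Icc (l s) (r s), (x, s) ∈ domLat l r T := fun x hx => ⟨⟨hs.1, (hs.2.trans ht.2).le⟩, hx⟩
  have dx : ∀ x ∈ Icc (l s) (r s), HasDerivAt (fun y => u y s) (pdx u x s) x := fun x hx => (C.sol.diff_x _ (sm x hx)).hasDerivAt
  have fin : (zeroSet u l r s).Finite := by
    by_contra hi
    obtain ⟨x, hx, hacc⟩ := Set.Infinite.exists_accPt_of_subset_isCompact hi isCompact_Icc (sep_subset _ _)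
    have ev : ∀ᶠ z in 𝓝[≠] x, u z s ≠0 := by
      by_cases af : pdx u x s =0
      · exact ((dx x hx).continuousAt.eventually_ne fun h => hg x hx ⟨h, af⟩).filter_mono nhdsWithin_le_nhds
      · exact (dx x hx).eventually_ne af
    rw [accPt_iff_frequently_nhdsNE] at hacc
    obtain ⟨z, hz, hne⟩ := (hacc.and_eventually ev).exists
    exact hne hz.2
  refine ⟨fin.toFinset.card +2, fun e he ⟨f, fa, fd, ff⟩ => ?_⟩
  have hz : ∀ i, ∃ z, i < fin.toFinset.card +1 → z ∈ Ioo (f i) (f (i +1)) ∧ u z s =0 := fun i => by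
    by_cases hi : i < fin.toFinset.card +1
    · have ai := fa i OME
      have aj := fa (i +1) OME
      have lt := fd i OME
      have bc := ff i OME
      have be := ff (i +1) OME
      set g : RtR := fun z => e * (-1) ^ i * u z s with hg
      have cg : ContinuousOn g (Icc (f i) (f (i +1))) := fun z hz =>
        ((dx z ⟨by linarith [ai.1, hz.1], by linarith [aj.2, hz.2]⟩).continuousAt.const_mul _).continuousWithinAt
      have ve : g (f (i +1)) <0 := by simp only [hg]; rw [pow_succ] at be; linarith
      obtain ⟨z, hz, af⟩ := intermediate_value_Ioo' lt.le cg (⟨ve, bc⟩ : (0:Real) ∈ Ioo (g (f (i +1))) (g (f i)))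
      have hk : e * (-1) ^ i ≠0 := fun hk => by rw [hk, zero_mul] at bc; exact lt_irrefl _ bc
      exact ⟨z, fun _ => ⟨hz, (mul_eq_zero.1 af).resolve_left hk⟩⟩
    · exact ⟨0, fun h => absurd h hi⟩
  choose z hz using hz
  have mono : ∀ i j, i < j → j < fin.toFinset.card +1 → z i < z j := fun i j hij => by
    induction j, hij using Nat.le_induction with
    | base => intro hj; exact (hz i OME).1.2.trans (hz (i +1) hj).1.1
    | succ j hj ih => intro h; exact (ih OME).trans ((hz j OME).1.2.trans (hz (j +1) h).1.1)
  have inj : Set.InjOn z (Finset.range (fin.toFinset.card +1) : Set ℕ) := fun i hi j hj hij => by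
    simp only [Finset.coe_range, mem_Iio] at hi hj
    rcases lt_trichotomy i j with h | h | h
    · exact absurd hij (mono i j h hj).ne
    · exact h
    · exact absurd hij (mono j i h hi).ne'
  have := Finset.card_le_card_of_injOn z (s := Finset.range (fin.toFinset.card +1)) (t := fin.toFinset) (fun i hi => by
    have hi : i < fin.toFinset.card +1 := by simpa using hi
    have ai := fa i OME
    have aj := fa (i +1) OME
    have := (hz i hi)
    simp only [Finite.coe_toFinset]
    exact ⟨⟨by linarith [ai.1, this.1.1], by linarith [aj.2, this.1.2]⟩, this.2⟩) inj
  rw [Finset.card_range] at this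
  omega
end CtxW
theorem dm_congr {l r l' r' : RtR} {T : Real} (hl : ∀ t ∈ Icc (0:Real) T, l t = l' t) (hr : ∀ t ∈ Icc (0:Real) T, r t = r' t) :
    domCl l r T = domCl l' r' T ∧ domLat l r T = domLat l' r' T := by
  constructor
  · ext p
    refine and_congr_right fun h => ?_
    rw [hl _ h, hr _ h]
  · ext p
    refine and_congr_right fun h => ?_
    rw [hl _ ⟨h.1.le, h.2⟩, hr _ ⟨h.1.le, h.2⟩]
theorem sol_congr {l r l' r' : RtR} {T : Real} {a b c u : RRR} (hl : ∀ t ∈ Icc (0:Real) T, l t = l' t)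
    (hr : ∀ t ∈ Icc (0:Real) T, r t = r' t) (h : IsClassicalSolution a b c l r T u) :
    IsClassicalSolution a b c l' r' T u := by
  obtain ⟨ec, ed⟩ := dm_congr hl hr
  exact ⟨ec ▸ h.cont, ed ▸ h.diff_x, ed ▸ h.diff_xx, ed ▸ h.diff_t, ed ▸ h.cont_x, ed ▸ h.cont_xx, ed ▸ h.cont_t, ed ▸ h.eqn⟩
theorem H1_congr {l l' : RtR} {T : Real} {u : RRR} (hl : ∀ t ∈ Icc (0:Real) T, l t = l' t)
    (h : H1cond (bdryTrace u l) l T) : H1cond (bdryTrace u l') l' T := by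
  intro p q ho aa ae ag
  have hs : ∀ t ∈ Icc p q, l t = l' t := fun t ht => hl t ⟨ho.trans ht.1, ht.2.trans ae⟩
  refine (h p q ho aa ae fun t ht => ?_).congr fun t ht => (hs t ht).symm
  have := ag t ht
  simp only [bdryTrace] at this ⊢
  rw [hs t ht]; exact this
theorem NZ_congr {l l' : RtR} {T : Real} {u : RRR} (hl : ∀ t ∈ Icc (0:Real) T, l t = l' t) {s : Real} (hs : s ∈ Ioo 0 T)
    (h : IsNZstar (bdryTrace u l') s) : IsNZstar (bdryTrace u l) s := by
  obtain ⟨af, ε, ef, h⟩ := h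
  simp only [bdryTrace] at af h
  refine ⟨by simp only [bdryTrace]; rw [hl s ⟨hs.1.le, hs.2.le⟩]; exact af, min ε s, lt_min ef hs.1, fun t ht => ?_⟩
  have mc := min_le_left ε s
  have mb := min_le_right ε s
  simp only [bdryTrace]
  rw [hl t ⟨by linarith [ht.1], by linarith [ht.2, hs.2]⟩]
  exact h t ⟨by linarith [ht.1], ht.2⟩
theorem H2_congr {l l' : RtR} {T : Real} {u : RRR} (hl : ∀ t ∈ Icc (0:Real) T, l t = l' t) {s σ : Real} (hs : s ∈ Ioo 0 T)
    (h : H2at u l σ s) : H2at u l' σ s := by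
  obtain ⟨⟨L, hL⟩, ho, aa⟩ := h
  have es := hl s ⟨hs.1.le, hs.2.le⟩
  refine ⟨⟨L, hL.congr_of_eventuallyEq ?_ es.symm⟩, ?_, ?_⟩
  · filter_upwards [nhdsWithin_le_nhds (Ioo_mem_nhds hs.1 hs.2)] with t ht using (hl t ⟨ht.1.le, ht.2.le⟩).symm
  · rintro ⟨ε, ef, h⟩
    rw [← es]
    refine ho ⟨min ε s, lt_min ef hs.1, fun t ht => ?_⟩
    have mc := min_le_left ε s
    have mb := min_le_right ε s
    rw [hl t ⟨by linarith [ht.1], by linarith [ht.2, hs.2]⟩]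
    exact h t ⟨by linarith [ht.1], ht.2⟩
  · rintro ⟨ε, ef, h⟩
    rw [← es]
    refine aa ⟨min ε s, lt_min ef hs.1, fun t ht => ?_⟩
    have mc := min_le_left ε s
    have mb := min_le_right ε s
    rw [hl t ⟨by linarith [ht.1], by linarith [ht.2, hs.2]⟩]
    exact h t ⟨by linarith [ht.1], ht.2⟩
theorem H3_congr {l r l' r' k k' : RtR} {T : Real} {u : RRR} (hl : ∀ t ∈ Icc (0:Real) T, l t = l' t)
    (hr : ∀ t ∈ Icc (0:Real) T, r t = r' t) (hk : ∀ t ∈ Icc (0:Real) T, k t = k' t) {s σ : Real} (hs : s ∈ Ioo 0 T)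
    (h : H3at u l r k σ s) : H3at u l' r' k' σ s := by
  obtain ⟨ε, ef, δ, da, h⟩ := h
  have sm : s ∈ Icc 0 T := ⟨hs.1.le, hs.2.le⟩
  refine ⟨min ε (T - s), lt_min ef (by linarith [hs.2]), δ, da, fun t ht x hx ho aa => ?_⟩
  have mc := min_le_left ε (T - s)
  have mb := min_le_right ε (T - s)
  rw [← hk t ⟨by linarith [ht.1, hs.1], by linarith [ht.2]⟩]
  rw [← hl s sm, ← hr s sm] at hx
  rw [← hk s sm] at ho aa
  exact h t ⟨ht.1, by linarith [ht.2]⟩ x hx ho aa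
theorem main_zero_number_finite
    (T : ℝ) (xi1 xi2 : ℝ → ℝ) (a b c u : ℝ → ℝ → ℝ)
    (hT : 0 < T)
    (hxc1 : ContinuousOn xi1 (Icc 0 T)) (hxc2 : ContinuousOn xi2 (Icc 0 T))
    (hxlt : ∀ t ∈ Icc (0:ℝ) T, xi1 t < xi2 t)
    (hsol : IsClassicalSolution a b c xi1 xi2 T u)
    (hreg : Reg12 a b c xi1 xi2 T)
    (hnz : ∀ t ∈ Icc (0:ℝ) T, ∃ x ∈ Icc (xi1 t) (xi2 t), u x t ≠ 0)
    (hH1a : H1cond (bdryTrace u xi1) xi1 T) (hH1b : H1cond (bdryTrace u xi2) xi2 T)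
    (hH2a : ∀ s ∈ Ioo (0:ℝ) T, IsNZstar (bdryTrace u xi1) s → H2at u xi1 (-1) s)
    (hH2b : ∀ s ∈ Ioo (0:ℝ) T, IsNZstar (bdryTrace u xi2) s → H2at u xi2 1 s)
    (hH3a : ∀ s ∈ Ioo (0:ℝ) T, bdryTrace u xi1 s = 0 → H3at u xi1 xi2 xi1 (-1) s)
    (hH3b : ∀ s ∈ Ioo (0:ℝ) T, bdryTrace u xi2 s = 0 → H3at u xi1 xi2 xi2 1 s) :
    ∀ t ∈ Ioo (0:ℝ) T, Znum u xi1 xi2 t < ⊤ := by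
  obtain ⟨l, cl, hl⟩ : ∃ l : RtR, Continuous l ∧ ∀ t ∈ Icc (0:Real) T, xi1 t = l t :=
    ⟨Set.IccExtend hT.le ((Icc 0 T).restrict xi1), hxc1.restrict.Icc_extend', fun t ht => by
      rw [Set.IccExtend_of_mem _ _ ht]; rfl⟩
  obtain ⟨r, cr, hr⟩ : ∃ l : RtR, Continuous l ∧ ∀ t ∈ Icc (0:Real) T, xi2 t = l t :=
    ⟨Set.IccExtend hT.le ((Icc 0 T).restrict xi2), hxc2.restrict.Icc_extend', fun t ht => by
      rw [Set.IccExtend_of_mem _ _ ht]; rfl⟩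
  obtain ⟨Ma, hM⟩ := hreg
  rw [(dm_congr hl hr).2] at hM
  have mm : Ma ≤ max 1 Ma := le_max_right _ _
  have W : CtxW T (max 1 Ma) l r a b c u :=
    { cl := cl, cr := cr, Ta := hT
      lt := fun t ht => by rw [← hl t ht, ← hr t ht]; exact hxlt t ht
      sol := sol_congr hl hr hsol
      Mb := le_max_left _ _
      ab := fun x t ho aa ae ag => by
        obtain ⟨gb, gd, gc, gf, gh, gn, gi, gj, -⟩ := hM (x, t) ⟨⟨ho, aa⟩, ae, ag⟩
        simp only at gb gi gj
        refine ⟨?_, (le_abs_self _).trans (gi.trans mm)⟩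
        exact inv_le_of_inv_le₀ gb ((le_abs_self _).trans (gj.trans mm))
      bb := fun x t ho aa ae ag => by
        obtain ⟨gb, gd, gc, gf, gh, gn, gi, gj, gp, gq, gr, gu, -⟩ := hM (x, t) ⟨⟨ho, aa⟩, ae, ag⟩
        exact gu.trans mm
      cb := fun x t ho aa ae ag => by
        obtain ⟨gb, gd, gc, gf, gh, gn, gi, gj, gp, gq, gr, gu, js, jt, gz⟩ := hM (x, t) ⟨⟨ho, aa⟩, ae, ag⟩
        exact gz.trans mm
      rg := fun p hp => by
        obtain ⟨gb, gd, gc, gf, gh, gn, gi, gj, gp, gq, gr, -⟩ := hM p hp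
        exact ⟨gd, gc, gf, gq.trans mm, gr.trans mm, gp.trans mm⟩
      nz := fun t ht => by rw [← hl t ht, ← hr t ht]; exact hnz t ht
      Hi := H1_congr hl hH1a
      Hj := H1_congr hr hH1b }
  have C : Ca T (max 1 Ma) l r a b c u :=
    { toCtx := W.toCtx
      uc := W.uc
      He := fun s hs h => H2_congr hr hs (hH2b s hs (NZ_congr hr hs h))
      Hf := fun s hs h => H3_congr hl hr hl hs (hH3a s hs (by
        simp only [bdryTrace] at h ⊢; rw [hl s ⟨hs.1.le, hs.2.le⟩]; exact h))
      Hg := fun s hs h => H3_congr hl hr hr hs (hH3b s hs (by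
        simp only [bdryTrace] at h ⊢; rw [hr s ⟨hs.1.le, hs.2.le⟩]; exact h)) }
  intro t ht
  obtain ⟨s, hs, n, hn⟩ := W.start ht
  have F := C.final hs.1 hs.2 ht.2 hn
  have tm : t ∈ Icc 0 T := ⟨ht.1.le, ht.2.le⟩
  unfold Znum
  rw [Set.encard_lt_top_iff]
  unfold zeroSet at F ⊢
  rw [hl t tm, hr t tm]
  exact F
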